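/- arXiv:1704.06314 — 2 statements merged into one kernel-verified Lean document; each statement's English description precedes it below -/
import Mathlib

section
/- Let α ∈ (1/2, 1) be a constant. There exist constants c > 0 and n₀ ∈ ℕ such that for every n ≥ n₀, every integer k with 1 ≤ k ≤ αn, and every real ε with 2^{−n} ≤ ε ≤ 1/6, the following holds: every randomized non-adaptive q-query algorithm that is an ε-tester for k-juntas on n-variable Boolean functions satisfies q ≥ c · k^{3/2} / (ε · (log₂(2 + k/ε))^6). -/
/-- `f : {0,1}^n → {0,1}` is a `k`-junta: there is a set `S ⊆ [n]` with `|S| ≤ k`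
such that `f x = f y` whenever `x` and `y` agree on all coordinates in `S`. -/
def IsJunta (n k : ℕ) (f : (Fin n → Bool) → Bool) : Prop :=
  ∃ S : Finset (Fin n), S.card ≤ k ∧
    ∀ x y : Fin n → Bool, (∀ i ∈ S, x i = y i) → f x = f y

/-- `f` is `ε`-far from every `k`-junta. -/
def FarFromJuntas (n k : ℕ) (ε : ℝ) (f : (Fin n → Bool) → Bool) : Prop :=
  ∀ g : (Fin n → Bool) → Bool, IsJunta n k g →
    ε * 2 ^ n ≤ ((Finset.univ.filter (fun x => f x ≠ g x)).card : ℝ)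

/-- A randomized non-adaptive `q`-query algorithm on `n`-variable Boolean functions:
a probability distribution over pairs `(X, h)` with `X` a tuple of `q` query strings
and `h` a map from the `q` answer bits to accept (`true`) / reject (`false`). -/
structure RandNonAdaptive (n q : ℕ) where
  w : ((Fin q → (Fin n → Bool)) × ((Fin q → Bool) → Bool)) → ℝ
  nonneg : ∀ p, 0 ≤ w p
  sum_eq_one : ∑ p, w p = 1

/-- Probability that the algorithm accepts `f`. -/
def acceptProb {n q : ℕ} (A : RandNonAdaptive n q) (f : (Fin n → Bool) → Bool) : ℝ :=
  ∑ p, if p.2 (fun i => f (p.1 i)) = true then A.w p else 0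

/-- Probability that the algorithm rejects `f`. -/
def rejectProb {n q : ℕ} (A : RandNonAdaptive n q) (f : (Fin n → Bool) → Bool) : ℝ :=
  ∑ p, if p.2 (fun i => f (p.1 i)) = false then A.w p else 0

/-- An `ε`-tester for `k`-juntas: accepts every `k`-junta with probability ≥ 5/6 and
rejects every function that is `ε`-far from every `k`-junta with probability ≥ 5/6. -/
def IsJuntaTester (n k q : ℕ) (ε : ℝ) (A : RandNonAdaptive n q) : Prop :=
  (∀ f, IsJunta n k f → 5 / 6 ≤ acceptProb A f) ∧
  (∀ f, FarFromJuntas n k ε f → 5 / 6 ≤ rejectProb A f)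

namespace JLB
open Finset

/-- Bernoulli product weight. -/
noncomputable def bw {ι : Type*} [Fintype ι] (p : ι → ℝ) (x : ι → Bool) : ℝ :=
  ∏ i, if x i = true then p i else 1 - p i

theorem bw_prod {ι : Type*} [Fintype ι] [DecidableEq ι] (p : ι → ℝ) (g : ι → Bool → ℝ) :
    ∑ x : ι → Bool, bw p x * ∏ i, g i (x i) = ∏ i, (p i * g i true + (1 - p i) * g i false) := by
  have h := Fintype.prod_sum (fun i (b : Bool) => (if b = true then p i else 1 - p i) * g i b)
  simp only [Fintype.sum_bool] at h
  simp only [bw, ← Finset.prod_mul_distrib]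
  rw [← h]
  simp

theorem bw_sum {ι : Type*} [Fintype ι] [DecidableEq ι] (p : ι → ℝ) :
    ∑ x : ι → Bool, bw p x = 1 := by
  have h := bw_prod p (fun _ _ => 1)
  simpa using h

theorem bw_nonneg {ι : Type*} [Fintype ι] (p : ι → ℝ) (h0 : ∀ i, 0 ≤ p i) (h1 : ∀ i, p i ≤ 1)
    (x : ι → Bool) : 0 ≤ bw p x := by
  apply Finset.prod_nonneg
  intro i _
  split_ifs
  · exact h0 i
  · linarith [h1 i]

theorem bw_split {ι : Type*} [Fintype ι] [DecidableEq ι] (V : Finset ι) (p : ι → ℝ)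
    (G : (ι → Bool) → ℝ) (hG : ∀ x y, (∀ i ∈ V, x i = y i) → G x = G y) :
    ∑ x : ι → Bool, bw p x * G x
      = ∑ a : {i // i ∈ V} → Bool, bw (fun i => p i.1) a *
          G (fun i => if h : i ∈ V then a ⟨i, h⟩ else false) := by
  rw [← (Equiv.piEquivPiSubtypeProd (fun i => i ∈ V) (fun _ => Bool)).symm.sum_comp,
    Fintype.sum_prod_type]
  apply Finset.sum_congr rfl
  intro a _
  have key : ∀ c : {i // ¬ i ∈ V} → Bool,
      bw p ((Equiv.piEquivPiSubtypeProd (fun i => i ∈ V) (fun _ => Bool)).symm (a, c)) *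
        G ((Equiv.piEquivPiSubtypeProd (fun i => i ∈ V) (fun _ => Bool)).symm (a, c))
      = bw (fun i : {i // i ∈ V} => p i.1) a *
          G (fun i => if h : i ∈ V then a ⟨i, h⟩ else false) *
          bw (fun i : {i // ¬ i ∈ V} => p i.1) c := by
    intro c
    have h1 : G ((Equiv.piEquivPiSubtypeProd (fun i => i ∈ V) (fun _ => Bool)).symm (a, c))
        = G (fun i => if h : i ∈ V then a ⟨i, h⟩ else false) := by
      apply hG
      intro i hi
      simp [Equiv.piEquivPiSubtypeProd, hi]
    have h2 : bw p ((Equiv.piEquivPiSubtypeProd (fun i => i ∈ V) (fun _ => Bool)).symm (a, c))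
        = bw (fun i : {i // i ∈ V} => p i.1) a * bw (fun i : {i // ¬ i ∈ V} => p i.1) c := by
      unfold bw
      rw [← Fintype.prod_subtype_mul_prod_subtype (fun i => i ∈ V)]
      congr 1
      · apply Finset.prod_congr (by ext; simp)
        intro i _
        simp [Equiv.piEquivPiSubtypeProd, i.2]
      · apply Finset.prod_congr (by ext; simp)
        intro i _
        simp [Equiv.piEquivPiSubtypeProd, i.2]
    rw [h1, h2]; ring
  rw [Finset.sum_congr rfl (fun c _ => key c), ← Finset.mul_sum, bw_sum, mul_one]

theorem bw_marg {ι : Type*} [Fintype ι] [DecidableEq ι] (V : Finset ι) (p p' : ι → ℝ)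
    (hp : ∀ i ∈ V, p i = p' i)
    (G : (ι → Bool) → ℝ) (hG : ∀ x y, (∀ i ∈ V, x i = y i) → G x = G y) :
    ∑ x : ι → Bool, bw p x * G x = ∑ x : ι → Bool, bw p' x * G x := by
  rw [bw_split V p G hG, bw_split V p' G hG]
  have : (fun i : {i // i ∈ V} => p i.1) = fun i => p' i.1 := by
    funext i; exact hp _ i.2
  rw [this]

theorem bw_tv {ι : Type*} [Fintype ι] [DecidableEq ι] (V : Finset ι) (γ δ : ℝ)
    (hγ0 : 0 ≤ γ) (hγ1 : γ ≤ 1 / 2) (hδ : 0 < δ) (hδ1 : δ ≤ 1)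
    (G : (ι → Bool) → ℝ) (hG : ∀ x y, (∀ i ∈ V, x i = y i) → G x = G y)
    (hG0 : ∀ x, 0 ≤ G x) (hG1 : ∀ x, G x ≤ 1) :
    ∑ x : ι → Bool, bw (fun _ => 1 / 2) x * G x - ∑ x : ι → Bool, bw (fun _ => 1 / 2 + γ) x * G x
      ≤ δ / 2 + 4 * γ ^ 2 * V.card / δ := by
  set hyb : ι → ℝ := fun i => if i ∈ V then 1 / 2 + γ else 1 / 2 with hhyb
  have hn : ∀ x : ι → Bool, 0 ≤ bw (fun _ => (1:ℝ) / 2) x :=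
    fun x => bw_nonneg _ (by intro; norm_num) (by intro; norm_num) x
  rw [bw_marg V (fun _ => 1 / 2 + γ) hyb (by intro i hi; simp [hhyb, hi]) G hG]
  by_cases hbig : 1 < 4 * γ ^ 2 * V.card
  · have h1 : ∑ x : ι → Bool, bw (fun _ => (1:ℝ) / 2) x * G x ≤ 1 := by
      refine le_trans ?_ (le_of_eq (bw_sum (fun _ : ι => (1:ℝ) / 2)))
      apply Finset.sum_le_sum
      intro x _
      nlinarith [hn x, hG1 x]
    have h2 : 0 ≤ ∑ x : ι → Bool, bw hyb x * G x := by
      apply Finset.sum_nonneg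
      intro x _
      apply mul_nonneg _ (hG0 x)
      apply bw_nonneg
      · intro i; simp only [hhyb]; split_ifs <;> linarith
      · intro i; simp only [hhyb]; split_ifs <;> linarith
    have h3 : 1 ≤ 4 * γ ^ 2 * V.card / δ := by
      rw [le_div_iff₀ hδ]; linarith
    linarith
  · push Not at hbig
    set Lf : ι → Bool → ℝ := fun i c => if i ∈ V then (if c = true then 1 + 2 * γ else 1 - 2 * γ) else 1
      with hLf
    have hL : ∀ x, bw hyb x = bw (fun _ => (1:ℝ) / 2) x * ∏ i, Lf i (x i) := by
      intro x
      simp only [bw, ← Finset.prod_mul_distrib]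
      apply Finset.prod_congr rfl
      intro i _
      simp only [hhyb, hLf]
      split_ifs <;> ring
    have hE1 : ∑ x : ι → Bool, bw (fun _ => (1:ℝ) / 2) x * ∏ i, Lf i (x i) = 1 := by
      rw [bw_prod]
      apply Finset.prod_eq_one
      intro i _
      simp only [hLf]
      by_cases hi : i ∈ V
      · simp only [hi, if_true, Bool.false_eq_true, if_false]; ring
      · simp only [hi, if_false]; ring
    have hE2 : ∑ x : ι → Bool, bw (fun _ => (1:ℝ) / 2) x * (∏ i, Lf i (x i)) ^ 2
        = (1 + 4 * γ ^ 2) ^ V.card := by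
      have := bw_prod (fun _ : ι => (1:ℝ)/2) (fun i c => Lf i c ^ 2)
      simp only [Finset.prod_pow] at this
      rw [this, ← Finset.prod_const, ← Finset.prod_subset (Finset.subset_univ V)]
      · apply Finset.prod_congr rfl
        intro i hi
        simp [hLf, hi]; ring
      · intro i _ hi
        simp [hLf, hi]
    calc ∑ x : ι → Bool, bw (fun _ => 1 / 2) x * G x - ∑ x : ι → Bool, bw hyb x * G x
        = ∑ x : ι → Bool, bw (fun _ => 1 / 2) x * ((1 - ∏ i, Lf i (x i)) * G x) := by
          rw [← Finset.sum_sub_distrib]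
          apply Finset.sum_congr rfl
          intro x _
          rw [hL]; ring
      _ ≤ ∑ x : ι → Bool, bw (fun _ => 1 / 2) x * (δ / 2 + (1 - ∏ i, Lf i (x i)) ^ 2 / (2 * δ)) := by
          apply Finset.sum_le_sum
          intro x _
          apply mul_le_mul_of_nonneg_left _ (hn x)
          set y := 1 - ∏ i, Lf i (x i)
          have a1 : y * G x ≤ |y| := by
            rcases le_total 0 y with h | h
            · rw [abs_of_nonneg h]; nlinarith [hG1 x]
            · have := abs_nonneg y
              nlinarith [hG0 x]
          have a2 : |y| ≤ δ / 2 + y ^ 2 / (2 * δ) := by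
            have : δ / 2 + y ^ 2 / (2 * δ) - |y| = (|y| - δ) ^ 2 / (2 * δ) := by
              rw [← sq_abs y]
              field_simp; ring
            have : 0 ≤ (|y| - δ) ^ 2 / (2 * δ) := by positivity
            linarith
          linarith
      _ = δ / 2 * ∑ x : ι → Bool, bw (fun _ => 1 / 2) x
            + (∑ x : ι → Bool, bw (fun _ => 1 / 2) x
              - 2 * ∑ x : ι → Bool, bw (fun _ => (1:ℝ) / 2) x * ∏ i, Lf i (x i)
              + ∑ x : ι → Bool, bw (fun _ => (1:ℝ) / 2) x * (∏ i, Lf i (x i)) ^ 2) / (2 * δ) := by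
          rw [Finset.mul_sum, Finset.mul_sum, ← Finset.sum_sub_distrib, ← Finset.sum_add_distrib,
            Finset.sum_div, ← Finset.sum_add_distrib]
          apply Finset.sum_congr rfl
          intro x _
          field_simp; ring
      _ = δ / 2 + ((1 + 4 * γ ^ 2) ^ V.card - 1) / (2 * δ) := by
          rw [hE1, hE2, bw_sum]; ring
      _ ≤ δ / 2 + 4 * γ ^ 2 * V.card / δ := by
          have b1 : (1 + 4 * γ ^ 2) ^ V.card ≤ Real.exp (4 * γ ^ 2 * V.card) := by
            have : 1 + 4 * γ ^ 2 ≤ Real.exp (4 * γ ^ 2) := by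
              linarith [Real.add_one_le_exp (4 * γ ^ 2)]
            calc (1 + 4 * γ ^ 2) ^ V.card ≤ (Real.exp (4 * γ ^ 2)) ^ V.card := by gcongr
              _ = _ := by rw [← Real.exp_nat_mul]; ring_nf
          have hx0 : 0 ≤ 4 * γ ^ 2 * V.card := by positivity
          have b2 : Real.exp (4 * γ ^ 2 * V.card) ≤ 1 + 2 * (4 * γ ^ 2 * V.card) := by
            have := Real.abs_exp_sub_one_le (x := 4 * γ ^ 2 * V.card) (by rw [abs_of_nonneg hx0]; exact hbig)
            rw [abs_of_nonneg hx0] at this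
            linarith [le_abs_self (Real.exp (4 * γ ^ 2 * V.card) - 1)]
          have b3 : ((1 + 4 * γ ^ 2) ^ V.card - 1) / (2 * δ) ≤ (2 * (4 * γ ^ 2 * V.card)) / (2 * δ) := by
            gcongr; linarith
          have b4 : (2 * (4 * γ ^ 2 * V.card)) / (2 * δ) = 4 * γ ^ 2 * V.card / δ := by
            field_simp
          linarith

theorem bw_var {ι : Type*} [Fintype ι] [DecidableEq ι] (p : ℝ) :
    ∑ x : ι → Bool, bw (fun _ => p) x * (((univ.filter (fun i => x i = true)).card : ℝ)
        - Fintype.card ι * p) ^ 2 = Fintype.card ι * (p * (1 - p)) := by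
  have hx : ∀ x : ι → Bool, ((univ.filter (fun i => x i = true)).card : ℝ)
        - Fintype.card ι * p = ∑ i, ((if x i = true then (1:ℝ) else 0) - p) := by
    intro x
    rw [Finset.sum_sub_distrib, Finset.sum_boole]
    simp
  have h2 : ∀ i j : ι, ∑ x : ι → Bool, bw (fun _ => p) x *
      (((if x i = true then (1:ℝ) else 0) - p) * ((if x j = true then (1:ℝ) else 0) - p))
      = if i = j then p * (1 - p) else 0 := by
    intro i j
    have := bw_prod (fun _ : ι => p) (fun l c =>
      (if l = i then (if c = true then (1:ℝ) else 0) - p else 1) *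
      (if l = j then (if c = true then (1:ℝ) else 0) - p else 1))
    simp only [Finset.prod_mul_distrib, Finset.prod_ite_eq', Finset.mem_univ, if_true] at this
    rw [this]
    by_cases h : i = j
    · subst h
      rw [if_pos rfl]
      rw [Finset.prod_eq_single i]
      · simp; ring
      · intro b _ hb; simp [hb]
      · simp
    · rw [if_neg h]
      apply Finset.prod_eq_zero (Finset.mem_univ i)
      simp [h]; ring
  calc _ = ∑ x : ι → Bool, ∑ i, ∑ j, bw (fun _ => p) x *
      (((if x i = true then (1:ℝ) else 0) - p) * ((if x j = true then (1:ℝ) else 0) - p)) := by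
        apply Finset.sum_congr rfl
        intro x _
        rw [hx, sq, Finset.sum_mul_sum, Finset.mul_sum]
        apply Finset.sum_congr rfl
        intro i _
        rw [Finset.mul_sum]
    _ = ∑ i, ∑ j, if i = j then p * (1 - p) else 0 := by
        rw [Finset.sum_comm]
        apply Finset.sum_congr rfl
        intro i _
        rw [Finset.sum_comm]
        apply Finset.sum_congr rfl
        intro j _
        exact h2 i j
    _ = _ := by simp

/-- Chebyshev. -/
theorem bw_cheb {ι : Type*} [Fintype ι] [DecidableEq ι] (p : ℝ) (h0 : 0 ≤ p) (h1 : p ≤ 1)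
    (τ : ℝ) (hτ : 0 < τ) (S : (ι → Bool) → Prop) [DecidablePred S]
    (hS : ∀ x, S x → τ ≤ |((univ.filter (fun i => x i = true)).card : ℝ) - Fintype.card ι * p|) :
    ∑ x : ι → Bool, (if S x then bw (fun _ => p) x else 0) ≤ Fintype.card ι / (4 * τ ^ 2) := by
  have hv := bw_var (ι := ι) p
  have : ∑ x : ι → Bool, (if S x then bw (fun _ => p) x else 0) ≤
    (∑ x : ι → Bool, bw (fun _ => p) x * (((univ.filter (fun i => x i = true)).card : ℝ)
        - Fintype.card ι * p) ^ 2) / τ ^ 2 := by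
    rw [Finset.sum_div]
    apply Finset.sum_le_sum
    intro x _
    have hb := bw_nonneg (fun _ : ι => p) (fun _ => h0) (fun _ => h1) x
    split_ifs with h
    · rw [le_div_iff₀ (by positivity)]
      apply mul_le_mul_of_nonneg_left _ hb
      rw [← sq_abs (_ - _)]
      have := hS x h
      gcongr
    · positivity
  rw [hv] at this
  refine this.trans ?_
  rw [div_le_div_iff₀ (by positivity) (by positivity)]
  have : p * (1 - p) ≤ 1 / 4 := by nlinarith [sq_nonneg (p - 1 / 2)]
  have hc : (0:ℝ) ≤ Fintype.card ι * τ ^ 2 := by positivity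
  nlinarith

/-! ### Combinatorial facts on the cube -/

theorem half_count {X : Type*} [DecidableEq X] (S D : Finset X) (σ : X → X)
    (hσ : Function.Injective σ) (h : ∀ x ∈ S, x ∈ D ∨ σ x ∈ D) : S.card ≤ 2 * D.card := by
  have h1 : S ⊆ D ∪ S.filter (fun x => σ x ∈ D) := by
    intro x hx
    rw [Finset.mem_union, Finset.mem_filter]
    rcases h x hx with h | h
    · exact Or.inl h
    · exact Or.inr ⟨hx, h⟩
  have h2 : (S.filter (fun x => σ x ∈ D)).card ≤ D.card := by
    apply Finset.card_le_card_of_injOn σ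
    · intro x hx
      exact (Finset.mem_filter.1 hx).2
    · exact hσ.injOn
  have h3 := Finset.card_le_card h1
  have h4 := Finset.card_union_le D (S.filter (fun x => σ x ∈ D))
  omega

/-- Flip coordinate `v`. -/
def flip {ι : Type*} [DecidableEq ι] (v : ι) (x : ι → Bool) : ι → Bool :=
  Function.update x v (!x v)

theorem flip_flip {ι : Type*} [DecidableEq ι] (v : ι) (x : ι → Bool) : flip v (flip v x) = x := by
  funext i
  by_cases h : i = v
  · subst h; simp [flip]
  · simp [flip, h]

theorem flip_inj {ι : Type*} [DecidableEq ι] (v : ι) :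
    Function.Injective (flip v : (ι → Bool) → (ι → Bool)) :=
  Function.LeftInverse.injective (flip_flip v)

/-- Parity. -/
def par {ι : Type*} [Fintype ι] (x : ι → Bool) : ZMod 2 := ∑ i, if x i = true then 1 else 0

theorem par_flip {ι : Type*} [Fintype ι] [DecidableEq ι] (v : ι) (x : ι → Bool) :
    par (flip v x) = par x + 1 := by
  unfold par
  rw [Fintype.sum_eq_add_sum_compl v, Fintype.sum_eq_add_sum_compl v (fun i => if x i = true then (1 : ZMod 2) else 0)]
  have : ∑ i ∈ {v}ᶜ, (if flip v x i = true then (1 : ZMod 2) else 0)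
      = ∑ i ∈ {v}ᶜ, (if x i = true then (1 : ZMod 2) else 0) := by
    apply Finset.sum_congr rfl
    intro i hi
    have : i ≠ v := by simpa using hi
    simp [flip, this]
  rw [this]
  have h2 : (1 : ZMod 2) + 1 = 0 := by decide
  cases hv : x v
  · simp [flip, hv]; ring
  · simp only [flip, hv, Function.update_self, Bool.not_true, Bool.false_eq_true, if_false, if_true]
    linear_combination -h2

theorem even_set {ι : Type*} [Fintype ι] [DecidableEq ι] [Nonempty ι] :
    ∃ E : Finset (ι → Bool), 2 * E.card = 2 ^ Fintype.card ι ∧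
      ∀ x ∈ E, ∀ v, flip v x ∉ E := by
  refine ⟨univ.filter (fun x => par x = 0), ?_, ?_⟩
  · obtain ⟨v⟩ := ‹Nonempty ι›
    have h1 : (univ.filter (fun x : ι → Bool => par x = 0)).card
        = (univ.filter (fun x : ι → Bool => ¬ par x = 0)).card := by
      apply Finset.card_bij (fun x _ => flip v x)
      · intro x hx
        simp only [Finset.mem_filter, Finset.mem_univ, true_and] at hx ⊢
        rw [par_flip, hx]; decide
      · intro x _ y _ h
        exact flip_inj v h
      · intro y hy
        refine ⟨flip v y, ?_, flip_flip v y⟩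
        simp only [Finset.mem_filter, Finset.mem_univ, true_and] at hy ⊢
        rw [par_flip]
        generalize par y = c at hy
        revert c; decide
    have h2 := Finset.card_filter_add_card_filter_not (s := (univ : Finset (ι → Bool))) (fun x => par x = 0)
    rw [Finset.card_univ, Fintype.card_fun, Fintype.card_bool] at h2
    omega
  · intro x hx v hv
    simp only [Finset.mem_filter, Finset.mem_univ, true_and] at hx hv
    rw [par_flip, hx] at hv
    revert hv; decide

theorem xor_bij {T : Type*} (w : T → Bool) : Function.Bijective
      (fun (x : T → Bool) (i : T) => xor (x i) (w i)) := by
  apply Function.Involutive.bijective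
  intro x
  funext i
  simp

theorem fiber_count {κ ν : Type*} [Fintype κ] [DecidableEq κ] [Fintype ν] [DecidableEq ν]
    (g : κ → ν) (hg : Function.Injective g) (u : κ → Bool) (H : Finset (κ → Bool)) :
    (univ.filter (fun x : ν → Bool => (fun i => xor (x (g i)) (u i)) ∈ H)).card * 2 ^ Fintype.card κ
      = H.card * 2 ^ Fintype.card ν := by
  have h1 : ∀ w : κ → Bool,
      (univ.filter (fun x : ν → Bool => (fun i => xor (x (g i)) (u i)) ∈ H)).card
      = (univ.filter (fun x : ν → Bool => (fun i => xor (xor (x (g i)) (u i)) (w i)) ∈ H)).card := by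
    intro w
    symm
    have hb := xor_bij (Function.extend g w (fun _ => false))
    apply Finset.card_bij (fun x _ => fun i => xor (x i) (Function.extend g w (fun _ => false) i))
    · intro x hx
      simp only [Finset.mem_filter, Finset.mem_univ, true_and] at hx ⊢
      convert hx using 2 with i
      rw [hg.extend_apply]
      cases x (g i) <;> cases u i <;> cases w i <;> rfl
    · intro x _ y _ h
      exact hb.1 h
    · intro y hy
      obtain ⟨x, hx⟩ := hb.2 y
      refine ⟨x, ?_, hx⟩
      rw [← hx] at hy
      simp only [Finset.mem_filter, Finset.mem_univ, true_and] at hy ⊢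
      convert hy using 2 with i
      rw [hg.extend_apply]
      cases x (g i) <;> cases u i <;> cases w i <;> rfl
  have h2 : ∑ w : κ → Bool,
      (univ.filter (fun x : ν → Bool => (fun i => xor (xor (x (g i)) (u i)) (w i)) ∈ H)).card
      = ∑ x : ν → Bool, H.card := by
    simp only [Finset.card_filter]
    rw [Finset.sum_comm]
    apply Finset.sum_congr rfl
    intro x _
    rw [← Finset.card_filter]
    have hb := xor_bij (fun i => xor (x (g i)) (u i))
    apply Finset.card_bij (fun w _ => fun i => xor (w i) (xor (x (g i)) (u i)))
    · intro w hw
      simp only [Finset.mem_filter, Finset.mem_univ, true_and] at hw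
      convert hw using 2 with i
      rw [Bool.xor_comm]
    · intro w _ y _ h
      exact hb.1 h
    · intro y hy
      obtain ⟨w, hw⟩ := hb.2 y
      refine ⟨w, ?_, hw⟩
      simp only [Finset.mem_filter, Finset.mem_univ, true_and]
      convert hy using 1
      rw [← hw]
      funext i
      rw [Bool.xor_comm]
  rw [← Finset.sum_congr rfl (fun w _ => h1 w)] at h2
  simp only [Finset.sum_const, Finset.card_univ, Fintype.card_fun, Fintype.card_bool, smul_eq_mul] at h2
  rw [mul_comm, h2, mul_comm]

/-! ### Lines -/

/-- Points of the affine plane over `ZMod P` (also used to index lines). -/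
abbrev Pt (P : ℕ) := ZMod P × ZMod P

/-- The point `j` lies on the line `l`. -/
def onLine {P : ℕ} (l j : Pt P) : Prop := j.2 = l.1 * j.1 + l.2

instance {P : ℕ} (l j : Pt P) : Decidable (onLine l j) := by unfold onLine; infer_instance

theorem card_lines_through {P : ℕ} [Fact P.Prime] (j : Pt P) :
    (univ.filter (fun l : Pt P => onLine l j)).card = P := by
  have : (univ.filter (fun l : Pt P => onLine l j)) =
      (univ : Finset (ZMod P)).image (fun a => (a, j.2 - a * j.1)) := by
    ext l
    simp only [Finset.mem_filter, Finset.mem_univ, true_and, Finset.mem_image]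
    unfold onLine
    constructor
    · intro h
      refine ⟨l.1, ?_⟩
      ext
      · rfl
      · simp only; rw [h]; ring
    · rintro ⟨a, rfl⟩
      simp
  rw [this, Finset.card_image_of_injective _ (by intro a b h; simpa using congrArg Prod.fst h),
    Finset.card_univ, ZMod.card]

theorem card_lines_two {P : ℕ} [Fact P.Prime] (j j' : Pt P) (h : j ≠ j') :
    (univ.filter (fun l : Pt P => onLine l j ∧ onLine l j')).card ≤ 1 := by
  rw [Finset.card_le_one]
  intro l hl l' hl'
  simp only [Finset.mem_filter, Finset.mem_univ, true_and] at hl hl'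
  unfold onLine at hl hl'
  obtain ⟨h1, h2⟩ := hl
  obtain ⟨h3, h4⟩ := hl'
  have hx : j.1 - j'.1 ≠ 0 := by
    intro h0
    apply h
    have : j.1 = j'.1 := by linear_combination h0
    ext
    · exact this
    · rw [h1, h2, this]
  have ha : l.1 = l'.1 := by
    have : (l.1 - l'.1) * (j.1 - j'.1) = 0 := by linear_combination h2 - h1 + h3 - h4
    rcases mul_eq_zero.1 this with h | h
    · linear_combination h
    · exact absurd h hx
  ext
  · exact ha
  · rw [ha] at h1; linear_combination h3 - h1

theorem lines_hit {P : ℕ} [Fact P.Prime] (U : Finset (Pt P)) (hU : 4 * P ≤ U.card) :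
    4 * P ^ 2 ≤ 5 * (univ.filter (fun l : Pt P => ∃ j ∈ U, onLine l j)).card := by
  have hP : 0 < P := (Fact.out : P.Prime).pos
  set X : Pt P → ℕ := fun l => (U.filter (fun j => onLine l j)).card with hX
  set H := univ.filter (fun l : Pt P => ∃ j ∈ U, onLine l j) with hH
  have s1 : ∑ l, X l = U.card * P := by
    simp only [hX, Finset.card_filter]
    rw [Finset.sum_comm]
    simp only [← Finset.card_filter, card_lines_through]
    simp
  have s2 : ∑ l, X l ^ 2 ≤ U.card * P + U.card ^ 2 := by
    have : ∀ l, X l ^ 2 = ∑ j ∈ U, ∑ j' ∈ U, if onLine l j ∧ onLine l j' then 1 else 0 := by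
      intro l
      simp only [hX, Finset.card_filter, sq, Finset.sum_mul_sum]
      apply Finset.sum_congr rfl; intro j _
      apply Finset.sum_congr rfl; intro j' _
      by_cases h1 : onLine l j <;> by_cases h2 : onLine l j' <;> simp [h1, h2]
    simp only [this]
    rw [Finset.sum_comm]
    have : ∀ j ∈ U, ∑ l, ∑ j' ∈ U, (if onLine l j ∧ onLine l j' then 1 else 0) ≤ P + U.card := by
      intro j hj
      rw [Finset.sum_comm]
      simp only [← Finset.card_filter]
      calc ∑ j' ∈ U, (univ.filter (fun l : Pt P => onLine l j ∧ onLine l j')).card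
          ≤ ∑ j' ∈ U, ((if j = j' then P else 0) + 1) := by
            apply Finset.sum_le_sum
            intro j' _
            by_cases h : j = j'
            · subst h
              simp [card_lines_through]
            · simpa [h] using card_lines_two j j' h
        _ = P + U.card := by
            rw [Finset.sum_add_distrib]
            simp [hj]
    calc _ ≤ ∑ j ∈ U, (P + U.card) := Finset.sum_le_sum this
      _ = _ := by simp; ring
  have s3 : (∑ l, X l) ^ 2 ≤ H.card * ∑ l, X l ^ 2 := by
    have e1 : ∑ l, X l = ∑ l ∈ H, X l := by
      symm
      apply Finset.sum_subset (Finset.subset_univ _)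
      intro l _ hl
      simp only [hX, Finset.card_eq_zero, Finset.filter_eq_empty_iff]
      intro j hj hjl
      apply hl
      simp only [hH, Finset.mem_filter, Finset.mem_univ, true_and]
      exact ⟨j, hj, hjl⟩
    rw [e1]
    calc _ ≤ H.card * ∑ l ∈ H, X l ^ 2 := sq_sum_le_card_mul_sum_sq
      _ ≤ _ := by
        apply Nat.mul_le_mul_left
        exact Finset.sum_le_sum_of_subset (Finset.subset_univ _)
  rw [s1] at s3
  have s4 : (U.card * P) ^ 2 ≤ H.card * (U.card * P + U.card ^ 2) :=
    s3.trans (Nat.mul_le_mul_left _ s2)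
  have hUp : 0 < U.card := by omega
  have s5 : U.card * P ^ 2 ≤ H.card * (P + U.card) := by
    have : U.card * (U.card * P ^ 2) ≤ U.card * (H.card * (P + U.card)) := by nlinarith
    exact Nat.le_of_mul_le_mul_left this hUp
  have s6 : U.card * (4 * P ^ 2) ≤ U.card * (5 * H.card) := by nlinarith
  exact Nat.le_of_mul_le_mul_left s6 hUp


/-! ### The hard functions -/

/-- Addresses. -/
abbrev Cell (P m0 : ℕ) := (Fin m0 ⊕ Pt P) → Bool

/-- The address coordinates selected by `μ`. -/
def addrE {P m0 n : ℕ} (e : Fin m0 ⊕ (Pt P × Bool) → Fin n) (μ : Pt P → Bool) :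
    Fin m0 ⊕ Pt P → Fin n
  | .inl i => e (.inl i)
  | .inr j => e (.inr (j, μ j))

/-- The action coordinates selected by `μ`. -/
def actE {P m0 n : ℕ} (e : Fin m0 ⊕ (Pt P × Bool) → Fin n) (μ : Pt P → Bool) (j : Pt P) : Fin n :=
  e (.inr (j, !μ j))

/-- The (shifted) address of `x`. -/
def cellOf {P m0 n : ℕ} (e : Fin m0 ⊕ (Pt P × Bool) → Fin n) (μ : Pt P → Bool) (u : Cell P m0)
    (x : Fin n → Bool) : Cell P m0 := fun i => xor (x (addrE e μ i)) (u i)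

/-- Parity of `y` over the points of `A` on the line `l`. -/
def val {P : ℕ} [Fact P.Prime] (l : Pt P) (A y : Pt P → Bool) : ZMod 2 :=
  par (fun j => decide (onLine l j) && A j && y j)

/-- The hard function. -/
def fn {P m0 n : ℕ} [Fact P.Prime] (line : Cell P m0 → Option (Pt P))
    (e : Fin m0 ⊕ (Pt P × Bool) → Fin n) (μ : Pt P → Bool) (u : Cell P m0)
    (b : Cell P m0 → ZMod 2) (A : Pt P → Bool) (x : Fin n → Bool) : Bool :=
  match line (cellOf e μ u x) with
  | none => false
  | some l => decide (b (cellOf e μ u x) + val l A (fun j => x (actE e μ j)) = 1)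

theorem addrE_inj {P m0 n : ℕ} (e : Fin m0 ⊕ (Pt P × Bool) → Fin n) (he : Function.Injective e)
    (μ : Pt P → Bool) : Function.Injective (addrE e μ) := by
  rintro (i | j) (i' | j') h <;> simp only [addrE] at h <;> have := he h <;> simp_all

theorem actE_inj {P m0 n : ℕ} (e : Fin m0 ⊕ (Pt P × Bool) → Fin n) (he : Function.Injective e)
    (μ : Pt P → Bool) : Function.Injective (actE e μ) := by
  intro j j' h
  have := he h
  simp_all

theorem addrE_ne_actE {P m0 n : ℕ} (e : Fin m0 ⊕ (Pt P × Bool) → Fin n)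
    (he : Function.Injective e) (μ : Pt P → Bool) (i : Fin m0 ⊕ Pt P) (j : Pt P) :
    addrE e μ i ≠ actE e μ j := by
  intro h
  rcases i with i | i
  · have := he h; simp at this
  · have := he h
    simp only [Sum.inr.injEq, Prod.mk.injEq] at this
    obtain ⟨rfl, h⟩ := this
    simp at h

theorem fn_junta {P m0 n k : ℕ} [Fact P.Prime] (line : Cell P m0 → Option (Pt P))
    (e : Fin m0 ⊕ (Pt P × Bool) → Fin n) (μ : Pt P → Bool) (u : Cell P m0)
    (b : Cell P m0 → ZMod 2) (A : Pt P → Bool)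
    (hA : m0 + P ^ 2 + (univ.filter (fun j => A j = true)).card ≤ k) :
    IsJunta n k (fn line e μ u b A) := by
  refine ⟨univ.image (addrE e μ) ∪ (univ.filter (fun j => A j = true)).image (actE e μ), ?_, ?_⟩
  · refine (Finset.card_union_le _ _).trans (le_trans ?_ hA)
    apply Nat.add_le_add
    · refine Finset.card_image_le.trans ?_
      simp [ZMod.card, sq]
    · exact Finset.card_image_le
  · intro x y h
    have h1 : cellOf e μ u x = cellOf e μ u y := by
      funext i
      simp only [cellOf]
      rw [h]
      simp
    have h2 : ∀ l, val l A (fun j => x (actE e μ j)) = val l A (fun j => y (actE e μ j)) := by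
      intro l
      unfold val
      congr 1
      funext j
      cases hj : A j
      · simp
      · beta_reduce
        rw [h]
        simp only [Finset.mem_union, Finset.mem_image, Finset.mem_filter, Finset.mem_univ, true_and]
        exact Or.inr ⟨j, hj, rfl⟩
    unfold fn
    rw [h1]
    simp only [h2]

theorem cell_flip_act {P m0 n : ℕ} (e : Fin m0 ⊕ (Pt P × Bool) → Fin n)
    (he : Function.Injective e) (μ : Pt P → Bool) (u : Cell P m0) (j : Pt P) (x : Fin n → Bool) :
    cellOf e μ u (flip (actE e μ j) x) = cellOf e μ u x := by
  funext i
  simp [cellOf, flip, Function.update_of_ne (addrE_ne_actE e he μ i j)]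

theorem cell_flip_addr {P m0 n : ℕ} [Fact P.Prime] (e : Fin m0 ⊕ (Pt P × Bool) → Fin n)
    (he : Function.Injective e) (μ : Pt P → Bool) (u : Cell P m0) (v : Fin m0 ⊕ Pt P)
    (x : Fin n → Bool) :
    cellOf e μ u (flip (addrE e μ v) x) = flip v (cellOf e μ u x) := by
  funext i
  by_cases h : i = v
  · subst h
    simp [cellOf, flip]
  · have : addrE e μ i ≠ addrE e μ v := fun h' => h (addrE_inj e he μ h')
    simp [cellOf, flip, this, h]

theorem fn_flip {P m0 n : ℕ} [Fact P.Prime] (line : Cell P m0 → Option (Pt P))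
    (e : Fin m0 ⊕ (Pt P × Bool) → Fin n) (he : Function.Injective e)
    (μ : Pt P → Bool) (u : Cell P m0)
    (b : Cell P m0 → ZMod 2) (A : Pt P → Bool) (x : Fin n → Bool) (l j : Pt P)
    (hl : line (cellOf e μ u x) = some l) (hj : onLine l j) (hA : A j = true) :
    fn line e μ u b A (flip (actE e μ j) x) ≠ fn line e μ u b A x := by
  have h1 : val l A (fun i => flip (actE e μ j) x (actE e μ i))
      = val l A (fun i => x (actE e μ i)) + 1 := by
    unfold val
    rw [← par_flip j]
    congr 1
    funext i
    by_cases h : i = j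
    · subst h
      simp [flip, hj, hA]
    · have : actE e μ i ≠ actE e μ j := fun h' => h (actE_inj e he μ h')
      simp [flip, this, h]
  unfold fn
  rw [cell_flip_act e he, hl]
  simp only [h1]
  generalize b (cellOf e μ u x) = c
  generalize val l A _ = d
  revert c d
  decide

theorem fn_far {P m0 n k t : ℕ} [Fact P.Prime] (line : Cell P m0 → Option (Pt P))
    (e : Fin m0 ⊕ (Pt P × Bool) → Fin n) (he : Function.Injective e)
    (h1 : ∀ z v, line z ≠ none → line (flip v z) = none)
    (h2 : ∀ l, (univ.filter (fun z => line z = some l)).card = t)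
    (μ : Pt P → Bool) (u : Cell P m0) (b : Cell P m0 → ZMod 2) (A : Pt P → Bool) (ε : ℝ)
    (hε : 2 * ε * 2 ^ (m0 + P ^ 2) ≤ 4 / 5 * (t * P ^ 2 : ℝ))
    (hk : m0 + P ^ 2 ≤ k)
    (hA : k + 4 * P ≤ m0 + P ^ 2 + (univ.filter (fun j => A j = true)).card) :
    FarFromJuntas n k ε (fn line e μ u b A) := by
  classical
  intro g hgj
  obtain ⟨J, hJ, hg⟩ := hgj
  set f := fn line e μ u b A with hf
  have hgflip : ∀ v x, v ∉ J → g (flip v x) = g x := by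
    intro v x hv
    apply hg
    intro i hi
    have : i ≠ v := fun h => hv (h ▸ hi)
    simp [flip, this]
  set D := univ.filter (fun x => f x ≠ g x) with hD
  -- the key count
  have key : ∀ U : Finset (Pt P), (∀ j ∈ U, A j = true) → 4 * P ≤ U.card →
      ∃ (S : Finset (Fin n → Bool)) (σ : (Fin n → Bool) → (Fin n → Bool)),
        Function.Injective σ ∧ 2 * ε * 2 ^ n ≤ (S.card : ℝ) ∧
        ∀ x ∈ S, f (σ x) ≠ f x ∧ ∃ j ∈ U, σ x = flip (actE e μ j) x := by
    intro U hUA hU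
    set H : Finset (Cell P m0) := univ.filter (fun z => ∃ j, j ∈ U ∧ ∃ l, line z = some l ∧ onLine l j)
      with hH
    set S := univ.filter (fun x : Fin n → Bool => cellOf e μ u x ∈ H) with hS
    set jc : Cell P m0 → Pt P := fun z =>
      if h : ∃ j, j ∈ U ∧ ∃ l, line z = some l ∧ onLine l j then h.choose else 0 with hjc
    refine ⟨S, fun x => flip (actE e μ (jc (cellOf e μ u x))) x, ?_, ?_, ?_⟩
    · apply Function.LeftInverse.injective (g := fun x => flip (actE e μ (jc (cellOf e μ u x))) x)
      intro x
      simp only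
      rw [cell_flip_act e he, flip_flip]
    · have c1 : S.card * 2 ^ (m0 + P ^ 2) = H.card * 2 ^ n := by
        have := fiber_count (addrE e μ) (addrE_inj e he μ) u H
        have hcard : Fintype.card (Fin m0 ⊕ Pt P) = m0 + P ^ 2 := by simp [ZMod.card, sq]
        rw [hcard, Fintype.card_fin] at this
        exact this
      have c2 : t * (univ.filter (fun l : Pt P => ∃ j ∈ U, onLine l j)).card ≤ H.card := by
        have : (univ.filter (fun l : Pt P => ∃ j ∈ U, onLine l j)).biUnion
            (fun l => univ.filter (fun z => line z = some l)) ⊆ H := by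
          intro z hz
          simp only [Finset.mem_biUnion, Finset.mem_filter, Finset.mem_univ, true_and, hH] at hz ⊢
          obtain ⟨l, ⟨j, hj, hjl⟩, hl⟩ := hz
          exact ⟨j, hj, l, hl, hjl⟩
        have h3 := Finset.card_le_card this
        rw [Finset.card_biUnion] at h3
        · rw [Finset.sum_congr rfl (fun l _ => h2 l)] at h3
          simp only [Finset.sum_const, smul_eq_mul] at h3
          rwa [mul_comm]
        · intro l _ l' _ hll
          rw [Function.onFun, Finset.disjoint_left]
          intro z hz hz'
          simp only [Finset.mem_filter, Finset.mem_univ, true_and] at hz hz'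
          rw [hz] at hz'
          exact hll (by simpa using hz')
      have c3 := lines_hit U hU
      have c4 : 4 * (t * P ^ 2) ≤ 5 * H.card := by
        calc 4 * (t * P ^ 2) = t * (4 * P ^ 2) := by ring
          _ ≤ t * (5 * (univ.filter (fun l : Pt P => ∃ j ∈ U, onLine l j)).card) :=
            Nat.mul_le_mul_left _ c3
          _ ≤ _ := by linarith
      have c1' : (S.card : ℝ) * 2 ^ (m0 + P ^ 2) = H.card * 2 ^ n := by exact_mod_cast c1
      have c4' : (4 : ℝ) * (t * P ^ 2) ≤ 5 * H.card := by exact_mod_cast c4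
      have hN : (0 : ℝ) < 2 ^ (m0 + P ^ 2) := by positivity
      have hn2 : (0 : ℝ) < 2 ^ n := by positivity
      have c5 : 2 * ε * 2 ^ (m0 + P ^ 2) ≤ (H.card : ℝ) := by linarith
      have c6 : (2 * ε * 2 ^ n) * 2 ^ (m0 + P ^ 2) ≤ (S.card : ℝ) * 2 ^ (m0 + P ^ 2) := by
        rw [c1']
        nlinarith [mul_le_mul_of_nonneg_right c5 hn2.le]
      exact le_of_mul_le_mul_right c6 hN
    · intro x hx
      simp only [hS, hH, Finset.mem_filter, Finset.mem_univ, true_and] at hx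
      have hj : jc (cellOf e μ u x) = hx.choose := by
        simp only [hjc]; rw [dif_pos hx]
      obtain ⟨hjU, l, hl, hjl⟩ := hx.choose_spec
      simp only
      rw [hj]
      refine ⟨?_, _, hjU, rfl⟩
      exact fn_flip line e he μ u b A x l _ hl hjl (hUA _ hjU)
  by_cases hJ1 : ∀ v, addrE e μ v ∈ J
  · set U := univ.filter (fun j => A j = true ∧ actE e μ j ∉ J) with hU
    have hUc : 4 * P ≤ U.card := by
      set U' := univ.filter (fun j => A j = true ∧ actE e μ j ∈ J) with hU'
      have a1 : (univ.filter (fun j => A j = true)).card ≤ U.card + U'.card := by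
        refine le_trans (Finset.card_le_card ?_) (Finset.card_union_le U U')
        intro j hj
        simp only [hU, hU', Finset.mem_union, Finset.mem_filter, Finset.mem_univ, true_and] at hj ⊢
        tauto
      have a2 : (univ.image (addrE e μ) ∪ U'.image (actE e μ)).card ≤ J.card := by
        apply Finset.card_le_card
        intro i hi
        simp only [hU', Finset.mem_union, Finset.mem_image, Finset.mem_filter, Finset.mem_univ,
          true_and] at hi
        rcases hi with ⟨v, rfl⟩ | ⟨j, hj, rfl⟩
        · exact hJ1 v
        · exact hj.2
      rw [Finset.card_union_of_disjoint, Finset.card_image_of_injective _ (addrE_inj e he μ),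
        Finset.card_image_of_injective _ (actE_inj e he μ)] at a2
      · have : (univ : Finset (Fin m0 ⊕ Pt P)).card = m0 + P ^ 2 := by simp [ZMod.card, sq]
        omega
      · rw [Finset.disjoint_left]
        intro i hi hi'
        simp only [Finset.mem_image, Finset.mem_univ, true_and] at hi hi'
        obtain ⟨v, rfl⟩ := hi
        obtain ⟨j, _, hj⟩ := hi'
        exact addrE_ne_actE e he μ v j hj.symm
    obtain ⟨S, σ, hσ, hS, hx⟩ := key U (by intro j hj; simp only [hU, Finset.mem_filter] at hj; exact hj.2.1) hUc
    have hc := half_count S D σ hσ (by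
      intro x hxS
      obtain ⟨hne, j, hj, hσx⟩ := hx x hxS
      have hgg : g (σ x) = g x := by
        rw [hσx]; apply hgflip
        simp only [hU, Finset.mem_filter] at hj; exact hj.2.2
      simp only [hD, Finset.mem_filter, Finset.mem_univ, true_and]
      rw [hgg]
      by_contra hcon
      push Not at hcon
      exact hne (hcon.2.trans hcon.1.symm))
    have hc' : (S.card : ℝ) ≤ 2 * D.card := by exact_mod_cast hc
    linarith
  · push Not at hJ1
    obtain ⟨v, hv⟩ := hJ1
    obtain ⟨S, σ, hσ, hS, hx⟩ := key (univ.filter (fun j => A j = true)) (by simp) (by omega)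
    set T := univ.filter (fun x => f x = true) with hT
    have hc := half_count S T σ hσ (by
      intro x hxS
      obtain ⟨hne, _⟩ := hx x hxS
      simp only [hT, Finset.mem_filter, Finset.mem_univ, true_and]
      revert hne
      cases f x <;> cases f (σ x) <;> simp)
    have hflip : ∀ x, f x = true → f (flip (addrE e μ v) x) = false := by
      intro x hfx
      have hn : line (cellOf e μ u x) ≠ none := by
        intro h
        simp [hf, fn, h] at hfx
      have := h1 _ v hn
      simp only [hf, fn]
      rw [cell_flip_addr e he, this]
    have hc2 := half_count (T ∪ T.image (flip (addrE e μ v))) D (flip (addrE e μ v)) (flip_inj _) (by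
      have aux : ∀ x, f x = true → f x ≠ g x ∨ f (flip (addrE e μ v) x) ≠ g (flip (addrE e μ v) x) := by
        intro x hfx
        rw [hgflip _ _ hv, hflip x hfx, hfx]
        cases g x <;> simp
      intro x hxT
      simp only [hT, hD, Finset.mem_union, Finset.mem_image, Finset.mem_filter, Finset.mem_univ,
        true_and] at hxT ⊢
      rcases hxT with hxT | ⟨y, hy, rfl⟩
      · exact aux x hxT
      · rw [flip_flip]
        exact (aux y hy).symm)
    rw [Finset.card_union_of_disjoint, Finset.card_image_of_injective _ (flip_inj _)] at hc2
    · have hc' : (S.card : ℝ) ≤ 2 * D.card := by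
        have : S.card ≤ 2 * D.card := by omega
        exact_mod_cast this
      linarith
    · rw [Finset.disjoint_left]
      intro x hx hx'
      simp only [hT, Finset.mem_image, Finset.mem_filter, Finset.mem_univ, true_and] at hx hx'
      obtain ⟨y, hy, rfl⟩ := hx'
      rw [hflip y hy] at hx
      exact absurd hx (by simp)

/-! ### Indistinguishability -/

theorem val_sub {P : ℕ} [Fact P.Prime] (l : Pt P) (A A' y y' : Pt P → Bool)
    (h : ∀ j, onLine l j → y j ≠ y' j → A j = A' j) :
    val l A y - val l A y' = val l A' y - val l A' y' := by
  unfold val par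
  rw [← Finset.sum_sub_distrib, ← Finset.sum_sub_distrib]
  apply Finset.sum_congr rfl
  intro j _
  by_cases h1 : onLine l j
  · by_cases h2 : y j = y' j
    · simp [h2]
    · beta_reduce
      rw [h j h1 h2]
  · simp [h1]

/-- The unshifted address. -/
def addr {P m0 n : ℕ} (e : Fin m0 ⊕ (Pt P × Bool) → Fin n) (μ : Pt P → Bool)
    (x : Fin n → Bool) : Cell P m0 := fun i => x (addrE e μ i)

open Classical in
/-- A representative query in each cell. -/
noncomputable def rep {P m0 n q : ℕ} (e : Fin m0 ⊕ (Pt P × Bool) → Fin n) (μ : Pt P → Bool)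
    (X : Fin q → (Fin n → Bool)) (z : Cell P m0) : Fin n → Bool :=
  if h : ∃ i, addr e μ (X i) = z then X h.choose else fun _ => false

/-- Points where query `i` differs from the representative of its cell. -/
noncomputable def dif {P m0 n q : ℕ} [Fact P.Prime] (e : Fin m0 ⊕ (Pt P × Bool) → Fin n)
    (μ : Pt P → Bool) (X : Fin q → (Fin n → Bool)) (i : Fin q) : Finset (Pt P) :=
  univ.filter (fun j => X i (actE e μ j) ≠ rep e μ X (addr e μ (X i)) (actE e μ j))

open Classical in
/-- The touched set. -/
noncomputable def touched {P m0 n q : ℕ} [Fact P.Prime] (line : Cell P m0 → Option (Pt P))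
    (e : Fin m0 ⊕ (Pt P × Bool) → Fin n)
    (μ : Pt P → Bool) (X : Fin q → (Fin n → Bool)) (u : Cell P m0) : Finset (Pt P) :=
  univ.biUnion (fun i => (dif e μ X i).filter
    (fun j => ∃ l, line (cellOf e μ u (X i)) = some l ∧ onLine l j))

/-- Indicator that the responses are accepted. -/
def ind {P m0 n q : ℕ} [Fact P.Prime] (line : Cell P m0 → Option (Pt P))
    (e : Fin m0 ⊕ (Pt P × Bool) → Fin n) (X : Fin q → (Fin n → Bool)) (h : (Fin q → Bool) → Bool)
    (μ : Pt P → Bool) (u : Cell P m0) (b : Cell P m0 → ZMod 2) (A : Pt P → Bool) : ℝ :=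
  if h (fun i => fn line e μ u b A (X i)) = true then 1 else 0

theorem sum_ind_congr {P m0 n q : ℕ} [Fact P.Prime] (line : Cell P m0 → Option (Pt P))
    (e : Fin m0 ⊕ (Pt P × Bool) → Fin n) (X : Fin q → (Fin n → Bool)) (h : (Fin q → Bool) → Bool)
    (μ : Pt P → Bool) (u : Cell P m0) (A A' : Pt P → Bool)
    (hA : ∀ j ∈ touched line e μ X u, A j = A' j) :
    ∑ b, ind line e X h μ u b A = ∑ b, ind line e X h μ u b A' := by
  classical
  set c : (Pt P → Bool) → Cell P m0 → ZMod 2 := fun A z =>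
    match line z with
    | none => 0
    | some l => val l A (fun j => rep e μ X (fun i => xor (z i) (u i)) (actE e μ j)) with hc
  rw [← (Equiv.subRight (c A)).sum_comp, ← (Equiv.subRight (c A')).sum_comp (fun b => ind line e X h μ u b A')]
  apply Finset.sum_congr rfl
  intro b _
  unfold ind
  have : (fun i => fn line e μ u ((Equiv.subRight (c A)) b) A (X i))
      = (fun i => fn line e μ u ((Equiv.subRight (c A')) b) A' (X i)) := by
    funext i
    unfold fn
    cases hl : line (cellOf e μ u (X i)) with
    | none => rfl
    | some l =>
      have hz : (fun k => xor (cellOf e μ u (X i) k) (u k)) = addr e μ (X i) := by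
        funext k
        simp [cellOf, addr]
      have hcA : ∀ A, c A (cellOf e μ u (X i))
          = val l A (fun j => rep e μ X (addr e μ (X i)) (actE e μ j)) := by
        intro A
        simp only [hc, hl, hz]
      have hv := val_sub l A A' (fun j => X i (actE e μ j))
        (fun j => rep e μ X (addr e μ (X i)) (actE e μ j)) (by
          intro j hj hne
          apply hA
          simp only [touched, Finset.mem_biUnion, Finset.mem_univ, true_and, Finset.mem_filter, dif]
          exact ⟨i, hne, l, hl, hj⟩)
      simp only [Equiv.subRight_apply, Pi.sub_apply, hcA]
      congr 2
      linear_combination hv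
  rw [this]

theorem sum_touched {P m0 n q t : ℕ} [Fact P.Prime] (line : Cell P m0 → Option (Pt P))
    (e : Fin m0 ⊕ (Pt P × Bool) → Fin n) (X : Fin q → (Fin n → Bool))
    (h2 : ∀ l, (univ.filter (fun z => line z = some l)).card = t)
    (μ : Pt P → Bool) (Dd : ℕ) (hD : ∀ i, (dif e μ X i).card ≤ Dd) :
    ∑ u, (touched line e μ X u).card ≤ q * Dd * (P * t) := by
  classical
  have h3 : ∀ (i : Fin q) (j : Pt P),
      (univ.filter (fun u : Cell P m0 => ∃ l, line (cellOf e μ u (X i)) = some l ∧ onLine l j)).card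
        ≤ P * t := by
    intro i j
    have a1 : (univ.filter (fun u : Cell P m0 => ∃ l, line (cellOf e μ u (X i)) = some l ∧ onLine l j)).card
        ≤ ((univ.filter (fun l : Pt P => onLine l j)).biUnion
          (fun l => univ.filter (fun z => line z = some l))).card := by
      apply Finset.card_le_card_of_injOn (fun u => cellOf e μ u (X i))
      · intro u hu
        have hu := (Finset.mem_filter.1 hu).2
        obtain ⟨l, hl, hj⟩ := hu
        simp only [Finset.coe_biUnion, Set.mem_iUnion, Finset.mem_coe, Finset.mem_filter,
          Finset.mem_univ, true_and]
        exact ⟨l, hj, hl⟩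
      · intro u _ u' _ huu
        funext k
        have := congrFun huu k
        simpa [cellOf] using this
    refine a1.trans (Finset.card_biUnion_le.trans ?_)
    rw [Finset.sum_congr rfl (fun l _ => h2 l)]
    simp [card_lines_through]
  calc ∑ u, (touched line e μ X u).card
      ≤ ∑ u, ∑ i, ∑ j ∈ dif e μ X i,
          (if ∃ l, line (cellOf e μ u (X i)) = some l ∧ onLine l j then 1 else 0) := by
        apply Finset.sum_le_sum
        intro u _
        refine Finset.card_biUnion_le.trans ?_
        apply Finset.sum_le_sum
        intro i _
        rw [Finset.card_filter]
    _ = ∑ i, ∑ j ∈ dif e μ X i,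
        (univ.filter (fun u : Cell P m0 => ∃ l, line (cellOf e μ u (X i)) = some l ∧ onLine l j)).card := by
        rw [Finset.sum_comm]
        apply Finset.sum_congr rfl
        intro i _
        rw [Finset.sum_comm]
        apply Finset.sum_congr rfl
        intro j _
        rw [Finset.card_filter]
    _ ≤ ∑ i : Fin q, Dd * (P * t) := by
        apply Finset.sum_le_sum
        intro i _
        refine (Finset.sum_le_sum (fun j _ => h3 i j)).trans ?_
        rw [Finset.sum_const, smul_eq_mul]
        exact Nat.mul_le_mul_right _ (hD i)
    _ = _ := by simp; ring

/-- The pair is far apart but collides under `μ`. -/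
def bad {P m0 n : ℕ} [Fact P.Prime] (e : Fin m0 ⊕ (Pt P × Bool) → Fin n)
    (Dd : ℕ) (x x' : Fin n → Bool) (μ : Pt P → Bool) : Prop :=
  addr e μ x = addr e μ x' ∧ Dd < (univ.filter (fun j => x (actE e μ j) ≠ x' (actE e μ j))).card

open Classical in
theorem bad_count {P m0 n : ℕ} [Fact P.Prime] (e : Fin m0 ⊕ (Pt P × Bool) → Fin n)
    (Dd : ℕ) (x x' : Fin n → Bool) :
    (univ.filter (fun μ => bad e Dd x x' μ)).card * 2 ^ Dd ≤ 2 ^ (P ^ 2) := by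
  rcases Finset.eq_empty_or_nonempty (univ.filter (fun μ => bad e Dd x x' μ)) with h | ⟨μs, hμs⟩
  · rw [h]; simp
  · have hμs := (Finset.mem_filter.1 hμs).2
    obtain ⟨ha, hd⟩ := hμs
    set Γ := univ.filter (fun j => x (actE e μs j) ≠ x' (actE e μs j)) with hΓ
    have hsub : (univ.filter (fun μ => bad e Dd x x' μ)) ⊆
        univ.filter (fun μ : Pt P → Bool => (fun i : {j // j ∈ Γ} => xor (μ i.1) (μs i.1))
          ∈ ({fun _ => false} : Finset ({j // j ∈ Γ} → Bool))) := by
      intro μ hμ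
      have hμ := (Finset.mem_filter.1 hμ).2
      simp only [Finset.mem_filter, Finset.mem_univ, true_and, Finset.mem_singleton]
      funext i
      have hi : x (actE e μs i.1) ≠ x' (actE e μs i.1) := (Finset.mem_filter.1 i.2).2
      have h1 := congrFun hμ.1 (Sum.inr i.1)
      simp only [addr, addrE, actE] at h1 hi
      by_contra hne
      have hx : μ i.1 = !μs i.1 := by
        revert hne
        cases μ i.1 <;> cases μs i.1 <;> simp
      rw [hx] at h1
      exact hi h1
    have hc := Finset.card_le_card hsub
    have hf := fiber_count (fun i : {j // j ∈ Γ} => i.1) Subtype.val_injective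
      (fun i => μs i.1) {fun _ => false}
    have hcard : Fintype.card (Pt P) = P ^ 2 := by simp [ZMod.card, sq]
    rw [Finset.card_singleton, one_mul, hcard, Fintype.card_coe] at hf
    calc _ ≤ _ * 2 ^ Γ.card :=
          Nat.mul_le_mul hc (Nat.pow_le_pow_right (by norm_num) hd.le)
      _ = _ := hf

theorem sum_bw_le_one {ι : Type*} [Fintype ι] [DecidableEq ι] (p : ℝ) (h0 : 0 ≤ p) (h1 : p ≤ 1)
    (G : (ι → Bool) → ℝ) (hG1 : ∀ x, G x ≤ 1) : ∑ x, bw (fun _ => p) x * G x ≤ 1 := by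
  refine le_trans ?_ (le_of_eq (bw_sum (fun _ : ι => p)))
  apply Finset.sum_le_sum
  intro x _
  nlinarith [bw_nonneg (fun _ : ι => p) (fun _ => h0) (fun _ => h1) x, hG1 x]

theorem sum_bw_nonneg {ι : Type*} [Fintype ι] [DecidableEq ι] (p : ℝ) (h0 : 0 ≤ p) (h1 : p ≤ 1)
    (G : (ι → Bool) → ℝ) (hG0 : ∀ x, 0 ≤ G x) : 0 ≤ ∑ x, bw (fun _ => p) x * G x :=
  Finset.sum_nonneg fun x _ =>
    mul_nonneg (bw_nonneg (fun _ : ι => p) (fun _ => h0) (fun _ => h1) x) (hG0 x)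

theorem indist {P m0 n q t : ℕ} [Fact P.Prime] (line : Cell P m0 → Option (Pt P))
    (e : Fin m0 ⊕ (Pt P × Bool) → Fin n) (X : Fin q → (Fin n → Bool)) (h : (Fin q → Bool) → Bool)
    (h2 : ∀ l, (univ.filter (fun z => line z = some l)).card = t)
    (γ δ : ℝ) (hγ0 : 0 ≤ γ) (hγ1 : γ ≤ 1 / 2) (hδ : 0 < δ) (hδ1 : δ ≤ 1) (Dd : ℕ) :
    ∑ μ, ∑ u, (∑ A, bw (fun _ => 1 / 2) A * ((∑ b, ind line e X h μ u b A) / Fintype.card (Cell P m0 → ZMod 2))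
      - ∑ A, bw (fun _ => 1 / 2 + γ) A * ((∑ b, ind line e X h μ u b A) / Fintype.card (Cell P m0 → ZMod 2)))
    ≤ 2 ^ (P ^ 2) * 2 ^ (m0 + P ^ 2) * ((q : ℝ) ^ 2 / 2 ^ Dd + δ / 2
        + 4 * γ ^ 2 * (q * Dd * (P * t)) / δ / 2 ^ (m0 + P ^ 2)) := by
  classical
  set G : (Pt P → Bool) → Cell P m0 → (Pt P → Bool) → ℝ := fun μ u A =>
    (∑ b, ind line e X h μ u b A) / Fintype.card (Cell P m0 → ZMod 2) with hG
  have hcC : Fintype.card (Cell P m0) = 2 ^ (m0 + P ^ 2) := by simp [ZMod.card, sq]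
  have hcM : Fintype.card (Pt P → Bool) = 2 ^ (P ^ 2) := by simp [ZMod.card, sq]
  have hNB : (0 : ℝ) < Fintype.card (Cell P m0 → ZMod 2) := by
    exact_mod_cast Fintype.card_pos
  have hG0 : ∀ μ u A, 0 ≤ G μ u A := by
    intro μ u A
    apply div_nonneg _ hNB.le
    apply Finset.sum_nonneg
    intro b _
    unfold ind; split_ifs <;> norm_num
  have hG1 : ∀ μ u A, G μ u A ≤ 1 := by
    intro μ u A
    rw [hG]
    simp only
    rw [div_le_one hNB]
    calc ∑ b, ind line e X h μ u b A ≤ ∑ b : Cell P m0 → ZMod 2, (1 : ℝ) := by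
          apply Finset.sum_le_sum
          intro b _
          unfold ind; split_ifs <;> norm_num
      _ = _ := by rw [Finset.sum_const, nsmul_eq_mul, mul_one, Finset.card_univ]
  set B := univ.filter (fun μ => ∃ pr : Fin q × Fin q, bad e Dd (X pr.1) (X pr.2) μ) with hB
  have hBc : (B.card : ℝ) ≤ (q : ℝ) ^ 2 / 2 ^ Dd * 2 ^ (P ^ 2) := by
    have a1 : B.card ≤ ∑ pr : Fin q × Fin q, (univ.filter (fun μ => bad e Dd (X pr.1) (X pr.2) μ)).card := by
      refine le_trans (Finset.card_le_card ?_) Finset.card_biUnion_le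
      intro μ hμ
      obtain ⟨pr, hpr⟩ := (Finset.mem_filter.1 hμ).2
      simp only [Finset.mem_biUnion, Finset.mem_univ, true_and, Finset.mem_filter]
      exact ⟨pr, hpr⟩
    have a2 : B.card * 2 ^ Dd ≤ q ^ 2 * 2 ^ (P ^ 2) := by
      calc B.card * 2 ^ Dd ≤ (∑ pr : Fin q × Fin q, (univ.filter (fun μ => bad e Dd (X pr.1) (X pr.2) μ)).card) * 2 ^ Dd :=
            Nat.mul_le_mul_right _ a1
        _ = ∑ pr : Fin q × Fin q, (univ.filter (fun μ => bad e Dd (X pr.1) (X pr.2) μ)).card * 2 ^ Dd := by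
            rw [Finset.sum_mul]
        _ ≤ ∑ pr : Fin q × Fin q, 2 ^ (P ^ 2) := Finset.sum_le_sum (fun pr _ => bad_count e Dd _ _)
        _ = _ := by simp [sq]
    have a3 : (B.card : ℝ) * 2 ^ Dd ≤ (q : ℝ) ^ 2 * 2 ^ (P ^ 2) := by exact_mod_cast a2
    rw [div_mul_eq_mul_div, le_div_iff₀ (by positivity)]
    exact a3
  have hpt : ∀ μ, ∑ u, (∑ A, bw (fun _ => 1 / 2) A * G μ u A
      - ∑ A, bw (fun _ => 1 / 2 + γ) A * G μ u A)
      ≤ (if μ ∈ B then (2 : ℝ) ^ (m0 + P ^ 2) else 0) + (2 ^ (m0 + P ^ 2) * (δ / 2)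
        + 4 * γ ^ 2 * (q * Dd * (P * t)) / δ) := by
    intro μ
    by_cases hμ : μ ∈ B
    · rw [if_pos hμ]
      have : ∑ u, (∑ A, bw (fun _ => 1 / 2) A * G μ u A
          - ∑ A, bw (fun _ => 1 / 2 + γ) A * G μ u A) ≤ ∑ u : Cell P m0, (1 : ℝ) := by
        apply Finset.sum_le_sum
        intro u _
        have b1 := sum_bw_le_one (1 / 2) (by norm_num) (by norm_num) (G μ u) (hG1 μ u)
        have b2 := sum_bw_nonneg (1 / 2 + γ) (by linarith) (by linarith) (G μ u) (hG0 μ u)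
        linarith
      rw [Finset.sum_const, nsmul_eq_mul, mul_one, Finset.card_univ, hcC] at this
      push_cast at this
      have : 0 ≤ (2 : ℝ) ^ (m0 + P ^ 2) * (δ / 2) + 4 * γ ^ 2 * (q * Dd * (P * t)) / δ := by positivity
      linarith
    · rw [if_neg hμ, zero_add]
      have hD : ∀ i, (dif e μ X i).card ≤ Dd := by
        intro i
        by_contra hcon
        push Not at hcon
        apply hμ
        simp only [hB, Finset.mem_filter, Finset.mem_univ, true_and]
        have hex : ∃ i', addr e μ (X i') = addr e μ (X i) := ⟨i, rfl⟩
        refine ⟨(i, hex.choose), hex.choose_spec.symm, ?_⟩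
        have : rep e μ X (addr e μ (X i)) = X hex.choose := by
          unfold rep; rw [dif_pos hex]
        unfold dif at hcon
        rw [this] at hcon
        exact hcon
      have ht := sum_touched line e X h2 μ Dd hD
      have ht' : ∑ u, ((touched line e μ X u).card : ℝ) ≤ q * Dd * (P * t) := by exact_mod_cast ht
      calc _ ≤ ∑ u, (δ / 2 + 4 * γ ^ 2 / δ * (touched line e μ X u).card) := by
            apply Finset.sum_le_sum
            intro u _
            have := bw_tv (touched line e μ X u) γ δ hγ0 hγ1 hδ hδ1 (G μ u) (by
              intro A A' hA
              simp only [hG]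
              rw [sum_ind_congr line e X h μ u A A' hA]) (hG0 μ u) (hG1 μ u)
            refine this.trans (le_of_eq ?_)
            ring
        _ = 2 ^ (m0 + P ^ 2) * (δ / 2) + 4 * γ ^ 2 / δ * ∑ u, ((touched line e μ X u).card : ℝ) := by
            rw [Finset.sum_add_distrib, Finset.sum_const, nsmul_eq_mul, Finset.card_univ, hcC,
              Finset.mul_sum]
            push_cast
            ring
        _ ≤ 2 ^ (m0 + P ^ 2) * (δ / 2) + 4 * γ ^ 2 / δ * (q * Dd * (P * t)) := by gcongr
        _ = _ := by ring
  calc _ ≤ ∑ μ, ((if μ ∈ B then (2 : ℝ) ^ (m0 + P ^ 2) else 0) + (2 ^ (m0 + P ^ 2) * (δ / 2)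
        + 4 * γ ^ 2 * (q * Dd * (P * t)) / δ)) := Finset.sum_le_sum (fun μ _ => hpt μ)
    _ = B.card * 2 ^ (m0 + P ^ 2) + 2 ^ (P ^ 2) * (2 ^ (m0 + P ^ 2) * (δ / 2)
        + 4 * γ ^ 2 * (q * Dd * (P * t)) / δ) := by
        rw [Finset.sum_add_distrib, Finset.sum_const, nsmul_eq_mul, Finset.card_univ, hcM,
          ← Finset.sum_filter, Finset.sum_const, nsmul_eq_mul]
        simp
    _ ≤ ((q : ℝ) ^ 2 / 2 ^ Dd * 2 ^ (P ^ 2)) * 2 ^ (m0 + P ^ 2) + 2 ^ (P ^ 2) * (2 ^ (m0 + P ^ 2) * (δ / 2)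
        + 4 * γ ^ 2 * (q * Dd * (P * t)) / δ) := by gcongr
    _ = _ := by
        field_simp
        ring

/-! ### Assembly -/

theorem acc_le_one {n q : ℕ} (A : RandNonAdaptive n q) (f : (Fin n → Bool) → Bool) :
    acceptProb A f ≤ 1 := by
  unfold acceptProb
  rw [← A.sum_eq_one]
  apply Finset.sum_le_sum
  intro p _
  have := A.nonneg p
  split_ifs <;> linarith

theorem acc_nonneg {n q : ℕ} (A : RandNonAdaptive n q) (f : (Fin n → Bool) → Bool) :
    0 ≤ acceptProb A f := by
  unfold acceptProb
  apply Finset.sum_nonneg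
  intro p _
  have := A.nonneg p
  split_ifs <;> linarith

theorem acc_add_rej {n q : ℕ} (A : RandNonAdaptive n q) (f : (Fin n → Bool) → Bool) :
    acceptProb A f + rejectProb A f = 1 := by
  unfold acceptProb rejectProb
  rw [← A.sum_eq_one, ← Finset.sum_add_distrib]
  apply Finset.sum_congr rfl
  intro p _
  cases p.2 (fun i => f (p.1 i)) <;> simp

theorem acc_eq {n q : ℕ} (A : RandNonAdaptive n q) (f : (Fin n → Bool) → Bool) :
    acceptProb A f = ∑ p, A.w p * (if p.2 (fun i => f (p.1 i)) = true then 1 else 0) := by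
  unfold acceptProb
  apply Finset.sum_congr rfl
  intro p _
  simp

theorem avg_lower {ι : Type*} [Fintype ι] [DecidableEq ι] (p : ℝ) (h0 : 0 ≤ p) (h1 : p ≤ 1)
    (S : (ι → Bool) → Prop) [DecidablePred S] (G : (ι → Bool) → ℝ)
    (hG0 : ∀ x, 0 ≤ G x) (hG : ∀ x, ¬ S x → 5 / 6 ≤ G x)
    (hS : ∑ x, (if S x then bw (fun _ => p) x else 0) ≤ 1 / 16) :
    5 / 6 - 1 / 16 ≤ ∑ x, bw (fun _ => p) x * G x := by
  have h : ∑ x, (5 / 6 * bw (fun _ : ι => p) x - (if S x then bw (fun _ => p) x else 0))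
      ≤ ∑ x, bw (fun _ => p) x * G x := by
    apply Finset.sum_le_sum
    intro x _
    have hb := bw_nonneg (fun _ : ι => p) (fun _ => h0) (fun _ => h1) x
    by_cases hx : S x
    · rw [if_pos hx]
      nlinarith [mul_nonneg hb (hG0 x)]
    · rw [if_neg hx]
      nlinarith [hG x hx]
  rw [Finset.sum_sub_distrib, ← Finset.mul_sum, bw_sum] at h
  linarith

theorem avg_upper {ι : Type*} [Fintype ι] [DecidableEq ι] (p : ℝ) (h0 : 0 ≤ p) (h1 : p ≤ 1)
    (S : (ι → Bool) → Prop) [DecidablePred S] (G : (ι → Bool) → ℝ)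
    (hG1 : ∀ x, G x ≤ 1) (hG : ∀ x, ¬ S x → G x ≤ 1 / 6)
    (hS : ∑ x, (if S x then bw (fun _ => p) x else 0) ≤ 1 / 16) :
    ∑ x, bw (fun _ => p) x * G x ≤ 1 / 6 + 1 / 16 := by
  have h : ∑ x, bw (fun _ => p) x * G x
      ≤ ∑ x, (1 / 6 * bw (fun _ : ι => p) x + (if S x then bw (fun _ => p) x else 0)) := by
    apply Finset.sum_le_sum
    intro x _
    have hb := bw_nonneg (fun _ : ι => p) (fun _ => h0) (fun _ => h1) x
    by_cases hx : S x
    · rw [if_pos hx]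
      nlinarith [hG1 x]
    · rw [if_neg hx]
      nlinarith [hG x hx]
  rw [Finset.sum_add_distrib, ← Finset.mul_sum, bw_sum] at h
  linarith

theorem core {P m0 n k q t a : ℕ} [Fact P.Prime] (line : Cell P m0 → Option (Pt P))
    (e : Fin m0 ⊕ (Pt P × Bool) → Fin n) (he : Function.Injective e)
    (h1 : ∀ z v, line z ≠ none → line (flip v z) = none)
    (h2 : ∀ l, (univ.filter (fun z => line z = some l)).card = t)
    (ε : ℝ) (hε : 2 * ε * 2 ^ (m0 + P ^ 2) ≤ 4 / 5 * (t * P ^ 2 : ℝ))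
    (ht : (t * P ^ 2 : ℝ) ≤ 3 * ε * 2 ^ (m0 + P ^ 2))
    (hk : m0 + P ^ 2 + a = k) (ha : (P : ℝ) ^ 2 / 2 + 2 * P ≤ a)
    (ha' : (a : ℝ) ≤ (P : ℝ) ^ 2 / 2 + 3 * P) (hP : 18 ≤ P)
    (T : RandNonAdaptive n q) (hT : IsJuntaTester n k q ε T) (Dd : ℕ) :
    2 / 3 - 1 / 8 ≤ (q : ℝ) ^ 2 / 2 ^ Dd + 1 / 10 + 4860 * ε * q * Dd / P ^ 3 := by
  classical
  have hPr : (18 : ℝ) ≤ P := by exact_mod_cast hP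
  have hcP : (Fintype.card (Pt P) : ℝ) = (P : ℝ) ^ 2 := by simp [ZMod.card, sq]
  have hcC : Fintype.card (Cell P m0) = 2 ^ (m0 + P ^ 2) := by simp [ZMod.card, sq]
  have hcM : Fintype.card (Pt P → Bool) = 2 ^ (P ^ 2) := by simp [ZMod.card, sq]
  set NB : ℝ := ((Fintype.card (Cell P m0 → ZMod 2) : ℕ) : ℝ) with hNBd
  have hNB : (0 : ℝ) < NB := by
    rw [hNBd]; exact_mod_cast Fintype.card_pos
  set M : ℝ := 2 ^ (P ^ 2) * 2 ^ (m0 + P ^ 2) with hM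
  have hMpos : 0 < M := by positivity
  set γ : ℝ := 9 / P with hγ
  have hγ0 : 0 ≤ γ := by positivity
  have hγ1 : γ ≤ 1 / 2 := by
    rw [hγ, div_le_div_iff₀ (by linarith) (by norm_num)]; linarith
  set G : (Pt P → Bool) → Cell P m0 → (Pt P → Bool) → ℝ := fun μ u A =>
    (∑ b, acceptProb T (fn line e μ u b A)) / NB with hG
  have hsum1 : ∀ c : ℝ, ∑ b : Cell P m0 → ZMod 2, c = NB * c := by
    intro c
    rw [Finset.sum_const, nsmul_eq_mul, Finset.card_univ]
  have hG0 : ∀ μ u A, 0 ≤ G μ u A := fun μ u A =>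
    div_nonneg (Finset.sum_nonneg fun b _ => acc_nonneg T _) hNB.le
  have hGle : ∀ μ u A (c : ℝ), (∀ b, acceptProb T (fn line e μ u b A) ≤ c) → G μ u A ≤ c := by
    intro μ u A c hc
    simp only [hG]
    rw [div_le_iff₀ hNB, mul_comm, ← hsum1]
    exact Finset.sum_le_sum fun b _ => hc b
  have hGge : ∀ μ u A (c : ℝ), (∀ b, c ≤ acceptProb T (fn line e μ u b A)) → c ≤ G μ u A := by
    intro μ u A c hc
    simp only [hG]
    rw [le_div_iff₀ hNB, mul_comm, ← hsum1]
    exact Finset.sum_le_sum fun b _ => hc b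
  have hcheb : ∀ (p : ℝ) (h0 : 0 ≤ p) (h1 : p ≤ 1) (S : (Pt P → Bool) → Prop) [DecidablePred S]
      (hS : ∀ x, S x → 2 * (P : ℝ) ≤ |((univ.filter (fun i => x i = true)).card : ℝ) - (P : ℝ) ^ 2 * p|),
      ∑ x, (if S x then bw (fun _ => p) x else 0) ≤ 1 / 16 := by
    intro p h0 h1 S _ hS
    have := bw_cheb p h0 h1 (2 * (P : ℝ)) (by linarith) S (by rw [hcP]; exact hS)
    rw [hcP] at this
    refine this.trans (le_of_eq ?_)
    field_simp
    ring
  have hyes : ∀ μ u, 5 / 6 - 1 / 16 ≤ ∑ A, bw (fun _ => 1 / 2) A * G μ u A := by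
    intro μ u
    apply avg_lower (1 / 2) (by norm_num) (by norm_num)
      (fun A : Pt P → Bool => a < (univ.filter (fun i => A i = true)).card) _ (hG0 μ u)
    · intro A hA
      apply hGge
      intro b
      apply hT.1
      apply fn_junta
      push Not at hA
      omega
    · apply hcheb _ (by norm_num) (by norm_num)
      intro A hA
      have hA' : (a : ℝ) < (univ.filter (fun i => A i = true)).card := by exact_mod_cast hA
      refine le_trans ?_ (le_abs_self _)
      linarith
  have hno : ∀ μ u, ∑ A, bw (fun _ => 1 / 2 + γ) A * G μ u A ≤ 1 / 6 + 1 / 16 := by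
    intro μ u
    apply avg_upper (1 / 2 + γ) (by linarith) (by linarith)
      (fun A : Pt P → Bool => (univ.filter (fun i => A i = true)).card < a + 4 * P) _
      (fun A => hGle μ u A 1 (fun b => acc_le_one T _))
    · intro A hA
      apply hGle
      intro b
      have := hT.2 (fn line e μ u b A) (fn_far line e he h1 h2 μ u b A ε hε (by omega) (by
        push Not at hA
        omega))
      have := acc_add_rej T (fn line e μ u b A)
      linarith
    · apply hcheb _ (by linarith) (by linarith)
      intro A hA
      have hA' : ((univ.filter (fun i => A i = true)).card : ℝ) < a + 4 * P := by exact_mod_cast hA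
      rw [abs_sub_comm]
      refine le_trans ?_ (le_abs_self _)
      have : (P : ℝ) ^ 2 * (1 / 2 + γ) = (P : ℝ) ^ 2 / 2 + 9 * P := by
        rw [hγ]; field_simp
      linarith
  have hsumM : ∀ c : ℝ, ∑ μ : Pt P → Bool, ∑ u : Cell P m0, c = M * c := by
    intro c
    rw [Finset.sum_const, Finset.sum_const, nsmul_eq_mul, nsmul_eq_mul, Finset.card_univ,
      Finset.card_univ, hcC, hcM, hM]
    push_cast
    ring
  have hlow : M * (2 / 3 - 1 / 8) ≤ ∑ μ, ∑ u, (∑ A, bw (fun _ => 1 / 2) A * G μ u A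
      - ∑ A, bw (fun _ => 1 / 2 + γ) A * G μ u A) := by
    rw [← hsumM]
    apply Finset.sum_le_sum
    intro μ _
    apply Finset.sum_le_sum
    intro u _
    have := hyes μ u
    have := hno μ u
    linarith
  set R : ℝ := ((q : ℝ) ^ 2 / 2 ^ Dd + (1 / 5) / 2
        + 4 * γ ^ 2 * (q * Dd * (P * t)) / (1 / 5) / 2 ^ (m0 + P ^ 2)) with hR
  have hGe : ∀ μ u A, G μ u A = ∑ p, T.w p * ((∑ b, ind line e p.1 p.2 μ u b A) / NB) := by
    intro μ u A
    simp only [hG, acc_eq, ind]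
    rw [Finset.sum_comm, Finset.sum_div]
    apply Finset.sum_congr rfl
    intro p _
    rw [← Finset.mul_sum, mul_div_assoc]
  have hbG : ∀ (pp : ℝ) μ u, ∑ A, bw (fun _ => pp) A * G μ u A
      = ∑ p, T.w p * ∑ A, bw (fun _ => pp) A * ((∑ b, ind line e p.1 p.2 μ u b A) / NB) := by
    intro pp μ u
    simp only [hGe, Finset.mul_sum]
    rw [Finset.sum_comm]
    apply Finset.sum_congr rfl
    intro p _
    apply Finset.sum_congr rfl
    intro A _
    ring
  have hup : ∑ μ, ∑ u, (∑ A, bw (fun _ => 1 / 2) A * G μ u A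
      - ∑ A, bw (fun _ => 1 / 2 + γ) A * G μ u A) ≤ M * R := by
    have e1 : ∑ μ, ∑ u, (∑ A, bw (fun _ => 1 / 2) A * G μ u A
      - ∑ A, bw (fun _ => 1 / 2 + γ) A * G μ u A)
      = ∑ p, T.w p * ∑ μ, ∑ u, (∑ A, bw (fun _ => 1 / 2) A * ((∑ b, ind line e p.1 p.2 μ u b A) / NB)
      - ∑ A, bw (fun _ => 1 / 2 + γ) A * ((∑ b, ind line e p.1 p.2 μ u b A) / NB)) := by
      calc _ = ∑ μ, ∑ u, ∑ p, T.w p * (∑ A, bw (fun _ => 1 / 2) A * ((∑ b, ind line e p.1 p.2 μ u b A) / NB)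
              - ∑ A, bw (fun _ => 1 / 2 + γ) A * ((∑ b, ind line e p.1 p.2 μ u b A) / NB)) := by
            apply Finset.sum_congr rfl
            intro μ _
            apply Finset.sum_congr rfl
            intro u _
            rw [hbG, hbG, ← Finset.sum_sub_distrib]
            apply Finset.sum_congr rfl
            intro p _
            rw [mul_sub]
        _ = ∑ μ, ∑ p, ∑ u, T.w p * (∑ A, bw (fun _ => 1 / 2) A * ((∑ b, ind line e p.1 p.2 μ u b A) / NB)
              - ∑ A, bw (fun _ => 1 / 2 + γ) A * ((∑ b, ind line e p.1 p.2 μ u b A) / NB)) := by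
            apply Finset.sum_congr rfl
            intro μ _
            rw [Finset.sum_comm]
        _ = _ := by
            rw [Finset.sum_comm]
            apply Finset.sum_congr rfl
            intro p _
            rw [Finset.mul_sum]
            apply Finset.sum_congr rfl
            intro μ _
            rw [Finset.mul_sum]
    rw [e1]
    calc _ ≤ ∑ p, T.w p * (M * R) := by
          apply Finset.sum_le_sum
          intro p _
          apply mul_le_mul_of_nonneg_left _ (T.nonneg p)
          exact indist line e p.1 p.2 h2 γ (1 / 5) hγ0 hγ1 (by norm_num) (by norm_num) Dd
      _ = M * R := by rw [← Finset.sum_mul, T.sum_eq_one, one_mul]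
  have hfin : 2 / 3 - 1 / 8 ≤ R := le_of_mul_le_mul_left (hlow.trans hup) hMpos
  refine hfin.trans ?_
  have hN : (0 : ℝ) < 2 ^ (m0 + P ^ 2) := by positivity
  have hlast : 4 * γ ^ 2 * (q * Dd * (P * t)) / (1 / 5) / 2 ^ (m0 + P ^ 2)
      ≤ 4860 * ε * q * Dd / P ^ 3 := by
    have hP0 : (0 : ℝ) < P := by linarith
    have e1 : 4 * γ ^ 2 * (q * Dd * (P * t)) / (1 / 5) / 2 ^ (m0 + P ^ 2)
        = 1620 * q * Dd / P ^ 3 * ((t * P ^ 2) / 2 ^ (m0 + P ^ 2)) := by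
      rw [hγ]; field_simp; ring
    rw [e1]
    have : (t * P ^ 2 : ℝ) / 2 ^ (m0 + P ^ 2) ≤ 3 * ε := by
      rw [div_le_iff₀ hN]; exact ht
    calc _ ≤ 1620 * q * Dd / P ^ 3 * (3 * ε) := by gcongr
      _ = _ := by ring
  rw [hR]
  linarith

theorem exists_line {P m0 t : ℕ} [Fact P.Prime] (ht : 2 * (t * P ^ 2) ≤ 2 ^ (m0 + P ^ 2)) :
    ∃ line : Cell P m0 → Option (Pt P), (∀ z v, line z ≠ none → line (flip v z) = none) ∧
      ∀ l, (univ.filter (fun z => line z = some l)).card = t := by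
  classical
  obtain ⟨E, hE, hEf⟩ := even_set (ι := Fin m0 ⊕ Pt P)
  have hcard : Fintype.card (Fin m0 ⊕ Pt P) = m0 + P ^ 2 := by simp [ZMod.card, sq]
  rw [hcard] at hE
  have hemb : Nonempty (Fin t × Pt P ↪ {z // z ∈ E}) := by
    apply Function.Embedding.nonempty_of_card_le
    rw [Fintype.card_coe]
    have : Fintype.card (Fin t × Pt P) = t * P ^ 2 := by simp [ZMod.card, sq]
    rw [this]
    omega
  obtain ⟨φ⟩ := hemb
  set ψ : Fin t × Pt P → Cell P m0 := fun w => (φ w).1 with hψ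
  have hψi : Function.Injective ψ := fun w w' h => φ.injective (Subtype.ext h)
  set line : Cell P m0 → Option (Pt P) := fun z =>
    if h : ∃ w, ψ w = z then some h.choose.2 else none with hl
  have hsome : ∀ w, line (ψ w) = some w.2 := by
    intro w
    have h : ∃ w', ψ w' = ψ w := ⟨w, rfl⟩
    simp only [hl]
    rw [dif_pos h]
    rw [hψi h.choose_spec]
  have hnone : ∀ z, line z ≠ none → ∃ w, ψ w = z := by
    intro z hz
    by_contra hcon
    apply hz
    simp only [hl]
    rw [dif_neg hcon]
  refine ⟨line, ?_, ?_⟩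
  · intro z v hz
    by_contra hcon
    obtain ⟨w, rfl⟩ := hnone z hz
    obtain ⟨w', hw'⟩ := hnone _ hcon
    apply hEf (ψ w) (φ w).2 v
    rw [← hw']
    exact (φ w').2
  · intro l
    have : univ.filter (fun z => line z = some l) = (univ : Finset (Fin t)).image (fun i => ψ (i, l)) := by
      ext z
      simp only [Finset.mem_filter, Finset.mem_univ, true_and, Finset.mem_image]
      constructor
      · intro hz
        obtain ⟨w, rfl⟩ := hnone z (by rw [hz]; simp)
        rw [hsome] at hz
        have : w.2 = l := by simpa using hz
        exact ⟨w.1, by rw [← this]⟩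
      · rintro ⟨i, rfl⟩
        rw [hsome]
    rw [this, Finset.card_image_of_injective]
    · simp
    · intro i i' h
      have := hψi h
      simpa using this

theorem core2 {P n k q : ℕ} (hPp : P.Prime) (hP : 18 ≤ P) (ε : ℝ) (hε0 : 0 < ε) (hε1 : ε ≤ 1 / 6)
    (hk1 : 2 * P ^ 2 ≤ k) (hk2 : 2 * k + P ^ 2 ≤ 2 * n)
    (hε2 : 2 * (P : ℝ) ^ 2 ≤ ε * 2 ^ (P ^ 2))
    (T : RandNonAdaptive n q) (hT : IsJuntaTester n k q ε T) (Dd : ℕ) :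
    2 / 3 - 1 / 8 ≤ (q : ℝ) ^ 2 / 2 ^ Dd + 1 / 10 + 4860 * ε * q * Dd / P ^ 3 := by
  have : Fact P.Prime := ⟨hPp⟩
  have hPP : 18 * P ≤ P ^ 2 := by nlinarith
  obtain ⟨a, ha⟩ : ∃ a, a = P ^ 2 / 2 + 2 * P + 1 := ⟨_, rfl⟩
  have ha1 : P ^ 2 + 4 * P ≤ 2 * a := by omega
  have ha2 : 2 * a ≤ P ^ 2 + 6 * P := by omega
  obtain ⟨m0, hm0⟩ : ∃ m0, m0 + P ^ 2 + a = k := ⟨k - P ^ 2 - a, by omega⟩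
  have ha1' : (P : ℝ) ^ 2 + 4 * P ≤ 2 * a := by exact_mod_cast ha1
  have ha2' : 2 * (a : ℝ) ≤ (P : ℝ) ^ 2 + 6 * P := by exact_mod_cast ha2
  have hPr : (18 : ℝ) ≤ P := by exact_mod_cast hP
  have hP2 : (0 : ℝ) < (P : ℝ) ^ 2 := by positivity
  have hNN : (2 : ℝ) ^ (P ^ 2) ≤ 2 ^ (m0 + P ^ 2) :=
    pow_le_pow_right₀ (by norm_num) (by omega)
  have hεN : 2 * (P : ℝ) ^ 2 ≤ ε * 2 ^ (m0 + P ^ 2) :=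
    hε2.trans (mul_le_mul_of_nonneg_left hNN hε0.le)
  set N : ℝ := 2 ^ (m0 + P ^ 2) with hN
  obtain ⟨t, ht⟩ : ∃ t : ℕ, t = ⌈5 / 2 * ε * N / (P : ℝ) ^ 2⌉₊ := ⟨_, rfl⟩
  have hNpos : 0 < N := by positivity
  have ht1 : 5 / 2 * ε * N ≤ t * (P : ℝ) ^ 2 := by
    have := Nat.le_ceil (5 / 2 * ε * N / (P : ℝ) ^ 2)
    rw [← ht, div_le_iff₀ hP2] at this
    exact this
  have ht2 : t * (P : ℝ) ^ 2 ≤ 3 * ε * N := by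
    have := (Nat.ceil_lt_add_one (a := 5 / 2 * ε * N / (P : ℝ) ^ 2) (by positivity)).le
    rw [← ht] at this
    have h := mul_le_mul_of_nonneg_right this hP2.le
    rw [add_mul, div_mul_cancel₀ _ hP2.ne'] at h
    linarith
  have ht3 : 2 * (t * P ^ 2) ≤ 2 ^ (m0 + P ^ 2) := by
    have : (2 : ℝ) * (t * (P : ℝ) ^ 2) ≤ N := by nlinarith
    rw [hN] at this
    exact_mod_cast this
  obtain ⟨line, h1, h2⟩ := exists_line ht3
  have hemb : Nonempty (Fin m0 ⊕ (Pt P × Bool) ↪ Fin n) := by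
    apply Function.Embedding.nonempty_of_card_le
    have : Fintype.card (Fin m0 ⊕ (Pt P × Bool)) = m0 + P ^ 2 * 2 := by simp [ZMod.card, sq]
    rw [this, Fintype.card_fin]
    omega
  obtain ⟨e⟩ := hemb
  exact core line e e.injective h1 h2 ε (by linarith) ht2 hm0 (by linarith) (by linarith) hP T hT Dd

/-! ### The easy bound -/

theorem easy {n k q : ℕ} (hkn : k < n) (ε : ℝ) (hε0 : 1 ≤ ε * 2 ^ n) (hε1 : ε ≤ 1 / 6)
    (T : RandNonAdaptive n q) (hT : IsJuntaTester n k q ε T) : 1 ≤ 3 * ε * q := by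
  classical
  have : Nonempty (Fin n) := ⟨⟨k, hkn⟩⟩
  obtain ⟨E, hE, hEf⟩ := even_set (ι := Fin n)
  rw [Fintype.card_fin] at hE
  have h2n : (0 : ℝ) < 2 ^ n := by positivity
  obtain ⟨s, hs⟩ : ∃ s : ℕ, s = ⌈ε * 2 ^ n⌉₊ := ⟨_, rfl⟩
  have hs1 : ε * 2 ^ n ≤ s := by rw [hs]; exact Nat.le_ceil _
  have hs2 : (s : ℝ) ≤ 2 * (ε * 2 ^ n) := by
    have := (Nat.ceil_lt_add_one (a := ε * 2 ^ n) (by linarith)).le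
    rw [← hs] at this
    linarith
  have hs3 : s ≤ E.card := by
    have hE' : (2 : ℝ) * E.card = 2 ^ n := by exact_mod_cast hE
    have : (s : ℝ) ≤ E.card := by nlinarith
    exact_mod_cast this
  obtain ⟨D, hDE, hDs⟩ := Finset.exists_subset_card_eq hs3
  set f : (Fin n → Bool) → (Fin n → Bool) → Bool := fun u x =>
    decide ((fun i => xor (x i) (u i)) ∈ D) with hf
  have hfar : ∀ u, FarFromJuntas n k ε (f u) := by
    intro u g hg
    obtain ⟨J, hJ, hg⟩ := hg
    have hv : ∃ v, v ∉ J := by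
      by_contra hcon
      push Not at hcon
      have : J = univ := Finset.eq_univ_iff_forall.2 hcon
      rw [this, Finset.card_univ, Fintype.card_fin] at hJ
      omega
    obtain ⟨v, hv⟩ := hv
    have hgflip : ∀ x, g (flip v x) = g x := by
      intro x
      apply hg
      intro i hi
      have : i ≠ v := fun h => hv (h ▸ hi)
      simp [flip, this]
    set Dis := univ.filter (fun x => f u x ≠ g x) with hDis
    set S := univ.filter (fun x => f u x = true) with hS
    have hScard : S.card = s := by
      rw [← hDs]
      apply Finset.card_bij (fun x _ => fun i => xor (x i) (u i))
      · intro x hx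
        simpa [hS, hf] using hx
      · intro x _ y _ h
        exact (xor_bij u).1 h
      · intro d hd
        obtain ⟨x, hx⟩ := (xor_bij u).2 d
        refine ⟨x, ?_, hx⟩
        simp only at hx
        simp only [hS, hf, Finset.mem_filter, Finset.mem_univ, true_and, decide_eq_true_eq]
        rw [hx]
        exact hd
    have hflip : ∀ x, f u x = true → f u (flip v x) = false := by
      intro x hfx
      simp only [hf, decide_eq_true_eq] at hfx
      have h1 := hEf _ (hDE hfx) v
      have h2 : (fun i => xor (flip v x i) (u i)) = flip v (fun i => xor (x i) (u i)) := by
        funext i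
        by_cases h : i = v
        · subst h; simp [flip]
        · simp [flip, h]
      simp only [hf, decide_eq_false_iff_not]
      rw [h2]
      exact fun h => h1 (hDE h)
    have hc2 := half_count (S ∪ S.image (flip v)) Dis (flip v) (flip_inj _) (by
      have aux : ∀ x, f u x = true → f u x ≠ g x ∨ f u (flip v x) ≠ g (flip v x) := by
        intro x hfx
        rw [hgflip, hflip x hfx, hfx]
        cases g x <;> simp
      intro x hxT
      simp only [hS, hDis, Finset.mem_union, Finset.mem_image, Finset.mem_filter, Finset.mem_univ,
        true_and] at hxT ⊢
      rcases hxT with hxT | ⟨y, hy, rfl⟩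
      · exact aux x hxT
      · rw [flip_flip]
        exact (aux y hy).symm)
    rw [Finset.card_union_of_disjoint, Finset.card_image_of_injective _ (flip_inj _)] at hc2
    · have : s ≤ Dis.card := by omega
      have : (s : ℝ) ≤ Dis.card := by exact_mod_cast this
      linarith
    · rw [Finset.disjoint_left]
      intro x hx hx'
      simp only [hS, Finset.mem_image, Finset.mem_filter, Finset.mem_univ, true_and] at hx hx'
      obtain ⟨y, hy, rfl⟩ := hx'
      rw [hflip y hy] at hx
      exact absurd hx (by simp)
  have hzero : 5 / 6 ≤ acceptProb T (fun _ => false) := by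
    apply hT.1
    exact ⟨∅, by simp, fun _ _ _ => rfl⟩
  have hgap : ∀ u, 2 / 3 ≤ acceptProb T (fun _ => false) - acceptProb T (f u) := by
    intro u
    have := hT.2 _ (hfar u)
    have := acc_add_rej T (f u)
    linarith
  have hcount : ∀ x, ∑ u, (if f u x = true then (1 : ℝ) else 0) = s := by
    intro x
    rw [← Finset.sum_filter, Finset.sum_const, nsmul_eq_mul, mul_one, ← hDs]
    norm_cast
    apply Finset.card_bij (fun u _ => fun i => xor (u i) (x i))
    · intro u hu
      have := (Finset.mem_filter.1 hu).2
      simp only [hf, decide_eq_true_eq] at this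
      simpa [Bool.xor_comm] using this
    · intro u _ u' _ h
      exact (xor_bij x).1 h
    · intro d hd
      obtain ⟨u, hu⟩ := (xor_bij x).2 d
      refine ⟨u, ?_, hu⟩
      simp only at hu
      simp only [hf, Finset.mem_filter, Finset.mem_univ, true_and, decide_eq_true_eq]
      rw [← hu] at hd
      simpa [Bool.xor_comm] using hd
  have hpt : ∀ u, acceptProb T (fun _ => false) - acceptProb T (f u)
      ≤ ∑ p, T.w p * ∑ i, (if f u (p.1 i) = true then (1 : ℝ) else 0) := by
    intro u
    rw [acc_eq, acc_eq, ← Finset.sum_sub_distrib]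
    apply Finset.sum_le_sum
    intro p _
    rw [← mul_sub]
    apply mul_le_mul_of_nonneg_left _ (T.nonneg p)
    have hnn : 0 ≤ ∑ i, (if f u (p.1 i) = true then (1 : ℝ) else 0) :=
      Finset.sum_nonneg fun i _ => by split_ifs <;> norm_num
    by_cases h : ∃ i, f u (p.1 i) = true
    · obtain ⟨i, hi⟩ := h
      have : (if f u (p.1 i) = true then (1 : ℝ) else 0)
          ≤ ∑ i, (if f u (p.1 i) = true then (1 : ℝ) else 0) :=
        Finset.single_le_sum (f := fun i => if f u (p.1 i) = true then (1 : ℝ) else 0)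
          (fun i _ => by split_ifs <;> norm_num) (Finset.mem_univ i)
      rw [if_pos hi] at this
      split_ifs <;> linarith
    · push Not at h
      have : (fun i => f u (p.1 i)) = fun _ => false := by
        funext i
        simpa using h i
      rw [this, sub_self]
      exact hnn
  have hsum : ∑ u : Fin n → Bool, (2 / 3 : ℝ)
      ≤ ∑ u, ∑ p, T.w p * ∑ i, (if f u (p.1 i) = true then (1 : ℝ) else 0) :=
    Finset.sum_le_sum fun u _ => (hgap u).trans (hpt u)
  rw [Finset.sum_comm] at hsum
  have hR : ∑ p, ∑ u, T.w p * ∑ i, (if f u (p.1 i) = true then (1 : ℝ) else 0) = q * s := by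
    calc _ = ∑ p, T.w p * (q * s) := by
          apply Finset.sum_congr rfl
          intro p _
          rw [← Finset.mul_sum, Finset.sum_comm, Finset.sum_congr rfl (fun i _ => hcount (p.1 i))]
          simp
      _ = _ := by rw [← Finset.sum_mul, T.sum_eq_one, one_mul]
  rw [hR, Finset.sum_const, nsmul_eq_mul, Finset.card_univ] at hsum
  simp only [Fintype.card_fun, Fintype.card_bool, Fintype.card_fin] at hsum
  push_cast at hsum
  have hq : (0 : ℝ) ≤ q := Nat.cast_nonneg q
  have h4 : (2 : ℝ) ^ n * (2 / 3) ≤ q * (2 * (ε * 2 ^ n)) :=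
    hsum.trans (mul_le_mul_of_nonneg_left hs2 hq)
  by_contra hcon
  push Not at hcon
  nlinarith

end JLB

set_option maxHeartbeats 1000000 in
theorem stmt0 (α : ℝ) (hα₁ : 1 / 2 < α) (hα₂ : α < 1) :
    ∃ (c : ℝ) (n₀ : ℕ), 0 < c ∧
      ∀ (n k q : ℕ) (ε : ℝ) (A : RandNonAdaptive n q),
        n₀ ≤ n → 1 ≤ k → (k : ℝ) ≤ α * n →
        (2 : ℝ) ^ (-(n : ℝ)) ≤ ε → ε ≤ 1 / 6 →
        IsJuntaTester n k q ε A →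
        c * (k : ℝ) ^ ((3 : ℝ) / 2) / (ε * (Real.logb 2 (2 + k / ε)) ^ 6) ≤ (q : ℝ) := by
  obtain ⟨β, hβ⟩ : ∃ β : ℝ, β = (1 - α) / 8 := ⟨_, rfl⟩
  have hβ0 : 0 < β := by rw [hβ]; linarith
  have hβ1 : β < 1 := by rw [hβ]; linarith
  obtain ⟨sβ, hsβ⟩ : ∃ s : ℝ, s = Real.sqrt β := ⟨_, rfl⟩
  have hsβ0 : 0 < sβ := by rw [hsβ]; exact Real.sqrt_pos.2 hβ0
  have hsβ2 : sβ ^ 2 = β := by rw [hsβ]; exact Real.sq_sqrt hβ0.le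
  have hsβ1 : sβ ≤ 1 := by nlinarith
  obtain ⟨C0, hC0⟩ : ∃ C : ℝ, C = 324 / β := ⟨_, rfl⟩
  have hC0p : 0 < C0 := by rw [hC0]; positivity
  obtain ⟨s0, hs0⟩ : ∃ s : ℝ, s = Real.sqrt C0 := ⟨_, rfl⟩
  have hs00 : 0 < s0 := by rw [hs0]; exact Real.sqrt_pos.2 hC0p
  have hs02 : s0 ^ 2 = C0 := by rw [hs0]; exact Real.sq_sqrt hC0p.le
  obtain ⟨c, hc⟩ : ∃ c : ℝ, c = min (1 / (3 * s0 ^ 3)) (sβ ^ 3 / 340200) := ⟨_, rfl⟩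
  have hc0 : 0 < c := by rw [hc]; positivity
  have hc1 : c ≤ 1 / (3 * s0 ^ 3) := by rw [hc]; exact min_le_left _ _
  have hc2 : c ≤ sβ ^ 3 / 340200 := by rw [hc]; exact min_le_right _ _
  refine ⟨c, 1, hc0, ?_⟩
  intro n k q ε A hn hk hkα hε0 hε1 hA
  have hεp : 0 < ε := lt_of_lt_of_le (by positivity) hε0
  have hnr : (1 : ℝ) ≤ n := by exact_mod_cast hn
  have hkr : (1 : ℝ) ≤ k := by exact_mod_cast hk
  have hkn : k < n := by
    have : (k : ℝ) < n := by nlinarith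
    exact_mod_cast this
  have hε2 : 1 ≤ ε * 2 ^ n := by
    rw [Real.rpow_neg (by norm_num), Real.rpow_natCast, inv_le_iff_one_le_mul₀ (by positivity)] at hε0
    exact hε0
  have heasy := JLB.easy hkn ε hε2 hε1 A hA
  obtain ⟨L, hL⟩ : ∃ L : ℝ, L = Real.logb 2 (2 + k / ε) := ⟨_, rfl⟩
  rw [← hL]
  have hke : 6 ≤ (k : ℝ) / ε := by
    rw [le_div_iff₀ hεp]; linarith
  have h2L : (2 : ℝ) ^ L = 2 + k / ε := by
    rw [hL]
    exact Real.rpow_logb (by norm_num) (by norm_num) (by linarith)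
  have hL1 : 1 ≤ L := by
    rw [hL, Real.le_logb_iff_rpow_le (by norm_num) (by linarith)]
    rw [Real.rpow_one]; linarith
  obtain ⟨S, hS⟩ : ∃ S : ℝ, S = Real.sqrt k := ⟨_, rfl⟩
  have hS2 : S ^ 2 = k := by rw [hS]; exact Real.sq_sqrt (by linarith)
  have hSp : 0 < S := by rw [hS]; exact Real.sqrt_pos.2 (by linarith)
  have hS3 : (k : ℝ) ^ ((3 : ℝ) / 2) = S ^ 3 := by
    rw [← hS2, ← Real.rpow_natCast, ← Real.rpow_natCast, ← Real.rpow_mul hSp.le]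
    norm_num
  rw [hS3]
  have hq0 : (0 : ℝ) ≤ q := Nat.cast_nonneg q
  rw [div_le_iff₀ (by positivity)]
  by_cases hcase : (k : ℝ) < C0 * L
  · have hSl : S ≤ s0 * L := by
      by_contra hcon
      push Not at hcon
      have h1 : (s0 * L) ^ 2 < S ^ 2 := pow_lt_pow_left₀ hcon (by positivity) (by norm_num)
      rw [mul_pow, hs02, hS2] at h1
      nlinarith [mul_nonneg hC0p.le (by nlinarith : (0 : ℝ) ≤ L ^ 2 - L)]
    have hS3l : S ^ 3 ≤ s0 ^ 3 * L ^ 6 := by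
      calc S ^ 3 ≤ (s0 * L) ^ 3 := by gcongr
        _ = s0 ^ 3 * L ^ 3 := by ring
        _ ≤ s0 ^ 3 * L ^ 6 := by
          gcongr
          norm_num
    calc c * S ^ 3 ≤ 1 / (3 * s0 ^ 3) * (s0 ^ 3 * L ^ 6) := by gcongr
      _ = 1 / 3 * L ^ 6 := by field_simp
      _ ≤ (ε * q) * L ^ 6 := by
        gcongr
        linarith
      _ = _ := by ring
  · push Not at hcase
    by_contra hcon
    push Not at hcon
    have hβk : 324 * L ≤ β * k := by
      have := mul_le_mul_of_nonneg_left hcase hβ0.le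
      have e : β * (C0 * L) = 324 * L := by rw [hC0]; field_simp
      linarith
    have hsS2 : (sβ * S) ^ 2 = β * k := by rw [mul_pow, hsβ2, hS2]
    have hsS : 18 ≤ sβ * S := by
      by_contra h
      push Not at h
      have : (sβ * S) ^ 2 < 18 ^ 2 := pow_lt_pow_left₀ h (by positivity) (by norm_num)
      linarith
    obtain ⟨R, hR⟩ : ∃ R : ℕ, R = ⌊sβ * S⌋₊ := ⟨_, rfl⟩
    have hR1 : (R : ℝ) ≤ sβ * S := by rw [hR]; exact Nat.floor_le (by linarith)
    have hR2 : sβ * S < R + 1 := by rw [hR]; exact Nat.lt_floor_add_one _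
    have hR0 : R ≠ 0 := by
      rintro rfl
      norm_num at hR2
      linarith
    obtain ⟨P, hPp, hP1, hP2⟩ := Nat.exists_prime_lt_and_le_two_mul R hR0
    have hP1' : (R : ℝ) + 1 ≤ P := by exact_mod_cast hP1
    have hP2' : (P : ℝ) ≤ 2 * R := by exact_mod_cast hP2
    have hPs : sβ * S ≤ P := by linarith
    have hP18 : 18 ≤ P := by
      have : (18 : ℝ) ≤ P := by linarith
      exact_mod_cast this
    have hPsq1 : β * k ≤ (P : ℝ) ^ 2 := by
      rw [← hsS2]; gcongr
    have hPsq2 : (P : ℝ) ^ 2 ≤ 4 * (β * k) := by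
      rw [← hsS2]
      calc (P : ℝ) ^ 2 ≤ (2 * (sβ * S)) ^ 2 := by gcongr; linarith
        _ = _ := by ring
    have hk1' : 2 * (P : ℝ) ^ 2 ≤ k := by
      have hαk : 0 ≤ α * k := by positivity
      have : 4 * (β * k) = (k - α * k) / 2 := by rw [hβ]; ring
      linarith
    have hk1 : 2 * P ^ 2 ≤ k := by exact_mod_cast hk1'
    have hk2 : 2 * k + P ^ 2 ≤ 2 * n := by
      have : 2 * (k : ℝ) + (P : ℝ) ^ 2 ≤ 2 * n := by
        have h5 : 4 * (β * k) = (1 - α) * k / 2 := by rw [hβ]; ring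
        have hkn' : (k : ℝ) ≤ n := by exact_mod_cast hkn.le
        have h6 : (1 - α) * k ≤ (1 - α) * n := mul_le_mul_of_nonneg_left hkn' (by linarith)
        have h7 : 0 ≤ (1 - α) * n := mul_nonneg (by linarith) (by linarith)
        have h8 : (1 - α) * n = n - α * n := by ring
        linarith
      exact_mod_cast this
    have hkL : (k : ℝ) ≤ ε * 2 ^ L := by
      rw [h2L, mul_add, mul_div_cancel₀ _ hεp.ne']
      linarith
    have hLP : L ≤ ((P ^ 2 : ℕ) : ℝ) := by push_cast; linarith
    have h2P : (2 : ℝ) ^ L ≤ 2 ^ (P ^ 2) := by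
      rw [← Real.rpow_natCast]
      exact Real.rpow_le_rpow_of_exponent_le (by norm_num) hLP
    have hε3 : 2 * (P : ℝ) ^ 2 ≤ ε * 2 ^ (P ^ 2) :=
      hk1'.trans (hkL.trans (mul_le_mul_of_nonneg_left h2P hεp.le))
    obtain ⟨Dd, hDd⟩ : ∃ D : ℕ, D = ⌈3 * L⌉₊ + 3 := ⟨_, rfl⟩
    have hD1 : 3 * L + 3 ≤ (Dd : ℝ) := by
      rw [hDd]; push_cast
      linarith [Nat.le_ceil (3 * L)]
    have hD2 : (Dd : ℝ) ≤ 7 * L := by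
      rw [hDd]; push_cast
      linarith [Nat.ceil_lt_add_one (a := 3 * L) (by positivity)]
    have hmain := JLB.core2 hPp hP18 ε hεp hε1 hk1 hk2 hε3 A hA Dd
    have hL6 : 1 ≤ L ^ 6 := one_le_pow₀ hL1
    have hc3 : c ≤ 1 := by
      have : sβ ^ 3 ≤ 1 := pow_le_one₀ hsβ0.le hsβ1
      linarith
    have hqS : q * ε ≤ S ^ 3 := by
      have h1 : q * ε ≤ q * (ε * L ^ 6) := by
        have h0 : 0 ≤ (q : ℝ) * ε := by positivity
        rw [← mul_assoc]
        exact le_mul_of_one_le_right h0 hL6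
      have h2 : c * S ^ 3 ≤ S ^ 3 := by
        have h0 : 0 < S ^ 3 := by positivity
        exact mul_le_of_le_one_left h0.le hc3
      linarith
    have hterm1 : (q : ℝ) ^ 2 / 2 ^ Dd ≤ 1 / 8 := by
      have h1 : (q : ℝ) ^ 2 ≤ (2 ^ L) ^ 3 := by
        have h2 : (k : ℝ) / ε ≤ 2 ^ L := by rw [h2L]; linarith
        calc (q : ℝ) ^ 2 = (q * ε) ^ 2 / ε ^ 2 := by field_simp
          _ ≤ (S ^ 3) ^ 2 / ε ^ 2 := by gcongr
          _ = (k : ℝ) ^ 3 / ε ^ 2 := by rw [← hS2]; ring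
          _ ≤ (k : ℝ) ^ 3 / ε ^ 3 := by
            have : ε ^ 3 ≤ ε ^ 2 := pow_le_pow_of_le_one hεp.le (by linarith) (by norm_num)
            gcongr
          _ = ((k : ℝ) / ε) ^ 3 := by rw [div_pow]
          _ ≤ _ := by gcongr
      have h3 : (2 ^ L : ℝ) ^ 3 * 8 ≤ 2 ^ Dd := by
        have : (2 ^ L : ℝ) ^ 3 * 8 = 2 ^ (3 * L + 3) := by
          rw [Real.rpow_add (by norm_num), mul_comm 3 L, Real.rpow_mul (by norm_num)]
          norm_num
        rw [this, ← Real.rpow_natCast]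
        exact Real.rpow_le_rpow_of_exponent_le (by norm_num) hD1
      rw [div_le_iff₀ (by positivity)]
      linarith
    have hterm2 : 4860 * ε * q * Dd / (P : ℝ) ^ 3 ≤ 1 / 10 := by
      have hP3 : (sβ * S) ^ 3 ≤ (P : ℝ) ^ 3 := by gcongr
      have hPpos : (0 : ℝ) < (P : ℝ) ^ 3 := lt_of_lt_of_le (by positivity) hP3
      rw [div_le_iff₀ hPpos]
      have hLL : L ≤ L ^ 6 := by
        calc L = L ^ 1 := (pow_one L).symm
          _ ≤ L ^ 6 := pow_le_pow_right₀ hL1 (by norm_num)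
      calc 4860 * ε * q * Dd ≤ 4860 * ε * q * (7 * L) := by gcongr
        _ ≤ 4860 * ε * q * (7 * L ^ 6) := by gcongr
        _ = 34020 * (q * (ε * L ^ 6)) := by ring
        _ ≤ 34020 * (c * S ^ 3) := by gcongr
        _ ≤ 34020 * (sβ ^ 3 / 340200 * S ^ 3) := by gcongr
        _ = 1 / 10 * (sβ * S) ^ 3 := by ring
        _ ≤ _ := by linarith
    linarith
end

section
/- Let α ∈ (1/2, 1) be a constant. There exist constants c > 0 and n₀ ∈ ℕ such that for every n ≥ n₀ and every real ε with 2^{−(2α−1)n/2} ≤ ε ≤ 1/6, setting k = ⌊αn⌋, the following holds: every randomized non-adaptive q-query algorithm that is an ε-tester for k-juntas on n-variable Boolean functions satisfies q ≥ c · n^{3/2} / (ε · (log₂ n)³ · (log₂(n/ε))³). -/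
/-! ### Finite averages -/

def av {Ω : Type*} [Fintype Ω] (w F : Ω → ℝ) : ℝ := ∑ ω, w ω * F ω

structure IsPr {Ω : Type*} [Fintype Ω] (w : Ω → ℝ) : Prop where
  nn : ∀ ω, 0 ≤ w ω
  one : ∑ ω, w ω = 1

section av
variable {Ω : Type*} [Fintype Ω] {w : Ω → ℝ}

lemma av_mono (hw : IsPr w) {F G : Ω → ℝ} (h : ∀ ω, F ω ≤ G ω) : av w F ≤ av w G :=
  Finset.sum_le_sum fun ω _ => mul_le_mul_of_nonneg_left (h ω) (hw.nn ω)

lemma av_const (hw : IsPr w) (c : ℝ) : av w (fun _ => c) = c := by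
  simp [av, ← Finset.sum_mul, hw.one]

lemma av_add (F G : Ω → ℝ) : av w (fun ω => F ω + G ω) = av w F + av w G := by
  simp [av, mul_add, Finset.sum_add_distrib]

lemma av_sub (F G : Ω → ℝ) : av w (fun ω => F ω - G ω) = av w F - av w G := by
  simp [av, mul_sub, Finset.sum_sub_distrib]

lemma av_smul (c : ℝ) (F : Ω → ℝ) : av w (fun ω => c * F ω) = c * av w F := by
  simp only [av, Finset.mul_sum]; exact Finset.sum_congr rfl fun _ _ => by ring

lemma av_sum {κ : Type*} (s : Finset κ) (F : κ → Ω → ℝ) :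
    av w (fun ω => ∑ k ∈ s, F k ω) = ∑ k ∈ s, av w (F k) := by
  simp only [av, Finset.mul_sum]; exact Finset.sum_comm

lemma av_le (hw : IsPr w) {F : Ω → ℝ} {c : ℝ} (h : ∀ ω, F ω ≤ c) : av w F ≤ c :=
  (av_mono hw h).trans_eq (av_const hw c)

lemma le_av (hw : IsPr w) {F : Ω → ℝ} {c : ℝ} (h : ∀ ω, c ≤ F ω) : c ≤ av w F :=
  (av_const hw c).symm.trans_le (av_mono hw h)

lemma av_nonneg (hw : IsPr w) {F : Ω → ℝ} (h : ∀ ω, 0 ≤ F ω) : 0 ≤ av w F := le_av hw h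

lemma av_comm {Ω' : Type*} [Fintype Ω'] {w' : Ω' → ℝ} (F : Ω → Ω' → ℝ) :
    av w (fun ω => av w' (fun ω' => F ω ω')) = av w' (fun ω' => av w (fun ω => F ω ω')) := by
  simp only [av, Finset.mul_sum]
  rw [Finset.sum_comm]
  exact Finset.sum_congr rfl fun _ _ => Finset.sum_congr rfl fun _ _ => by ring
end av

/-- indicator -/
noncomputable def ind (P : Prop) : ℝ := open Classical in if P then 1 else 0

lemma ind_nonneg (P : Prop) : 0 ≤ ind P := by unfold ind; split_ifs <;> norm_num
lemma ind_le_one (P : Prop) : ind P ≤ 1 := by unfold ind; split_ifs <;> norm_num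
lemma ind_true {P : Prop} (h : P) : ind P = 1 := by simp [ind, h]
lemma ind_false {P : Prop} (h : ¬ P) : ind P = 0 := by simp [ind, h]
lemma ind_le {P : Prop} {x : ℝ} (h0 : 0 ≤ x) (h : P → 1 ≤ x) : ind P ≤ x := by
  unfold ind; split_ifs with hp
  · exact h hp
  · exact h0
lemma ind_mono {P Q : Prop} (h : P → Q) : ind P ≤ ind Q :=
  ind_le (ind_nonneg _) fun hp => (ind_true (h hp)).ge
lemma ind_or (P Q : Prop) : ind (P ∨ Q) ≤ ind P + ind Q := by
  refine ind_le (add_nonneg (ind_nonneg _) (ind_nonneg _)) ?_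
  rintro (h | h)
  · rw [ind_true h]; linarith [ind_nonneg Q]
  · rw [ind_true h]; linarith [ind_nonneg P]
lemma ind_exists_le {κ : Type*} (s : Finset κ) (P : κ → Prop) :
    ind (∃ k ∈ s, P k) ≤ ∑ k ∈ s, ind (P k) := by
  refine ind_le (Finset.sum_nonneg fun _ _ => ind_nonneg _) ?_
  rintro ⟨k, hk, h⟩
  calc (1 : ℝ) = ind (P k) := (ind_true h).symm
    _ ≤ _ := Finset.single_le_sum (f := fun k => ind (P k)) (fun _ _ => ind_nonneg _) hk

/-! ### Product weights -/

lemma sum_pi_prod {ι κ : Type*} [Fintype ι] [DecidableEq ι] [Fintype κ] (g : ι → κ → ℝ) :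
    ∑ x : ι → κ, ∏ i, g i (x i) = ∏ i, ∑ b, g i b := by
  rw [Finset.prod_univ_sum, Fintype.piFinset_univ]

def piw {ι κ : Type*} [Fintype ι] (w : κ → ℝ) (x : ι → κ) : ℝ := ∏ i, w (x i)

section piw
variable {ι κ : Type*} [Fintype ι] [DecidableEq ι] [Fintype κ] {w : κ → ℝ}

lemma piw_pr (hw : IsPr w) : IsPr (piw (ι := ι) w) where
  nn x := Finset.prod_nonneg fun _ _ => hw.nn _
  one := by
    unfold piw
    rw [sum_pi_prod (fun _ : ι => w)]
    simp [hw.one]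

lemma av_piw_prod (g : ι → κ → ℝ) :
    av (piw (ι := ι) w) (fun x => ∏ i, g i (x i)) = ∏ i, av w (g i) := by
  unfold av piw
  rw [← sum_pi_prod]
  exact Finset.sum_congr rfl fun x _ => by rw [Finset.prod_mul_distrib]

lemma av_piw_one (hw : IsPr w) (i : ι) (g : κ → ℝ) :
    av (piw (ι := ι) w) (fun x => g (x i)) = av w g := by
  have h := av_piw_prod (ι := ι) (w := w) (fun k => if k = i then g else fun _ => 1)
  have e : ∀ x : ι → κ, ∏ k, (if k = i then g else fun _ => 1) (x k) = g (x i) := by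
    intro x
    rw [Finset.prod_eq_single i] <;> simp +contextual
  simp only [e] at h
  rw [h, Finset.prod_eq_single i]
  · simp
  · intro b _ hb; simp [hb, av_const hw]
  · simp

lemma av_piw_two (hw : IsPr w) {i j : ι} (hij : i ≠ j) (g : κ → ℝ) :
    av (piw (ι := ι) w) (fun x => g (x i) * g (x j)) = av w g * av w g := by
  have h := av_piw_prod (ι := ι) (w := w) (fun k => if k = i ∨ k = j then g else fun _ => 1)
  have e : ∀ x : ι → κ, ∏ k, (if k = i ∨ k = j then g else fun _ => 1) (x k)
      = g (x i) * g (x j) := by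
    intro x
    rw [Finset.prod_eq_mul i j hij] <;> simp +contextual
  simp only [e] at h
  rw [h, Finset.prod_eq_mul i j hij]
  · simp
  · intro b _ hb; simp [hb.1, hb.2, av_const hw]
  · simp
  · simp

lemma cheb (hw : IsPr w) (ψ : κ → ℝ) (h1 : ∀ b, |ψ b| ≤ 1) (h0 : av w ψ = 0) {t : ℝ} (ht : 0 < t) :
    av (piw (ι := ι) w) (fun x => ind (t ≤ |∑ i, ψ (x i)|)) ≤ Fintype.card ι / t ^ 2 := by
  have step : av (piw (ι := ι) w) (fun x => ind (t ≤ |∑ i, ψ (x i)|)) ≤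
      av (piw (ι := ι) w) (fun x => (1 / t ^ 2) * (∑ i, ψ (x i)) ^ 2) := by
    refine av_mono (piw_pr hw) fun x => ind_le (by positivity) fun h => ?_
    have : t ^ 2 ≤ (∑ i, ψ (x i)) ^ 2 := by rw [← sq_abs (∑ i, ψ (x i))]; gcongr
    rw [one_div, inv_mul_eq_div, le_div_iff₀ (by positivity)]; linarith
  refine step.trans ?_
  rw [av_smul, one_div, inv_mul_eq_div]
  refine div_le_div_of_nonneg_right ?_ (by positivity)
  simp only [sq, Finset.sum_mul_sum]
  rw [av_sum]
  simp only [av_sum]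
  calc ∑ i : ι, ∑ j : ι, av (piw w) (fun x => ψ (x i) * ψ (x j))
      ≤ ∑ i : ι, ∑ j : ι, if i = j then (1 : ℝ) else 0 := by
        refine Finset.sum_le_sum fun i _ => Finset.sum_le_sum fun j _ => ?_
        split_ifs with h
        · subst h
          refine av_le (piw_pr hw) fun x => ?_
          have := abs_le.1 (h1 (x i)); nlinarith
        · rw [av_piw_two hw h, h0]; simp
    _ = _ := by simp
end piw

def bw (p : ℝ) (b : Bool) : ℝ := if b then p else 1 - p

lemma bw_pr {p : ℝ} (h0 : 0 ≤ p) (h1 : p ≤ 1) : IsPr (bw p) where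
  nn b := by cases b <;> simp [bw] <;> linarith
  one := by simp [bw]

lemma av_bw (p : ℝ) (g : Bool → ℝ) : av (bw p) g = p * g true + (1 - p) * g false := by
  simp [av, bw]

/-! ### Total variation bound for biased bits -/

lemma marg {ι : Type*} [Fintype ι] [DecidableEq ι] (U : Finset ι) (w1 w2 : ι → Bool → ℝ)
    (h1 : ∀ i, ∑ b, w1 i b = 1) (h2 : ∀ i, ∑ b, w2 i b = 1) (h12 : ∀ i ∈ U, w1 i = w2 i)
    (F : (ι → Bool) → ℝ) (dep : ∀ x y, (∀ i ∈ U, x i = y i) → F x = F y) :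
    ∑ x, (∏ i, w1 i (x i)) * F x = ∑ x, (∏ i, w2 i (x i)) * F x := by
  set ρ : (ι → Bool) → (ι → Bool) := fun x i => if i ∈ U then x i else false with hρ
  have hF : ∀ x, F x = F (ρ x) := fun x => dep _ _ fun i hi => by simp [hρ, hi]
  have key : ∀ w : ι → Bool → ℝ, ∑ x, (∏ i, w i (x i)) * F x =
      ∑ t, (∏ i, ∑ b, if (if i ∈ U then b else false) = t i then w i b else 0) * F t := by
    intro w
    have e : ∀ t, (∏ i, ∑ b, if (if i ∈ U then b else false) = t i then w i b else 0) =
        ∑ x, if ρ x = t then ∏ i, w i (x i) else 0 := by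
      intro t
      rw [← sum_pi_prod (fun i b => if (if i ∈ U then b else false) = t i then w i b else 0)]
      refine Finset.sum_congr rfl fun x _ => ?_
      split_ifs with h
      · refine Finset.prod_congr rfl fun i _ => ?_
        rw [if_pos]; exact congrFun h i
      · have : ∃ i, ρ x i ≠ t i := by
          by_contra hc; push Not at hc; exact h (funext hc)
        obtain ⟨i, hi⟩ := this
        exact Finset.prod_eq_zero (Finset.mem_univ i) (if_neg hi)
    simp only [e, Finset.sum_mul]
    rw [Finset.sum_comm]
    refine Finset.sum_congr rfl fun x _ => ?_
    rw [Finset.sum_eq_single (ρ x)]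
    · rw [if_pos rfl, ← hF]
    · intro b _ hb; rw [if_neg hb.symm, zero_mul]
    · simp
  rw [key, key]
  refine Finset.sum_congr rfl fun t _ => ?_
  congr 1
  refine Finset.prod_congr rfl fun i _ => ?_
  by_cases hi : i ∈ U
  · simp only [h12 i hi]
  · simp only [hi, if_false]
    by_cases ht : false = t i
    · simp only [ht, if_true, h1, h2]
    · simp only [ht, if_false]

lemma tv {ι : Type*} [Fintype ι] [DecidableEq ι] {p p' : ℝ} (hp0 : 0 < p) (hp1 : p < 1)
    (U : Finset ι)
    (F : (ι → Bool) → ℝ) (F0 : ∀ x, 0 ≤ F x) (F1 : ∀ x, F x ≤ 1)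
    (dep : ∀ x y, (∀ i ∈ U, x i = y i) → F x = F y) :
    (av (piw (bw p')) F - av (piw (bw p)) F) ^ 2 ≤ (1 + (p' - p) ^ 2 / (p * (1 - p))) ^ U.card - 1 := by
  have hpr := piw_pr (ι := ι) (bw_pr hp0.le hp1.le)
  have hq : 0 < 1 - p := by linarith
  have hb : ∀ b, bw p b ≠ 0 := by intro b; cases b <;> simp [bw] <;> linarith
  set L : (ι → Bool) → ℝ := fun x => ∏ i, (if i ∈ U then fun b => bw p' b / bw p b else fun _ => 1) (x i) with hL
  have e1 : av (piw (bw p')) F = av (piw (bw p)) (fun x => L x * F x) := by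
    have := marg U (fun _ => bw p') (fun i => if i ∈ U then bw p' else bw p)
      (fun i => by simp [bw]) (fun i => by split_ifs <;> simp [bw]) (fun i hi => by simp [hi]) F dep
    unfold av piw
    rw [this]
    refine Finset.sum_congr rfl fun x _ => ?_
    rw [← mul_assoc, hL, ← Finset.prod_mul_distrib]
    congr 1
    refine Finset.prod_congr rfl fun i _ => ?_
    split_ifs
    · rw [mul_div_cancel₀ _ (hb _)]
    · simp
  have eL : av (piw (bw p)) L = 1 := by
    rw [hL, av_piw_prod]
    refine Finset.prod_eq_one fun i _ => ?_
    split_ifs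
    · simp [av_bw, bw]; field_simp; ring
    · simp [av_bw]
  have eL2 : av (piw (bw p)) (fun x => L x * L x) = (1 + (p' - p) ^ 2 / (p * (1 - p))) ^ U.card := by
    have : (fun x => L x * L x) = fun x : ι → Bool => ∏ i,
        ((fun i => if i ∈ U then fun b => (bw p' b / bw p b) ^ 2 else fun _ => (1 : ℝ)) i) (x i) := by
      funext x
      rw [hL, ← Finset.prod_mul_distrib]
      refine Finset.prod_congr rfl fun i _ => ?_
      dsimp only
      split_ifs
      · ring
      · ring
    rw [this, av_piw_prod, ← Finset.prod_const, ← Finset.prod_subset (Finset.subset_univ U)]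
    · refine Finset.prod_congr rfl fun i hi => ?_
      simp [hi, av_bw, bw]; field_simp; ring
    · intro i _ hi; simp [hi, av_bw]
  have e2 : av (piw (bw p')) F - av (piw (bw p)) F = av (piw (bw p)) (fun x => (L x - 1) * F x) := by
    rw [e1, ← av_sub]; congr 1; funext x; ring
  rw [e2]
  have cs : (av (piw (bw p)) (fun x => (L x - 1) * F x)) ^ 2 ≤
      av (piw (bw p)) (fun x => (L x - 1) ^ 2) * av (piw (bw p)) (fun x => F x ^ 2) := by
    unfold av
    refine Finset.sum_sq_le_sum_mul_sum_of_sq_le_mul _ (fun x _ => ?_) (fun x _ => ?_) (fun x _ => ?_)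
    · exact mul_nonneg (hpr.nn x) (sq_nonneg _)
    · exact mul_nonneg (hpr.nn x) (sq_nonneg _)
    · exact le_of_eq (by ring)
  have hF2 : av (piw (bw p)) (fun x => F x ^ 2) ≤ 1 :=
    av_le hpr fun x => by have := F0 x; have := F1 x; nlinarith
  have hL2 : av (piw (bw p)) (fun x => (L x - 1) ^ 2) = (1 + (p' - p) ^ 2 / (p * (1 - p))) ^ U.card - 1 := by
    have : (fun x => (L x - 1) ^ 2) = fun x => (L x * L x - 2 * L x) + 1 := by funext x; ring
    rw [this, av_add, av_sub, av_smul, av_const hpr, eL, eL2]; ring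
  have hnn : 0 ≤ av (piw (bw p)) (fun x => (L x - 1) ^ 2) := av_nonneg hpr fun x => sq_nonneg _
  rw [← hL2]
  nlinarith

/-! ### The random functions -/

section fn
variable {n : ℕ}

def addr (M x : Fin n → Bool) : Fin n → Bool := fun i => M i && x i

def val (M a : Fin n → Bool) (s : (Fin n → Bool) → Fin n → Bool) (r : (Fin n → Bool) → ZMod 2)
    (x : Fin n → Bool) : ZMod 2 :=
  r (addr M x) + ∑ i, if (x i && (!M i && (a i && s (addr M x) i))) = true then 1 else 0

def fn (M a : Fin n → Bool) (s : (Fin n → Bool) → Fin n → Bool) (r : (Fin n → Bool) → ZMod 2)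
    (x : Fin n → Bool) : Bool := decide (val M a s r x = 1)

def flp (i : Fin n) (x : Fin n → Bool) : Fin n → Bool := Function.update x i (!x i)

lemma flp_flp (i : Fin n) (x : Fin n → Bool) : flp i (flp i x) = x := by
  funext j; by_cases h : j = i
  · subst h; simp [flp]
  · simp [flp, h]

lemma fn_ne (M a : Fin n → Bool) (s r) (x y : Fin n → Bool) :
    fn M a s r x ≠ fn M a s r y ↔ val M a s r x ≠ val M a s r y := by
  unfold fn
  generalize val M a s r x = u
  generalize val M a s r y = v
  revert u v; decide

lemma addr_flp {M : Fin n → Bool} {i : Fin n} (hi : M i = false) (x : Fin n → Bool) :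
    addr M (flp i x) = addr M x := by
  funext j; by_cases h : j = i
  · subst h; simp [addr, hi]
  · simp [addr, flp, h]

lemma val_flp {M a : Fin n → Bool} {s r} {i : Fin n} (hM : M i = false) (ha : a i = true)
    (x : Fin n → Bool) (hs : s (addr M x) i = true) :
    val M a s r (flp i x) = val M a s r x + 1 := by
  unfold val
  rw [addr_flp hM, ← Finset.add_sum_erase _ _ (Finset.mem_univ i),
    ← Finset.add_sum_erase (f := fun i => if (x i && (!M i && (a i && s (addr M x) i))) = true then (1 : ZMod 2) else 0) _ (Finset.mem_univ i)]
  have : ∑ j ∈ Finset.univ.erase i, (if (flp i x j && (!M j && (a j && s (addr M x) j))) = true then (1 : ZMod 2) else 0)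
      = ∑ j ∈ Finset.univ.erase i, (if (x j && (!M j && (a j && s (addr M x) j))) = true then (1 : ZMod 2) else 0) := by
    refine Finset.sum_congr rfl fun j hj => ?_
    have := Finset.ne_of_mem_erase hj
    simp [flp, this]
  rw [this]
  generalize ∑ j ∈ Finset.univ.erase i, (if (x j && (!M j && (a j && s (addr M x) j))) = true then (1 : ZMod 2) else 0) = u
  generalize r (addr M x) = v
  simp only [flp, Function.update_self, hM, ha, hs]
  cases x i
  · simp; ring
  · simp only [Bool.not_true, Bool.not_false, Bool.and_self, if_true]
    revert u v; decide

lemma fn_junta (M a : Fin n → Bool) (s r) (k : ℕ)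
    (h : (Finset.univ.filter fun i => (M i || a i) = true).card ≤ k) :
    IsJunta n k (fn M a s r) := by
  refine ⟨_, h, fun x y hxy => ?_⟩
  have hxy' : ∀ i, (M i || a i) = true → x i = y i := fun i hi => hxy i (by simpa using hi)
  have ha : addr M x = addr M y := by
    funext i; unfold addr
    cases hM : M i
    · simp
    · simp [hxy' i (by simp [hM])]
  unfold fn val
  rw [ha]
  congr 3
  refine Finset.sum_congr rfl fun i _ => ?_
  cases hai : a i
  · simp
  · rw [hxy' i (by simp [hai])]

lemma err_half (f g : (Fin n → Bool) → Bool) (σ : (Fin n → Bool) → (Fin n → Bool))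
    (hσ : ∀ x, σ (σ x) = x) (hg : ∀ x, g (σ x) = g x) :
    (Finset.univ.filter fun x => f x ≠ f (σ x)).card ≤ 2 * (Finset.univ.filter fun x => f x ≠ g x).card := by
  have hinj : Function.Injective σ := Function.LeftInverse.injective hσ
  have hsub : (Finset.univ.filter fun x => f x ≠ f (σ x)) ⊆
      (Finset.univ.filter fun x => f x ≠ g x) ∪ (Finset.univ.filter fun x => f x ≠ g x).image σ := by
    intro x hx
    simp only [Finset.mem_filter, Finset.mem_univ, true_and, Finset.mem_union, Finset.mem_image] at hx ⊢
    by_cases h : f x = g x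
    · right
      refine ⟨σ x, ?_, hσ x⟩
      rw [hg, ← h]; exact hx.symm
    · exact Or.inl h
  calc _ ≤ _ := Finset.card_le_card hsub
    _ ≤ _ := Finset.card_union_le _ _
    _ = _ := by rw [Finset.card_image_of_injective _ hinj]; ring

lemma fn_far (M a : Fin n → Bool) (s r) (k : ℕ) (b ε : ℝ) (hε : ε ≤ 1 / 6)
    (hZ : (k : ℝ) + b ≤ (Finset.univ.filter fun i => (M i || a i) = true).card)
    (h1 : ∀ i, M i = true → (2 : ℝ) ^ n / 3 ≤
      (Finset.univ.filter fun x => fn M a s r x ≠ fn M a s r (flp i x)).card)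
    (h2 : ∀ B : Finset (Fin n), (∀ i ∈ B, M i = false ∧ a i = true) → b ≤ B.card →
      2 * ε * 2 ^ n ≤ (Finset.univ.filter fun x => ∃ i ∈ B, s (addr M x) i = true).card) :
    FarFromJuntas n k ε (fn M a s r) := by
  classical
  rintro g ⟨J, hJ, hg⟩
  by_cases hc : ∃ i, M i = true ∧ i ∉ J
  · obtain ⟨i, hi, hiJ⟩ := hc
    have e := err_half (fn M a s r) g (flp i) (flp_flp i) (fun x => hg _ _ fun j hj => by
      have : j ≠ i := fun h => hiJ (h ▸ hj)
      simp [flp, this])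
    have e' : ((Finset.univ.filter fun x => fn M a s r x ≠ fn M a s r (flp i x)).card : ℝ) ≤
      2 * (Finset.univ.filter fun x => fn M a s r x ≠ g x).card := by exact_mod_cast e
    have := h1 i hi
    have hpos : (0 : ℝ) < 2 ^ n := by positivity
    nlinarith
  · push Not at hc
    set B := (Finset.univ.filter fun i => (M i || a i) = true) \ J with hB
    have hBm : ∀ i ∈ B, M i = false ∧ a i = true := by
      intro i hi
      simp only [hB, Finset.mem_sdiff, Finset.mem_filter, Finset.mem_univ, true_and] at hi
      have hMi : M i = false := by
        by_contra h
        exact hi.2 (hc i (by simpa using h))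
      refine ⟨hMi, by simpa [hMi] using hi.1⟩
    have hBJ : ∀ i ∈ B, i ∉ J := fun i hi => (Finset.mem_sdiff.1 hi).2
    have hBc : b ≤ B.card := by
      have := Finset.le_card_sdiff J (Finset.univ.filter fun i => (M i || a i) = true)
      have h' : (Finset.univ.filter fun i => (M i || a i) = true).card ≤ B.card + k := by
        rw [← hB] at this; omega
      have h'' : ((Finset.univ.filter fun i => (M i || a i) = true).card : ℝ) ≤ B.card + k := by
        exact_mod_cast h'
      linarith
    have h2' := h2 B hBm hBc
    have hcex : ∀ z : Fin n → Bool, ∃ c : Option (Fin n), (∀ i ∈ c, i ∈ B ∧ s z i = true) ∧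
        ((∃ i ∈ B, s z i = true) → c ≠ none) := by
      intro z
      by_cases h : ∃ i ∈ B, s z i = true
      · obtain ⟨i, hi, hs⟩ := h
        exact ⟨some i, by simpa using ⟨hi, hs⟩, by simp⟩
      · exact ⟨none, by simp, fun h' => absurd h' h⟩
    choose c hc1 hc2 using hcex
    set σ : (Fin n → Bool) → (Fin n → Bool) := fun x =>
      match c (addr M x) with
      | none => x
      | some i => flp i x with hσ
    have hσn : ∀ x, c (addr M x) = none → σ x = x := fun x h => by simp only [hσ, h]
    have hσs : ∀ x i, c (addr M x) = some i → σ x = flp i x := fun x i h => by simp only [hσ, h]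
    have e := err_half (fn M a s r) g σ (fun x => by
        rcases h : c (addr M x) with _ | i
        · rw [hσn x h, hσn x h]
        · rw [hσs x i h, hσs _ i, flp_flp]
          rw [addr_flp (hBm i (hc1 _ i h).1).1, h])
      (fun x => by
        rcases h : c (addr M x) with _ | i
        · rw [hσn x h]
        · rw [hσs x i h]
          refine hg _ _ fun j hj => ?_
          have : j ≠ i := fun h' => hBJ i (hc1 _ i h).1 (h' ▸ hj)
          simp [flp, this])
    have e3 : (Finset.univ.filter fun x => ∃ i ∈ B, s (addr M x) i = true).card ≤
        (Finset.univ.filter fun x => fn M a s r x ≠ fn M a s r (σ x)).card := by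
      refine Finset.card_le_card fun x hx => ?_
      simp only [Finset.mem_filter, Finset.mem_univ, true_and] at hx ⊢
      rcases h : c (addr M x) with _ | i
      · exact absurd h (hc2 _ hx)
      · have hi := hc1 _ i h
        rw [hσs x i h, fn_ne, val_flp (hBm i hi.1).1 (hBm i hi.1).2 x hi.2]
        simp
    have e' : ((Finset.univ.filter fun x => ∃ i ∈ B, s (addr M x) i = true).card : ℝ) ≤
      2 * (Finset.univ.filter fun x => fn M a s r x ≠ g x).card := by exact_mod_cast e3.trans e
    linarith

end fn

/-! ### Concentration for the far distribution -/

section conc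
variable {n : ℕ}

def msz (M : Fin n → Bool) : ℕ := (Finset.univ.filter fun i => M i = true).card

lemma fib_card (M z : Fin n → Bool) (hz : addr M z = z) :
    (Finset.univ.filter fun x => addr M x = z).card * 2 ^ msz M = 2 ^ n := by
  have e : (Finset.univ.filter fun x => addr M x = z) =
      Fintype.piFinset (fun i => if M i = true then {z i} else (Finset.univ : Finset Bool)) := by
    ext x
    simp only [Finset.mem_filter, Finset.mem_univ, true_and, Fintype.mem_piFinset]
    constructor
    · intro h i
      split_ifs with hM
      · have := congrFun h i
        simpa [addr, hM] using this
      · simp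
    · intro h
      funext i
      have := h i
      split_ifs at this with hM
      · simpa [addr, hM] using this
      · have h' := congrFun hz i
        simp only [addr] at h' ⊢
        simp only [Bool.not_eq_true] at hM
        rw [hM] at h' ⊢
        simpa using h'
  rw [e, Fintype.card_piFinset]
  have e2 : 2 ^ msz M = ∏ i : Fin n, (if M i = true then 2 else 1) := by
    rw [Finset.prod_ite]; simp [msz]
  rw [e2, ← Finset.prod_mul_distrib]
  calc _ = ∏ i : Fin n, 2 := by
        refine Finset.prod_congr rfl fun i _ => ?_
        split_ifs <;> simp
    _ = _ := by simp

lemma addr_addr (M x : Fin n → Bool) : addr M (addr M x) = addr M x := by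
  funext i; simp [addr]

lemma fib_card_real (M z : Fin n → Bool) (hz : addr M z = z) :
    ((Finset.univ.filter fun x => addr M x = z).card : ℝ) = 2 ^ n / 2 ^ msz M := by
  rw [eq_div_iff (by positivity)]; exact_mod_cast fib_card M z hz

lemma fib_card_le (M z : Fin n → Bool) :
    ((Finset.univ.filter fun x => addr M x = z).card : ℝ) ≤ 2 ^ n / 2 ^ msz M := by
  by_cases hz : addr M z = z
  · exact (fib_card_real M z hz).le
  · rw [Finset.filter_eq_empty_iff.2]
    · simp; positivity
    · intro x _ h; exact hz (by rw [← h, addr_addr])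

def adrs (M : Fin n → Bool) : Finset (Fin n → Bool) := Finset.univ.filter fun z => addr M z = z

lemma card_preim (M : Fin n → Bool) (P : (Fin n → Bool) → Prop) [DecidablePred P] :
    ((Finset.univ.filter fun x => P (addr M x)).card : ℝ) =
      ((adrs M).filter P).card * (2 ^ n / 2 ^ msz M) := by
  have h := Finset.card_eq_sum_card_fiberwise (s := Finset.univ.filter fun x => P (addr M x))
    (t := (adrs M).filter P) (f := addr M) (by
      intro x hx
      simp only [Finset.coe_filter, Finset.mem_univ, true_and, Set.mem_ofPred_eq, adrs, Finset.mem_filter] at hx ⊢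
      exact ⟨addr_addr M x, hx⟩)
  rw [h]
  push_cast
  rw [← nsmul_eq_mul, ← Finset.sum_const]
  refine Finset.sum_congr rfl fun z hz => ?_
  simp only [adrs, Finset.mem_filter, Finset.mem_univ, true_and] at hz
  rw [← fib_card_real M z hz.1]
  congr 2
  ext x
  simp only [Finset.mem_filter, Finset.mem_univ, true_and, and_iff_right_iff_imp]
  rintro h; rw [h]; exact hz.2

lemma card_adrs (M : Fin n → Bool) : (adrs M).card = 2 ^ msz M := by
  have h := card_preim M (fun _ => True)
  simp at h
  have h2 : (2 : ℝ) ^ n ≠ 0 := by positivity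
  field_simp at h
  exact_mod_cast h.symm

noncomputable def ru : ((Fin n → Bool) → ZMod 2) → ℝ :=
  fun _ => ((Fintype.card ((Fin n → Bool) → ZMod 2) : ℝ))⁻¹

lemma ru_pr : IsPr (ru (n := n)) where
  nn _ := by unfold ru; positivity
  one := by unfold ru; rw [Finset.sum_const, nsmul_eq_mul, Finset.card_univ, mul_inv_cancel₀]; positivity

lemma av_ru_shift (c : (Fin n → Bool) → ZMod 2) (G : ((Fin n → Bool) → ZMod 2) → ℝ) :
    av ru (fun r => G (r + c)) = av ru G := by
  unfold av ru
  exact Fintype.sum_equiv (Equiv.addRight c) _ _ fun r => rfl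

lemma val_shift (M a : Fin n → Bool) (s r) (z x : Fin n → Bool) :
    val M a s (r + Pi.single z 1) x = val M a s r x + if addr M x = z then 1 else 0 := by
  unfold val
  rw [Pi.add_apply]
  by_cases h : addr M x = z
  · rw [h]; simp; ring
  · simp [h]

lemma addr_flp' {M : Fin n → Bool} {i : Fin n} (hi : M i = true) (x : Fin n → Bool) :
    addr M (flp i x) = flp i (addr M x) := by
  funext j; by_cases h : j = i
  · subst h; simp [addr, flp, hi]
  · simp [addr, flp, h]

lemma flp_ne (i : Fin n) (x : Fin n → Bool) : flp i x ≠ x := by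
  intro h; have := congrFun h i; simp [flp] at this

noncomputable def chi (u v : ZMod 2) : ℝ := if u = v then 1 else -1

lemma chi_add (u v : ZMod 2) : chi (u + 1) v = - chi u v := by
  unfold chi
  have : (u + 1 = v) ↔ ¬ (u = v) := by revert u v; decide
  simp only [this]
  by_cases h : u = v <;> simp [h]

lemma chi_corr (M a : Fin n → Bool) (s) (i : Fin n) (hi : M i = true) (x y : Fin n → Bool)
    (h1 : addr M y ≠ addr M x) (h2 : addr M y ≠ flp i (addr M x)) :
    av ru (fun r => chi (val M a s r x) (val M a s r (flp i x)) *
      chi (val M a s r y) (val M a s r (flp i y))) = 0 := by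
  have h := av_ru_shift (Pi.single (addr M x) 1) (fun r => chi (val M a s r x) (val M a s r (flp i x)) *
      chi (val M a s r y) (val M a s r (flp i y)))
  have h3 : flp i (addr M x) ≠ addr M x := flp_ne i _
  have h4 : flp i (addr M y) ≠ addr M x := by
    intro h; apply h2; rw [← h, flp_flp]
  simp only [val_shift, addr_flp' hi, h1, h3, h4, if_true, if_false, add_zero, chi_add, neg_mul] at h
  have h' := av_smul (w := ru) (-1) (fun r => chi (val M a s r x) (val M a s r (flp i x)) *
      chi (val M a s r y) (val M a s r (flp i y)))
  simp only [neg_mul, one_mul] at h'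
  linarith

lemma conc1 (M a : Fin n → Bool) (s) (i : Fin n) (hi : M i = true) :
    av ru (fun r => ind (¬ ((2 : ℝ) ^ n / 3 ≤
      (Finset.univ.filter fun x => fn M a s r x ≠ fn M a s r (flp i x)).card))) ≤ 18 / 2 ^ msz M := by
  set X : ((Fin n → Bool) → ZMod 2) → (Fin n → Bool) → ℝ :=
    fun r x => chi (val M a s r x) (val M a s r (flp i x)) with hX
  have hpos : (0 : ℝ) < 2 ^ n := by positivity
  have hT : ∀ r, ∑ x, X r x = 2 ^ n -
      2 * ((Finset.univ.filter fun x => fn M a s r x ≠ fn M a s r (flp i x)).card : ℝ) := by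
    intro r
    have e : ∀ x, X r x = 1 - 2 * (if fn M a s r x ≠ fn M a s r (flp i x) then 1 else 0) := by
      intro x
      simp only [fn_ne, hX, chi]
      by_cases h : val M a s r x = val M a s r (flp i x)
      · simp [h]
      · simp [h]; norm_num
    simp only [e]
    rw [Finset.sum_sub_distrib, ← Finset.mul_sum, Finset.sum_boole]
    simp
  have hstep : ∀ r, ind (¬ ((2 : ℝ) ^ n / 3 ≤
      (Finset.univ.filter fun x => fn M a s r x ≠ fn M a s r (flp i x)).card)) ≤
      9 / (2 ^ n * 2 ^ n) * ((∑ x, X r x) * (∑ x, X r x)) := by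
    intro r
    refine ind_le (mul_nonneg (by positivity) (mul_self_nonneg _)) fun h => ?_
    rw [hT r, div_mul_eq_mul_div, le_div_iff₀ (by positivity)]
    push Not at h
    nlinarith
  refine (av_mono ru_pr hstep).trans ?_
  rw [av_smul]
  simp only [Finset.sum_mul_sum]
  rw [av_sum]
  simp only [av_sum]
  have hsum : ∑ x, ∑ y, av ru (fun r => X r x * X r y) ≤ 2 ^ n * (2 * (2 ^ n / 2 ^ msz M)) := by
    calc ∑ x, ∑ y, av ru (fun r => X r x * X r y)
        ≤ ∑ x : Fin n → Bool, 2 * ((2 : ℝ) ^ n / 2 ^ msz M) := by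
          refine Finset.sum_le_sum fun x _ => ?_
          calc ∑ y, av ru (fun r => X r x * X r y)
              ≤ ∑ y, ((if addr M y = addr M x then (1 : ℝ) else 0) +
                  (if addr M y = flp i (addr M x) then (1 : ℝ) else 0)) := by
                refine Finset.sum_le_sum fun y _ => ?_
                have hle : av ru (fun r => X r x * X r y) ≤ 1 := by
                  refine av_le ru_pr fun r => ?_
                  simp only [hX, chi]
                  split_ifs <;> norm_num
                by_cases h1 : addr M y = addr M x
                · rw [if_pos h1]; split_ifs <;> linarith
                · by_cases h2 : addr M y = flp i (addr M x)
                  · rw [if_pos h2]; split_ifs; linarith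
                  · rw [if_neg h1, if_neg h2]
                    exact (chi_corr M a s i hi x y h1 h2).trans_le (by norm_num)
            _ = _ := by rw [Finset.sum_add_distrib, Finset.sum_boole, Finset.sum_boole]
            _ ≤ 2 * ((2 : ℝ) ^ n / 2 ^ msz M) := by
                have := fib_card_le M (addr M x)
                have := fib_card_le M (flp i (addr M x))
                linarith
      _ = _ := by simp
  refine (mul_le_mul_of_nonneg_left hsum (by positivity)).trans_eq ?_
  field_simp
  norm_num

lemma conc2 (M : Fin n → Bool) (B : Finset (Fin n)) {e ε : ℝ} (he0 : 0 ≤ e) (he1 : e ≤ 1)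
    (hε0 : 0 < ε) (hε1 : ε ≤ 1 / 6) (hB : 30 * ε ≤ e * B.card) :
    av (piw (piw (bw e))) (fun s : (Fin n → Bool) → Fin n → Bool => ind (¬ (2 * ε * 2 ^ n ≤
      ((Finset.univ.filter fun x => ∃ i ∈ B, s (addr M x) i = true).card : ℝ))))
      ≤ Real.exp (- ε * 2 ^ msz M) := by
  have hb := bw_pr he0 he1
  have hb1 := piw_pr (ι := Fin n) hb
  have hb2 := piw_pr (ι := Fin n → Bool) hb1
  set N : ℝ := 2 ^ msz M with hN
  have hNpos : 0 < N := by positivity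
  have hstep : ∀ s : (Fin n → Bool) → Fin n → Bool, ind (¬ (2 * ε * 2 ^ n ≤
      ((Finset.univ.filter fun x => ∃ i ∈ B, s (addr M x) i = true).card : ℝ))) ≤
      Real.exp (Real.log 2 * (2 * ε * N)) *
        ∏ z, (fun t : Fin n → Bool => if z ∈ adrs M ∧ ∃ i ∈ B, t i = true then (1 / 2 : ℝ) else 1) (s z) := by
    intro s
    have hprod : ∏ z, (if z ∈ adrs M ∧ ∃ i ∈ B, s z i = true then (1 / 2 : ℝ) else 1) =
        (1 / 2) ^ ((adrs M).filter fun z => ∃ i ∈ B, s z i = true).card := by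
      rw [Finset.prod_ite]
      simp only [Finset.prod_const, one_pow, mul_one]
      congr 2
      ext z; simp
    dsimp only
    rw [hprod]
    refine ind_le (by positivity) fun h => ?_
    push Not at h
    rw [card_preim M (fun z => ∃ i ∈ B, s z i = true), ← hN] at h
    set H := ((adrs M).filter fun z => ∃ i ∈ B, s z i = true).card with hH
    have h' : (H : ℝ) < 2 * ε * N := by
      rw [mul_div_assoc', div_lt_iff₀ hNpos] at h
      have : (0 : ℝ) < 2 ^ n := by positivity
      nlinarith
    have e1 : ((1 : ℝ) / 2) ^ H = Real.exp (- (Real.log 2 * H)) := by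
      rw [Real.exp_neg, mul_comm, Real.exp_nat_mul, Real.exp_log (by norm_num)]; simp
    rw [e1, ← Real.exp_add]
    apply Real.one_le_exp
    have := Real.log_pos (by norm_num : (1 : ℝ) < 2)
    nlinarith
  refine (av_mono hb2 hstep).trans ?_
  rw [av_smul]
  refine (mul_le_mul_of_nonneg_left (le_of_eq (av_piw_prod (fun z (t : Fin n → Bool) =>
    if z ∈ adrs M ∧ ∃ i ∈ B, t i = true then (1 / 2 : ℝ) else 1))) (Real.exp_pos _).le).trans ?_
  have hq : (1 - e) ^ B.card ≤ 1 - 5 * ε := by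
    have h1 : (1 - e) ^ B.card ≤ Real.exp (- (e * B.card)) := by
      calc (1 - e) ^ B.card ≤ (Real.exp (-e)) ^ B.card := by
            gcongr
            exact Real.one_sub_le_exp_neg e
        _ = _ := by rw [← Real.exp_nat_mul]; congr 1; ring
    have h2 : Real.exp (- (e * B.card)) ≤ 1 / (1 + 30 * ε) := by
      rw [Real.exp_neg, ← one_div]
      apply one_div_le_one_div_of_le (by positivity)
      have := Real.add_one_le_exp (e * B.card)
      linarith
    have h3 : 1 / (1 + 30 * ε) ≤ 1 - 5 * ε := by
      rw [div_le_iff₀ (by positivity)]; nlinarith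
    linarith
  have hz : ∀ z, av (piw (bw e)) (fun t : Fin n → Bool => if z ∈ adrs M ∧ ∃ i ∈ B, t i = true then (1 / 2 : ℝ) else 1)
      ≤ if z ∈ adrs M then Real.exp (-(5 / 2 * ε)) else 1 := by
    intro z
    by_cases hz : z ∈ adrs M
    · simp only [hz, true_and, if_true]
      have e1 : (fun t : Fin n → Bool => if ∃ i ∈ B, t i = true then (1 / 2 : ℝ) else 1) =
          fun t => 1 / 2 + 1 / 2 * ∏ i, (if i ∈ B then fun b : Bool => if b = true then (0 : ℝ) else 1 else fun _ => 1) (t i) := by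
        funext t
        split_ifs with h
        · obtain ⟨i, hi, ht⟩ := h
          rw [Finset.prod_eq_zero (Finset.mem_univ i) (by simp [hi, ht])]; simp
        · rw [Finset.prod_eq_one]
          · norm_num
          · intro i _
            push Not at h
            split_ifs with hi
            · simp [h i hi]
            · rfl
      rw [e1, av_add, av_smul, av_const hb1, av_piw_prod, ← Finset.prod_subset (Finset.subset_univ B)]
      · have e2 : ∏ i ∈ B, av (bw e) (if i ∈ B then fun b : Bool => if b = true then (0 : ℝ) else 1 else fun _ => 1)
            = (1 - e) ^ B.card := by
          rw [← Finset.prod_const]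
          refine Finset.prod_congr rfl fun i hi => ?_
          simp [hi, av_bw]
        rw [e2]
        have := Real.one_sub_le_exp_neg (5 / 2 * ε)
        linarith
      · intro i _ hi; simp [hi, av_bw]
    · simp only [hz, false_and, if_false]
      exact (av_const hb1 1).le
  have hprod : ∏ z, av (piw (bw e)) (fun t : Fin n → Bool => if z ∈ adrs M ∧ ∃ i ∈ B, t i = true then (1 / 2 : ℝ) else 1)
      ≤ Real.exp (-(5 / 2 * ε)) ^ (2 ^ msz M) := by
    refine (Finset.prod_le_prod (fun z _ => av_nonneg hb1 fun t => by split_ifs <;> norm_num) fun z _ => hz z).trans_eq ?_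
    rw [Finset.prod_ite]
    simp [card_adrs]
  refine (mul_le_mul_of_nonneg_left hprod (Real.exp_pos _).le).trans ?_
  rw [← Real.exp_nat_mul, ← Real.exp_add, Real.exp_le_exp]
  push_cast
  rw [← hN]
  have := Real.log_two_lt_d9
  have : 0 < ε * N := by positivity
  nlinarith

end conc

/-! ### Indistinguishability -/

section indist
variable {n q : ℕ}

lemma indist (M : Fin n → Bool) (X : Fin q → Fin n → Bool) (h : (Fin q → Bool) → Bool) (L : ℕ)
    (good : ∀ j k, addr M (X j) = addr M (X k) →
      (Finset.univ.filter fun i => X j i ≠ X k i).card ≤ L)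
    {p p' e δ u0 : ℝ} (hp0 : 0 < p) (hp1 : p < 1) (hp'0 : 0 ≤ p') (hp'1 : p' ≤ 1)
    (he0 : 0 ≤ e) (he1 : e ≤ 1) (hδ : 0 ≤ δ) (hu0 : 0 < u0)
    (hu : ∀ u : ℕ, (u : ℝ) ≤ u0 → (1 + (p' - p) ^ 2 / (p * (1 - p))) ^ u - 1 ≤ δ ^ 2) :
    av (piw (bw p)) (fun a => av (piw (piw (bw e))) (fun s => av ru (fun r =>
      ind (h (fun j => fn M a s r (X j)) = true)))) -
    av (piw (bw p')) (fun a => av (piw (piw (bw e))) (fun s => av ru (fun r =>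
      ind (h (fun j => fn M a s r (X j)) = true)))) ≤ δ + e * (q * L) / u0 := by
  have hbase : ∀ z : Fin n → Bool, ∃ b : Fin n → Bool, ∀ j, addr M (X j) = z →
      ∃ k, X k = b ∧ addr M (X k) = z := by
    intro z
    by_cases hz : ∃ k, addr M (X k) = z
    · obtain ⟨k, hk⟩ := hz
      exact ⟨X k, fun _ _ => ⟨k, rfl, hk⟩⟩
    · exact ⟨fun _ => false, fun j hj => absurd ⟨j, hj⟩ hz⟩
  choose base hbase using hbase
  set val' : (Fin n → Bool) → ((Fin n → Bool) → Fin n → Bool) → ((Fin n → Bool) → ZMod 2) →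
    (Fin n → Bool) → ZMod 2 := fun a s r x => r (addr M x) +
      ∑ i, ((if (x i && (!M i && (a i && s (addr M x) i))) = true then (1 : ZMod 2) else 0) -
        (if (base (addr M x) i && (!M i && (a i && s (addr M x) i))) = true then 1 else 0)) with hval'
  set G : (Fin n → Bool) → ((Fin n → Bool) → Fin n → Bool) → ((Fin n → Bool) → ZMod 2) → ℝ :=
    fun a s r => ind (h (fun j => decide (val' a s r (X j) = 1)) = true) with hG
  have hshift : ∀ a s, av ru (fun r => ind (h (fun j => fn M a s r (X j)) = true)) =
      av ru (fun r => G a s r) := by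
    intro a s
    rw [← av_ru_shift (fun z => - ∑ i,
      (if (base z i && (!M i && (a i && s z i))) = true then (1 : ZMod 2) else 0))]
    congr 1
    funext r
    simp only [hG, hval', fn, val, Finset.sum_sub_distrib, Pi.add_apply]
    congr 5
    funext j
    congr 2
    ring
  have hswap : ∀ p : ℝ, av (piw (bw p)) (fun a => av (piw (piw (bw e))) (fun s => av ru (fun r =>
      ind (h (fun j => fn M a s r (X j)) = true)))) =
      av (piw (piw (bw e))) (fun s => av ru (fun r => av (piw (bw p)) (fun a => G a s r))) := by
    intro p
    simp only [hshift]
    rw [av_comm]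
    congr 1; funext s
    rw [av_comm]
  rw [hswap, hswap, ← av_sub]
  simp only [← av_sub]
  have hb := bw_pr he0 he1
  have hb1 := piw_pr (ι := Fin n) hb
  have hb2 := piw_pr (ι := Fin n → Bool) hb1
  have hP := piw_pr (ι := Fin n) (bw_pr hp0.le hp1.le)
  have hP' := piw_pr (ι := Fin n) (bw_pr hp'0 hp'1)
  set D : Fin q → Finset (Fin n) := fun j => Finset.univ.filter fun i => X j i ≠ base (addr M (X j)) i with hD
  have hDL : ∀ j, (D j).card ≤ L := by
    intro j
    obtain ⟨k, hk, hk'⟩ := hbase _ j rfl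
    simp only [hD, ← hk]
    exact good j k hk'.symm
  have hpt : ∀ s r, av (piw (bw p)) (fun a => G a s r) - av (piw (bw p')) (fun a => G a s r) ≤
      δ + 1 / u0 * ∑ j, ∑ i ∈ D j, ind (s (addr M (X j)) i = true) := by
    intro s r
    set U : Finset (Fin n) := Finset.univ.biUnion fun j => (D j).filter fun i => s (addr M (X j)) i = true with hU
    have hUc : (U.card : ℝ) ≤ ∑ j, ∑ i ∈ D j, ind (s (addr M (X j)) i = true) := by
      calc (U.card : ℝ) ≤ ((∑ j, ((D j).filter fun i => s (addr M (X j)) i = true).card : ℕ) : ℝ) := by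
            exact_mod_cast Finset.card_biUnion_le
        _ = _ := by
            push_cast
            refine Finset.sum_congr rfl fun j _ => ?_
            rw [← Finset.sum_boole]
            refine Finset.sum_congr rfl fun i _ => ?_
            simp [ind]
    have hS : (0 : ℝ) ≤ ∑ j, ∑ i ∈ D j, ind (s (addr M (X j)) i = true) := le_trans (by positivity) hUc
    by_cases hle : (U.card : ℝ) ≤ u0
    · have ht := tv (p' := p') hp0 hp1 U (fun a => G a s r) (fun a => ind_nonneg _) (fun a => ind_le_one _) (by
        intro a b hab
        simp only [hG]
        have : ∀ j, val' a s r (X j) = val' b s r (X j) := by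
          intro j
          simp only [hval']
          congr 1
          refine Finset.sum_congr rfl fun i _ => ?_
          by_cases hi : i ∈ U
          · rw [hab i hi]
          · have hi' : ¬ (X j i ≠ base (addr M (X j)) i ∧ s (addr M (X j)) i = true) := by
              intro hc
              apply hi
              simp only [hU, hD, Finset.mem_biUnion, Finset.mem_filter, Finset.mem_univ, true_and]
              exact ⟨j, hc⟩
            by_cases hx : X j i = base (addr M (X j)) i
            · rw [hx]; simp
            · have : s (addr M (X j)) i = false := by
                by_contra hc
                exact hi' ⟨hx, by simpa using hc⟩
              rw [this]; simp
        simp only [this])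
      have ht2 := ht.trans (hu _ hle)
      have ht3 := abs_le.1 (abs_le_of_sq_le_sq ht2 hδ)
      have : 0 ≤ 1 / u0 * ∑ j, ∑ i ∈ D j, ind (s (addr M (X j)) i = true) := by positivity
      linarith [ht3.1]
    · push Not at hle
      have h1 : av (piw (bw p)) (fun a => G a s r) ≤ 1 := av_le hP fun a => ind_le_one _
      have h2 : 0 ≤ av (piw (bw p')) (fun a => G a s r) := av_nonneg hP' fun a => ind_nonneg _
      have h3 : 1 ≤ 1 / u0 * ∑ j, ∑ i ∈ D j, ind (s (addr M (X j)) i = true) := by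
        rw [div_mul_eq_mul_div, le_div_iff₀ hu0]; linarith
      linarith
  refine (av_mono hb2 fun s => av_le ru_pr fun r => hpt s r).trans ?_
  rw [av_add, av_const hb2, av_smul, av_sum]
  simp only [av_sum]
  have hone : ∀ z i, av (piw (piw (bw e))) (fun s : (Fin n → Bool) → Fin n → Bool => ind (s z i = true)) = e := by
    intro z i
    rw [av_piw_one hb1 z (fun t : Fin n → Bool => ind (t i = true)),
      av_piw_one hb i (fun b : Bool => ind (b = true)), av_bw]
    simp [ind]
  simp only [hone]
  have hsum : ∑ j, ∑ i ∈ D j, e ≤ e * (q * L) := by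
    calc ∑ j, ∑ i ∈ D j, e ≤ ∑ j : Fin q, (L : ℝ) * e := by
          refine Finset.sum_le_sum fun j _ => ?_
          rw [Finset.sum_const, nsmul_eq_mul]
          have : ((D j).card : ℝ) ≤ L := by exact_mod_cast hDL j
          gcongr
      _ = _ := by simp; ring
  have : 1 / u0 * ∑ j, ∑ i ∈ D j, e ≤ e * (q * L) / u0 := by
    rw [div_mul_eq_mul_div, one_mul]; gcongr
  linarith

/-- Probability that `M` fails to separate two far-apart queries. -/
lemma bad_M (X : Fin q → Fin n → Bool) (L : ℕ) :
    av (piw (bw (1 / 2))) (fun M : Fin n → Bool => ind (¬ ∀ j k, addr M (X j) = addr M (X k) →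
      (Finset.univ.filter fun i => X j i ≠ X k i).card ≤ L)) ≤ q ^ 2 / 2 ^ L := by
  have hb := bw_pr (p := 1 / 2) (by norm_num) (by norm_num)
  have hb1 := piw_pr (ι := Fin n) hb
  have hpair : ∀ x y : Fin n → Bool, av (piw (bw (1 / 2))) (fun M : Fin n → Bool =>
      ind (addr M x = addr M y ∧ L < (Finset.univ.filter fun i => x i ≠ y i).card)) ≤ 1 / 2 ^ L := by
    intro x y
    by_cases hL : L < (Finset.univ.filter fun i => x i ≠ y i).card
    · have hpt : ∀ M : Fin n → Bool, ind (addr M x = addr M y ∧ L < (Finset.univ.filter fun i => x i ≠ y i).card) ≤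
          ∏ i, (if x i ≠ y i then fun b : Bool => if b = true then (0 : ℝ) else 1 else fun _ => 1) (M i) := by
        intro M
        refine ind_le (Finset.prod_nonneg fun i _ => ?_) fun hM => ?_
        · split_ifs <;> dsimp only <;> (try split_ifs) <;> norm_num
        · rw [Finset.prod_eq_one]
          intro i _
          by_cases hxy : x i ≠ y i
          · rw [if_pos hxy]
            have := congrFun hM.1 i
            simp only [addr] at this
            cases hMi : M i
            · simp
            · rw [hMi] at this; simp at this; exact absurd this hxy
          · rw [if_neg hxy]
      refine (av_mono hb1 hpt).trans ?_
      rw [av_piw_prod]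
      have e : ∀ i, av (bw (1 / 2)) (if x i ≠ y i then fun b : Bool => if b = true then (0 : ℝ) else 1 else fun _ => 1)
          = if x i ≠ y i then (1 / 2 : ℝ) else 1 := by
        intro i
        split_ifs <;> simp [av_bw] <;> norm_num
      simp only [e]
      rw [Finset.prod_ite]
      simp only [Finset.prod_const, one_pow, mul_one]
      rw [← one_div_pow]
      exact pow_le_pow_of_le_one (by norm_num) (by norm_num) hL.le
    · refine av_le hb1 fun M => ?_
      rw [ind_false (fun h => hL h.2)]; positivity
  calc _ ≤ av (piw (bw (1 / 2))) (fun M : Fin n → Bool => ∑ j, ∑ k,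
        ind (addr M (X j) = addr M (X k) ∧ L < (Finset.univ.filter fun i => X j i ≠ X k i).card)) := by
        refine av_mono hb1 fun M => ind_le (Finset.sum_nonneg fun _ _ => Finset.sum_nonneg fun _ _ => ind_nonneg _) ?_
        intro hM
        push Not at hM
        obtain ⟨j, k, hjk⟩ := hM
        calc (1 : ℝ) = _ := (ind_true hjk).symm
          _ ≤ ∑ k, ind (addr M (X j) = addr M (X k) ∧ L < (Finset.univ.filter fun i => X j i ≠ X k i).card) :=
            Finset.single_le_sum (f := fun k => ind (addr M (X j) = addr M (X k) ∧ L < (Finset.univ.filter fun i => X j i ≠ X k i).card)) (fun _ _ => ind_nonneg _) (Finset.mem_univ k)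
          _ ≤ _ := Finset.single_le_sum (f := fun j => ∑ k, ind (addr M (X j) = addr M (X k) ∧ L < (Finset.univ.filter fun i => X j i ≠ X k i).card)) (fun _ _ => Finset.sum_nonneg fun _ _ => ind_nonneg _) (Finset.mem_univ j)
    _ ≤ ∑ j : Fin q, ∑ k : Fin q, 1 / 2 ^ L := by
        rw [av_sum]
        simp only [av_sum]
        exact Finset.sum_le_sum fun j _ => Finset.sum_le_sum fun k _ => hpair _ _
    _ = _ := by simp; ring

end indist

/-! ### Putting the pieces together -/

section main
variable {n q : ℕ}

noncomputable def EE (p e : ℝ) (G : (Fin n → Bool) → (Fin n → Bool) → ((Fin n → Bool) → Fin n → Bool) →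
    ((Fin n → Bool) → ZMod 2) → ℝ) : ℝ :=
  av (piw (bw (1 / 2))) fun M => av (piw (bw p)) fun a => av (piw (piw (bw e))) fun s =>
    av ru fun r => G M a s r

lemma av_pair {ι κ κ' : Type*} [Fintype ι] [DecidableEq ι] [Fintype κ] [Fintype κ']
    (w1 : κ → ℝ) (w2 : κ' → ℝ) (F : (ι → κ × κ') → ℝ) :
    av (piw fun bc : κ × κ' => w1 bc.1 * w2 bc.2) F =
      av (piw w1) (fun M => av (piw w2) (fun a => F fun i => (M i, a i))) := by
  unfold av piw
  simp only [Finset.mul_sum]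
  rw [← Fintype.sum_prod_type' (fun (M : ι → κ) (a : ι → κ') =>
    (∏ i, w1 (M i)) * ((∏ i, w2 (a i)) * F fun i => (M i, a i)))]
  refine Fintype.sum_equiv (Equiv.arrowProdEquivProdArrow ι (fun _ => κ) (fun _ => κ')) _ _ fun ω => ?_
  rw [Finset.prod_mul_distrib, mul_assoc]
  rfl

def zc (M a : Fin n → Bool) : ℕ := (Finset.univ.filter fun i => (M i || a i) = true).card

lemma zcheb {p : ℝ} (hp0 : 0 ≤ p) (hp1 : p ≤ 1) {t : ℝ} (ht : 0 < t) :
    av (piw (bw (1 / 2))) (fun M : Fin n → Bool => av (piw (bw p)) (fun a =>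
      ind (t ≤ |(zc M a : ℝ) - n * (1 / 2 + p / 2)|))) ≤ n / t ^ 2 := by
  set w : Bool × Bool → ℝ := fun bc => bw (1 / 2) bc.1 * bw p bc.2 with hw
  have hwp : IsPr w := by
    constructor
    · intro x
      exact mul_nonneg ((bw_pr (by norm_num) (by norm_num)).nn _) ((bw_pr hp0 hp1).nn _)
    · simp only [hw, Fintype.sum_prod_type]; simp [bw]; ring
  have h := cheb (ι := Fin n) hwp (fun bc => (if (bc.1 || bc.2) = true then 1 else 0) - (1 / 2 + p / 2))
    (by rintro ⟨b, c⟩; cases b <;> cases c <;> simp [abs_le] <;> (try constructor) <;> linarith)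
    (by simp only [hw, av, Fintype.sum_prod_type]; simp [bw]; ring) ht
  rw [hw, av_pair] at h
  simp only [Finset.sum_sub_distrib, Finset.sum_boole, Finset.sum_const, Finset.card_univ, Fintype.card_fin,
    nsmul_eq_mul] at h
  exact h

lemma mcheb {t : ℝ} (ht : 0 < t) :
    av (piw (bw (1 / 2))) (fun M : Fin n → Bool =>
      ind (t ≤ |(msz M : ℝ) - n * (1 / 2)|)) ≤ n / t ^ 2 := by
  have h := cheb (ι := Fin n) (bw_pr (p := 1 / 2) (by norm_num) (by norm_num))
    (fun b => (if b = true then 1 else 0) - (1 / 2))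
    (by rintro b; cases b <;> simp [abs_le] <;> norm_num)
    (by simp [av_bw]; norm_num) ht
  simp only [Finset.sum_sub_distrib, Finset.sum_boole, Finset.sum_const, Finset.card_univ, Fintype.card_fin,
    nsmul_eq_mul] at h
  exact h

lemma EE_mono {p e : ℝ} (hp0 : 0 ≤ p) (hp1 : p ≤ 1) (he0 : 0 ≤ e) (he1 : e ≤ 1)
    {G H : (Fin n → Bool) → (Fin n → Bool) → ((Fin n → Bool) → Fin n → Bool) →
    ((Fin n → Bool) → ZMod 2) → ℝ} (h : ∀ M a s r, G M a s r ≤ H M a s r) : EE p e G ≤ EE p e H :=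
  av_mono (piw_pr (bw_pr (by norm_num) (by norm_num))) fun M => av_mono (piw_pr (bw_pr hp0 hp1)) fun a =>
    av_mono (piw_pr (piw_pr (bw_pr he0 he1))) fun s => av_mono ru_pr fun r => h M a s r

lemma EE_const {p e : ℝ} (hp0 : 0 ≤ p) (hp1 : p ≤ 1) (he0 : 0 ≤ e) (he1 : e ≤ 1) (c : ℝ) :
    EE (n := n) p e (fun _ _ _ _ => c) = c := by
  unfold EE
  simp only [av_const ru_pr, av_const (piw_pr (piw_pr (bw_pr he0 he1))), av_const (piw_pr (bw_pr hp0 hp1)),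
    av_const (piw_pr (bw_pr (p := 1 / 2) (by norm_num) (by norm_num)))]

lemma EE_add {p e : ℝ} (G H : (Fin n → Bool) → (Fin n → Bool) → ((Fin n → Bool) → Fin n → Bool) →
    ((Fin n → Bool) → ZMod 2) → ℝ) :
    EE p e (fun M a s r => G M a s r + H M a s r) = EE p e G + EE p e H := by
  unfold EE; simp only [av_add]

lemma EE_smul {p e : ℝ} (c : ℝ) (G : (Fin n → Bool) → (Fin n → Bool) → ((Fin n → Bool) → Fin n → Bool) →
    ((Fin n → Bool) → ZMod 2) → ℝ) :
    EE p e (fun M a s r => c * G M a s r) = c * EE p e G := by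
  unfold EE; simp only [av_smul]

lemma EE_av {p e : ℝ} {Ω : Type*} [Fintype Ω] (w : Ω → ℝ) (G : Ω → (Fin n → Bool) → (Fin n → Bool) → ((Fin n → Bool) → Fin n → Bool) →
    ((Fin n → Bool) → ZMod 2) → ℝ) :
    EE p e (fun M a s r => av w fun ω => G ω M a s r) = av w fun ω => EE p e (G ω) := by
  unfold EE
  symm
  refine (av_comm _).trans ?_
  congr 1; funext M
  refine (av_comm _).trans ?_
  congr 1; funext a
  refine (av_comm _).trans ?_
  congr 1; funext s
  exact av_comm _

lemma yes_junta {p e β : ℝ} {k : ℕ} (hp0 : 0 ≤ p) (hp1 : p ≤ 1) (he0 : 0 ≤ e) (he1 : e ≤ 1)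
    (hn : 0 < n) (hk : ∀ m : ℕ, (m : ℝ) ≤ β → m ≤ k)
    (hβ : n * (1 / 2 + p / 2) + 5 * √n ≤ β) :
    EE (n := n) p e (fun M a s r => ind (¬ IsJunta n k (fn M a s r))) ≤ 1 / 25 := by
  have hs : 0 < √(n : ℝ) := Real.sqrt_pos.2 (by exact_mod_cast hn)
  have h1 : EE (n := n) p e (fun M a s r => ind (¬ IsJunta n k (fn M a s r))) ≤
      EE (n := n) p e (fun M a _ _ => ind (5 * √n ≤ |(zc M a : ℝ) - n * (1 / 2 + p / 2)|)) := by
    refine EE_mono hp0 hp1 he0 he1 fun M a s r => ind_mono fun h => ?_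
    by_contra hc
    apply h
    apply fn_junta
    apply hk
    push Not at hc
    have := (abs_lt.1 hc).2
    unfold zc at this
    linarith
  refine h1.trans ?_
  unfold EE
  simp only [av_const ru_pr, av_const (piw_pr (piw_pr (bw_pr he0 he1)))]
  refine (zcheb hp0 hp1 (by positivity)).trans_eq ?_
  rw [mul_pow, Real.sq_sqrt (by positivity)]
  have : (n : ℝ) ≠ 0 := by positivity
  field_simp; norm_num

lemma no_far {p e ε α : ℝ} {k : ℕ} (hp0 : 0 ≤ p) (hp1 : p ≤ 1) (he0 : 0 ≤ e) (he1 : e ≤ 1)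
    (hε0 : 0 < ε) (hε1 : ε ≤ 1 / 6)
    (hn : 0 < n) (hk : (k : ℝ) + 10 * √n ≤ n * (1 / 2 + p / 2)) (he : 30 * ε ≤ e * (5 * √n))
    (hα : α < 1)
    (H2 : n / ((1 - α) * n / 2) ^ 2 ≤ (1 / 100 : ℝ))
    (H3 : ∀ m : ℕ, α * n / 2 ≤ m → 18 * n / (2 : ℝ) ^ m ≤ 1 / 100)
    (H4 : ∀ m : ℕ, α * n / 2 ≤ m → (2 : ℝ) ^ n * Real.exp (- ε * 2 ^ m) ≤ 1 / 100) :
    EE (n := n) p e (fun M a s r => ind (¬ FarFromJuntas n k ε (fn M a s r))) ≤ 7 / 100 := by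
  have hs : 0 < √(n : ℝ) := Real.sqrt_pos.2 (by exact_mod_cast hn)
  have hn' : (0 : ℝ) < n := by exact_mod_cast hn
  have hm := piw_pr (ι := Fin n) (bw_pr (p := 1 / 2) (by norm_num) (by norm_num))
  have ha := piw_pr (ι := Fin n) (bw_pr hp0 hp1)
  have hss := piw_pr (ι := Fin n → Bool) (piw_pr (ι := Fin n) (bw_pr he0 he1))
  set Q1 : (Fin n → Bool) → (Fin n → Bool) → Prop := fun M a =>
    5 * √n ≤ |(zc M a : ℝ) - n * (1 / 2 + p / 2)| with hQ1
  set Q2 : (Fin n → Bool) → Prop := fun M => (1 - α) * n / 2 ≤ |(msz M : ℝ) - n * (1 / 2)| with hQ2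
  set Q3 : (Fin n → Bool) → (Fin n → Bool) → ((Fin n → Bool) → Fin n → Bool) →
    ((Fin n → Bool) → ZMod 2) → Prop := fun M a s r => ∃ i ∈ Finset.univ, α * n / 2 ≤ msz M ∧ M i = true ∧
      ¬ ((2 : ℝ) ^ n / 3 ≤ (Finset.univ.filter fun x => fn M a s r x ≠ fn M a s r (flp i x)).card) with hQ3
  set Q4 : (Fin n → Bool) → ((Fin n → Bool) → Fin n → Bool) → Prop := fun M s =>
    ∃ B ∈ (Finset.univ : Finset (Finset (Fin n))), α * n / 2 ≤ msz M ∧ 5 * √n ≤ B.card ∧ ¬ (2 * ε * 2 ^ n ≤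
      ((Finset.univ.filter fun x => ∃ i ∈ B, s (addr M x) i = true).card : ℝ)) with hQ4
  have hpt : ∀ M a s r, ind (¬ FarFromJuntas n k ε (fn M a s r)) ≤
      ind (Q1 M a) + ind (Q2 M) + ind (Q3 M a s r) + ind (Q4 M s) := by
    intro M a s r
    have himp : ¬ FarFromJuntas n k ε (fn M a s r) → ((Q1 M a ∨ Q2 M) ∨ Q3 M a s r) ∨ Q4 M s := by
      intro h
      by_contra hc
      push Not at hc
      obtain ⟨⟨⟨h1, h2⟩, h3⟩, h4⟩ := hc
      simp only [hQ1, not_le] at h1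
      simp only [hQ2, not_le] at h2
      have hmsz : α * n / 2 ≤ msz M := by
        have := (abs_lt.1 h2).1
        linarith
      apply h
      refine fn_far M a s r k (5 * √n) ε hε1 ?_ ?_ ?_
      · have := (abs_lt.1 h1).1
        unfold zc at this
        linarith
      · intro i hi
        by_contra hc
        exact h3 ⟨i, Finset.mem_univ _, hmsz, hi, hc⟩
      · intro B _ hB
        by_contra hc
        exact h4 ⟨B, Finset.mem_univ _, hmsz, hB, hc⟩
    refine (ind_mono himp).trans ?_
    have := ind_or ((Q1 M a ∨ Q2 M) ∨ Q3 M a s r) (Q4 M s)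
    have := ind_or (Q1 M a ∨ Q2 M) (Q3 M a s r)
    have := ind_or (Q1 M a) (Q2 M)
    linarith
  refine (EE_mono hp0 hp1 he0 he1 hpt).trans ?_
  rw [EE_add, EE_add, EE_add]
  have b1 : EE (n := n) p e (fun M a _ _ => ind (Q1 M a)) ≤ 1 / 25 := by
    unfold EE
    simp only [av_const ru_pr, av_const hss]
    refine (zcheb hp0 hp1 (by positivity)).trans_eq ?_
    rw [mul_pow, Real.sq_sqrt (by positivity)]
    field_simp; norm_num
  have b2 : EE (n := n) p e (fun M _ _ _ => ind (Q2 M)) ≤ 1 / 100 := by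
    unfold EE
    simp only [av_const ru_pr, av_const hss, av_const ha]
    refine (mcheb ?_).trans H2
    have : 0 < 1 - α := by linarith
    positivity
  have b3 : EE (n := n) p e (fun M a s r => ind (Q3 M a s r)) ≤ 1 / 100 := by
    refine av_le hm fun M => av_le ha fun a => av_le hss fun s => ?_
    refine (av_mono ru_pr fun r => ind_exists_le _ _).trans ?_
    rw [av_sum]
    by_cases hM : α * n / 2 ≤ msz M
    · refine le_trans ?_ (H3 _ hM)
      calc _ ≤ ∑ i : Fin n, (18 : ℝ) / 2 ^ msz M := by
            refine Finset.sum_le_sum fun i _ => ?_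
            by_cases hi : M i = true
            · refine (av_mono ru_pr fun r => ind_mono fun h => h.2.2).trans (conc1 M a s i hi)
            · refine av_le ru_pr fun r => ?_
              rw [ind_false fun h => hi h.2.1]; positivity
        _ = _ := by simp; ring
    · refine (Finset.sum_nonpos fun i _ => av_le ru_pr fun r => ?_).trans (by norm_num)
      rw [ind_false fun h => hM h.1]
  have b4 : EE (n := n) p e (fun M _ s _ => ind (Q4 M s)) ≤ 1 / 100 := by
    unfold EE
    simp only [av_const ru_pr]
    refine av_le hm fun M => av_le ha fun a => ?_
    refine (av_mono hss fun r => ind_exists_le _ _).trans ?_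
    rw [av_sum]
    by_cases hM : α * n / 2 ≤ msz M
    · refine le_trans ?_ (H4 _ hM)
      calc _ ≤ ∑ B : Finset (Fin n), Real.exp (- ε * 2 ^ msz M) := by
            refine Finset.sum_le_sum fun B _ => ?_
            by_cases hB : 5 * √n ≤ B.card
            · refine (av_mono hss fun s => ind_mono fun h => h.2.2).trans
                (conc2 M B he0 he1 hε0 hε1 (he.trans ?_))
              gcongr
            · refine av_le hss fun s => ?_
              rw [ind_false fun h => hB h.2.1]; positivity
        _ = _ := by simp
    · refine (Finset.sum_nonpos fun i _ => av_le hss fun r => ?_).trans (by norm_num)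
      rw [ind_false fun h => hM h.1]
  linarith

lemma acc_eq (A : RandNonAdaptive n q) (f : (Fin n → Bool) → Bool) :
    acceptProb A f = av A.w (fun P => ind (P.2 (fun i => f (P.1 i)) = true)) := by
  unfold acceptProb av ind
  refine Finset.sum_congr rfl fun P _ => ?_
  by_cases h : P.2 (fun i => f (P.1 i)) = true <;> simp [h]

lemma acc_rej (A : RandNonAdaptive n q) (f : (Fin n → Bool) → Bool) :
    acceptProb A f + rejectProb A f = 1 := by
  unfold acceptProb rejectProb
  rw [← Finset.sum_add_distrib, ← A.sum_eq_one]
  refine Finset.sum_congr rfl fun P _ => ?_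
  cases P.2 (fun i => f (P.1 i)) <;> simp

lemma core {p p' e ε u0 : ℝ} {k L : ℕ} (A : RandNonAdaptive n q) (hA : IsJuntaTester n k q ε A)
    (hp0 : 0 < p) (hp1 : p < 1) (hp'0 : 0 ≤ p') (hp'1 : p' ≤ 1)
    (he0 : 0 ≤ e) (he1 : e ≤ 1) (hu0 : 0 < u0)
    (hu : ∀ u : ℕ, (u : ℝ) ≤ u0 → (1 + (p' - p) ^ 2 / (p * (1 - p))) ^ u - 1 ≤ (1 / 4 : ℝ) ^ 2)
    (hL : (q : ℝ) ^ 2 / 2 ^ L ≤ 1 / 16)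
    (hy : EE (n := n) p e (fun M a s r => ind (¬ IsJunta n k (fn M a s r))) ≤ 1 / 25)
    (hno : EE (n := n) p' e (fun M a s r => ind (¬ FarFromJuntas n k ε (fn M a s r))) ≤ 7 / 100) :
    1 / 10 < e * (q * L) / u0 := by
  have hm := piw_pr (ι := Fin n) (bw_pr (p := 1 / 2) (by norm_num) (by norm_num))
  have ha := piw_pr (ι := Fin n) (bw_pr hp0.le hp1.le)
  have ha' := piw_pr (ι := Fin n) (bw_pr hp'0 hp'1)
  have hss := piw_pr (ι := Fin n → Bool) (piw_pr (ι := Fin n) (bw_pr he0 he1))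
  have hw : IsPr A.w := ⟨A.nonneg, A.sum_eq_one⟩
  have acc0 : ∀ f, 0 ≤ acceptProb A f := fun f => by
    rw [acc_eq]; exact av_nonneg hw fun _ => ind_nonneg _
  have acc1 : ∀ f, acceptProb A f ≤ 1 := fun f => by
    rw [acc_eq]; exact av_le hw fun _ => ind_le_one _
  have Y : 5 / 6 + (-5 / 6) * (1 / 25) ≤ EE (n := n) p e (fun M a s r => acceptProb A (fn M a s r)) := by
    have h1 : EE (n := n) p e (fun M a s r => 5 / 6 + (-5 / 6) * ind (¬ IsJunta n k (fn M a s r))) ≤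
        EE (n := n) p e (fun M a s r => acceptProb A (fn M a s r)) := by
      refine EE_mono hp0.le hp1.le he0 he1 fun M a s r => ?_
      by_cases h : IsJunta n k (fn M a s r)
      · rw [ind_false (not_not.2 h)]; linarith [hA.1 _ h]
      · rw [ind_true h]; linarith [acc0 (fn M a s r)]
    rw [EE_add, EE_const hp0.le hp1.le he0 he1, EE_smul] at h1
    linarith
  have N : EE (n := n) p' e (fun M a s r => acceptProb A (fn M a s r)) ≤ 1 / 6 + 5 / 6 * (7 / 100) := by
    have h1 : EE (n := n) p' e (fun M a s r => acceptProb A (fn M a s r)) ≤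
        EE (n := n) p' e (fun M a s r => 1 / 6 + 5 / 6 * ind (¬ FarFromJuntas n k ε (fn M a s r))) := by
      refine EE_mono hp'0 hp'1 he0 he1 fun M a s r => ?_
      by_cases h : FarFromJuntas n k ε (fn M a s r)
      · rw [ind_false (not_not.2 h)]; linarith [hA.2 _ h, acc_rej A (fn M a s r)]
      · rw [ind_true h]; linarith [acc1 (fn M a s r)]
    rw [EE_add, EE_const hp'0 hp'1 he0 he1, EE_smul] at h1
    linarith
  have D : EE (n := n) p e (fun M a s r => acceptProb A (fn M a s r)) -
      EE (n := n) p' e (fun M a s r => acceptProb A (fn M a s r)) ≤ 1 / 16 + (1 / 4 + e * (q * L) / u0) := by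
    simp only [acc_eq]
    rw [EE_av A.w (fun P M a s r => ind (P.2 (fun i => fn M a s r (P.1 i)) = true)),
      EE_av A.w (fun P M a s r => ind (P.2 (fun i => fn M a s r (P.1 i)) = true)), ← av_sub]
    refine av_le hw fun P => ?_
    unfold EE
    rw [← av_sub]
    refine le_trans ?_ (add_le_add_left ((bad_M P.1 L).trans hL) _)
    rw [← av_const hm (1 / 4 + e * (q * L) / u0), ← av_add]
    refine av_mono hm fun M => ?_
    dsimp only
    by_cases hg : ∀ j k, addr M (P.1 j) = addr M (P.1 k) →
      (Finset.univ.filter fun i => P.1 j i ≠ P.1 k i).card ≤ L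
    · have := indist M P.1 P.2 L hg hp0 hp1 hp'0 hp'1 he0 he1 (by norm_num : (0 : ℝ) ≤ 1 / 4) hu0 hu
      rw [ind_false (not_not.2 hg)]
      linarith
    · rw [ind_true hg]
      have h1 : av (piw (bw p)) (fun a => av (piw (piw (bw e))) (fun s => av ru (fun r =>
        ind (P.2 (fun j => fn M a s r (P.1 j)) = true)))) ≤ 1 :=
        av_le ha fun a => av_le hss fun s => av_le ru_pr fun r => ind_le_one _
      have h2 : 0 ≤ av (piw (bw p')) (fun a => av (piw (piw (bw e))) (fun s => av ru (fun r =>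
        ind (P.2 (fun j => fn M a s r (P.1 j)) = true)))) :=
        av_nonneg ha' fun a => av_nonneg hss fun s => av_nonneg ru_pr fun r => ind_nonneg _
      have h3 : 0 ≤ e * (q * L) / u0 := by positivity
      linarith
  linarith

end main

/-! ### Asymptotics -/

lemma ev_exp (γ C : ℝ) (hγ : 0 < γ) (hC : 0 < C) :
    ∃ n₀ : ℕ, ∀ n : ℕ, n₀ ≤ n → C * n ≤ (2 : ℝ) ^ (γ * n) := by
  have hb : (2 : ℝ) ^ (-γ) < 1 := Real.rpow_lt_one_of_one_lt_of_neg (by norm_num) (by linarith)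
  have hb0 : (0 : ℝ) < (2 : ℝ) ^ (-γ) := by positivity
  have h := tendsto_self_mul_const_pow_of_abs_lt_one (r := (2 : ℝ) ^ (-γ)) (by rw [abs_of_pos hb0]; exact hb)
  have h2 := (h.eventually (gt_mem_nhds (by positivity : (0 : ℝ) < 1 / C)))
  obtain ⟨n₀, hn₀⟩ := Filter.eventually_atTop.1 h2
  refine ⟨n₀, fun n hn => ?_⟩
  have := hn₀ n hn
  rw [← Real.rpow_natCast, ← Real.rpow_mul (by norm_num), neg_mul, Real.rpow_neg (by norm_num),
    ← div_eq_mul_inv, div_lt_div_iff₀ (by positivity) hC] at this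
  linarith

lemma ev_lin (C : ℝ) : ∃ n₀ : ℕ, ∀ n : ℕ, n₀ ≤ n → C ≤ √(n : ℝ) := by
  obtain ⟨m, hm⟩ := exists_nat_ge (C ^ 2)
  refine ⟨m, fun n hn => Real.le_sqrt_of_sq_le (hm.trans (by exact_mod_cast hn))⟩

lemma aux1 {S : ℝ} (h : 100 ≤ S) : 10000 ≤ S * S := by nlinarith

lemma aux2 {η S : ℝ} (h : 20 ≤ η * S) : 400 ≤ η * η * (S * S) := by nlinarith

lemma aux3 {x ε : ℝ} (hx : 0 < x) (h : ε ≤ 1 / 6) : x * ε ≤ x := by nlinarith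

lemma aux4 {a b c : ℝ} (ha : 0 ≤ a) (hb : 1 ≤ b) (hc : a ≤ c) : a ≤ b * c := by nlinarith

set_option maxHeartbeats 4000000 in
theorem stmt1 (α : ℝ) (hα₁ : 1 / 2 < α) (hα₂ : α < 1) :
    ∃ (c : ℝ) (n₀ : ℕ), 0 < c ∧
      ∀ (n q : ℕ) (ε : ℝ) (A : RandNonAdaptive n q),
        n₀ ≤ n →
        (2 : ℝ) ^ (-((2 * α - 1) * (n : ℝ) / 2)) ≤ ε → ε ≤ 1 / 6 →
        IsJuntaTester n ⌊α * (n : ℝ)⌋₊ q ε A →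
        c * (n : ℝ) ^ ((3 : ℝ) / 2) /
            (ε * (Real.logb 2 n) ^ 3 * (Real.logb 2 ((n : ℝ) / ε)) ^ 3) ≤ (q : ℝ) := by
  set κ : ℝ := 2 * α - 1 with hκ
  set η : ℝ := 1 - α with hη
  have hκ0 : 0 < κ := by rw [hκ]; linarith
  have hκ1 : κ < 1 := by rw [hκ]; linarith
  have hη0 : 0 < η := by rw [hη]; linarith
  have hη1 : η < 1 := by rw [hη]; linarith
  obtain ⟨n1, hn1⟩ := ev_exp (α / 2) 1800 (by linarith) (by norm_num)
  obtain ⟨n2, hn2⟩ := ev_exp (η / 2) 2 (by linarith) (by norm_num)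
  obtain ⟨n3, hn3⟩ := ev_lin (20 / κ + 20 / η + 100)
  refine ⟨κ * η / 10 ^ 8, max n1 (max n2 n3), by positivity, ?_⟩
  intro n q ε A hn hεlow hε1 hA
  have h1 := hn1 n (le_trans (le_max_left _ _) hn)
  have h2 := hn2 n (le_trans ((le_max_left _ _).trans (le_max_right _ _)) hn)
  have h3 := hn3 n (le_trans ((le_max_right _ _).trans (le_max_right _ _)) hn)
  set S : ℝ := √(n : ℝ) with hS
  have hk0 : 0 < 20 / κ := by positivity
  have hk1 : 0 < 20 / η := by positivity
  have hS100 : 100 ≤ S := by linarith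
  have hS0 : 0 < S := by linarith
  have hSκ : 20 ≤ κ * S := by
    have : 20 / κ ≤ S := by linarith
    rw [div_le_iff₀ hκ0] at this; linarith
  have hSη : 20 ≤ η * S := by
    have : 20 / η ≤ S := by linarith
    rw [div_le_iff₀ hη0] at this; linarith
  have hSS : S * S = n := Real.mul_self_sqrt (by positivity)
  have hnbig : (10000 : ℝ) ≤ n := by rw [← hSS]; exact aux1 hS100
  have hnpos : 0 < n := by
    have : (0 : ℝ) < n := by linarith
    exact_mod_cast this
  have hn0 : (0 : ℝ) < n := by exact_mod_cast hnpos
  have hε0 : 0 < ε := lt_of_lt_of_le (by positivity) hεlow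
  -- parameters
  set p : ℝ := κ - 10 / S with hp
  set p' : ℝ := κ + 20 / S with hp'
  set e : ℝ := 6 * ε / S with he
  set u0 : ℝ := n * (κ * η) / 18000 with hu0
  have h10 : 10 / S ≤ κ / 2 := by rw [div_le_iff₀ hS0]; linarith
  have h20 : 20 / S ≤ η := by rw [div_le_iff₀ hS0]; linarith
  have h10' : 0 < 10 / S := by positivity
  have h20' : 0 < 20 / S := by positivity
  have hp0 : 0 < p := by linarith
  have hp1 : p < 1 := by linarith
  have hp'0 : 0 ≤ p' := by linarith
  have hp'1 : p' ≤ 1 := by rw [hp', hκ]; rw [hη] at h20; linarith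
  have he0 : 0 ≤ e := by positivity
  have he1 : e ≤ 1 := by rw [he, div_le_one hS0]; linarith
  have hu00 : 0 < u0 := by positivity
  have hnS : (n : ℝ) / S = S := by rw [← hSS]; field_simp
  have hαn : 0 ≤ α * n := by positivity
  have hmean : (n : ℝ) * (1 / 2 + p / 2) = α * n - 5 * S := by
    have : (n : ℝ) * (10 / S) = 10 * S := by rw [mul_div_assoc', mul_comm, mul_div_assoc, hnS]
    rw [hp, hκ]; linarith
  have hmean' : (n : ℝ) * (1 / 2 + p' / 2) = α * n + 10 * S := by
    have : (n : ℝ) * (20 / S) = 20 * S := by rw [mul_div_assoc', mul_comm, mul_div_assoc, hnS]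
    rw [hp', hκ]; linarith
  have hyes := yes_junta (n := n) (β := α * n) (k := ⌊α * (n : ℝ)⌋₊) hp0.le hp1.le he0 he1 hnpos
    (fun m hm => Nat.le_floor hm) (by rw [hmean]; linarith)
  have hpw : ∀ m : ℕ, α * n / 2 ≤ m → (2 : ℝ) ^ (α / 2 * n) ≤ (2 : ℝ) ^ m := by
    intro m hm
    rw [← Real.rpow_natCast]
    exact Real.rpow_le_rpow_of_exponent_le (by norm_num) (by linarith)
  have hno := no_far (n := n) (α := α) (k := ⌊α * (n : ℝ)⌋₊) (ε := ε) hp'0 hp'1 he0 he1 hε0 hε1 hnpos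
    (by rw [hmean']; linarith [Nat.floor_le hαn])
    (by rw [he, ← hS]; apply le_of_eq; field_simp; norm_num) hα₂
    (by
      rw [← hη, div_le_iff₀ (by positivity)]
      have : 400 ≤ η * η * n := by rw [← hSS]; exact aux2 hSη
      linarith [mul_le_mul_of_nonneg_left this hn0.le])
    (by
      intro m hm
      rw [div_le_iff₀ (by positivity)]
      have := hpw m hm
      linarith)
    (by
      intro m hm
      have hy : 2 * (n : ℝ) ≤ ε * 2 ^ m := by
        calc 2 * (n : ℝ) ≤ (2 : ℝ) ^ (η / 2 * n) := h2
          _ = (2 : ℝ) ^ (-((2 * α - 1) * (n : ℝ) / 2)) * (2 : ℝ) ^ (α / 2 * n) := by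
              rw [← Real.rpow_add (by norm_num)]; congr 1; rw [hη]; ring
          _ ≤ ε * 2 ^ m := by
              gcongr
              exact hpw m hm
      have e1 : (2 : ℝ) ^ n ≤ Real.exp n := by
        have : (2 : ℝ) ≤ Real.exp 1 := by linarith [Real.add_one_le_exp (1 : ℝ)]
        calc (2 : ℝ) ^ n ≤ Real.exp 1 ^ n := by gcongr
          _ = _ := by rw [← Real.exp_nat_mul, mul_one]
      have e2 : Real.exp (- ε * 2 ^ m) ≤ Real.exp (- (2 * (n : ℝ))) := by
        rw [Real.exp_le_exp]; linarith
      calc (2 : ℝ) ^ n * Real.exp (- ε * 2 ^ m) ≤ Real.exp n * Real.exp (- (2 * (n : ℝ))) := by gcongr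
        _ = (Real.exp n)⁻¹ := by rw [← Real.exp_add, ← Real.exp_neg]; congr 1; ring
        _ ≤ 1 / 100 := by
          rw [inv_le_comm₀ (by positivity) (by norm_num)]
          have := Real.add_one_le_exp (n : ℝ)
          norm_num; linarith)
  by_contra hcon
  push Not at hcon
  set l : ℝ := Real.logb 2 n with hl
  set l' : ℝ := Real.logb 2 ((n : ℝ) / ε) with hl'
  have hnε : (n : ℝ) ≤ n / ε := by
    rw [le_div_iff₀ hε0]; exact aux3 hn0 hε1
  have hnε0 : 0 < (n : ℝ) / ε := by positivity
  have hl1 : 1 ≤ l := by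
    rw [hl, Real.le_logb_iff_rpow_le (by norm_num) hn0, Real.rpow_one]; linarith
  have hl'1 : 1 ≤ l' := by
    rw [hl', Real.le_logb_iff_rpow_le (by norm_num) hnε0, Real.rpow_one]; linarith
  have hl3 : 1 ≤ l ^ 3 := one_le_pow₀ hl1
  have hl'3 : l' ≤ l' ^ 3 := le_self_pow₀ hl'1 (by norm_num)
  have h32 : (n : ℝ) ^ ((3 : ℝ) / 2) = n * S := by
    rw [hS, Real.sqrt_eq_rpow, ← Real.rpow_one_add' (by positivity) (by norm_num)]; norm_num
  have hq1 : (q : ℝ) * l' * ε < κ * η / 10 ^ 8 * (n * S) := by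
    rw [h32, lt_div_iff₀ (by positivity)] at hcon
    have hll : l' ≤ l ^ 3 * l' ^ 3 := aux4 (by linarith) hl3 hl'3
    have : (q : ℝ) * ε * l' ≤ (q : ℝ) * ε * (l ^ 3 * l' ^ 3) := by gcongr
    linarith
  have hκη : κ * η ≤ 1 := mul_le_one₀ hκ1.le hη0.le hη1.le
  have hq2 : (q : ℝ) ≤ (n / ε) ^ 2 := by
    have hqε : (q : ℝ) * ε ≤ n * n := by
      have a1 : (q : ℝ) * ε ≤ q * l' * ε := by
        have : 0 ≤ (q : ℝ) * ε := by positivity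
        linarith [mul_le_mul_of_nonneg_left hl'1 this]
      have a2 : κ * η / 10 ^ 8 * (n * S) ≤ n * n := by
        have hSn : S ≤ n := by rw [← hSS]; exact le_mul_of_one_le_left hS0.le (by linarith)
        calc κ * η / 10 ^ 8 * (n * S) ≤ 1 * (n * n) := by
              gcongr
              rw [div_le_one (by norm_num)]; linarith
          _ = _ := one_mul _
      linarith
    rw [div_pow, le_div_iff₀ (by positivity)]
    have : (q : ℝ) * ε * ε ≤ n * n * 1 := by
      gcongr
      linarith
    linarith
  have hcore := core (L := ⌈4 * l' + 4⌉₊) (u0 := u0) A hA hp0 hp1 hp'0 hp'1 he0 he1 hu00 ?_ ?_ hyes hno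
  · have hLle : ((⌈4 * l' + 4⌉₊ : ℕ) : ℝ) ≤ 9 * l' := by
      have := Nat.ceil_lt_add_one (by linarith : 0 ≤ 4 * l' + 4)
      linarith
    rw [lt_div_iff₀ hu00] at hcore
    have : e * (q * (⌈4 * l' + 4⌉₊ : ℕ)) ≤ e * (q * (9 * l')) := by gcongr
    have h5 : e * (q * (9 * l')) = 54 * (q * l' * ε) / S := by rw [he]; ring
    have h6 : 54 * (q * l' * ε) / S < 54 * (κ * η / 10 ^ 8 * n) := by
      rw [div_lt_iff₀ hS0]; linarith
    have h7 : 0 < κ * η * n := by positivity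
    rw [hu0] at hcore
    linarith
  · intro u hu
    have hd : (p' - p) ^ 2 / (p * (1 - p)) ≤ 900 / (n * (κ * η)) := by
      have e1 : (p' - p) ^ 2 = 900 / n := by rw [hp, hp', ← hSS]; field_simp; ring
      have e2 : κ * η ≤ p * (1 - p) := by
        have a1 : κ / 2 ≤ p := by linarith
        have a2 : 2 * η ≤ 1 - p := by rw [hp, hκ, hη]; linarith
        calc κ * η = κ / 2 * (2 * η) := by ring
          _ ≤ p * (1 - p) := by gcongr
      rw [e1, div_div]
      gcongr
    have hp1p : 0 < p * (1 - p) := mul_pos hp0 (by linarith)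
    have h5 : (1 + (p' - p) ^ 2 / (p * (1 - p))) ^ u ≤ Real.exp (1 / 20) := by
      calc (1 + (p' - p) ^ 2 / (p * (1 - p))) ^ u ≤ (Real.exp (900 / (n * (κ * η)))) ^ u := by
            gcongr
            linarith [Real.add_one_le_exp (900 / (n * (κ * η)))]
        _ = Real.exp (u * (900 / (n * (κ * η)))) := by rw [← Real.exp_nat_mul]
        _ ≤ _ := by
            rw [Real.exp_le_exp, mul_div_assoc', div_le_iff₀ (by positivity)]
            rw [hu0] at hu
            linarith
    have h6 : Real.exp (1 / 20) ≤ 20 / 19 := by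
      have := Real.one_sub_le_exp_neg (1 / 20)
      rw [Real.exp_neg] at this
      have h7 := Real.exp_pos (1 / 20)
      have h8 : Real.exp (1 / 20) * (Real.exp (1 / 20))⁻¹ = 1 := mul_inv_cancel₀ h7.ne'
      linarith [mul_le_mul_of_nonneg_left this h7.le]
    norm_num at h6 ⊢
    norm_num at h5
    linarith
  · rw [div_le_iff₀ (by positivity)]
    have h5 : (n / ε) ^ 4 * 16 ≤ (2 : ℝ) ^ ⌈4 * l' + 4⌉₊ := by
      rw [← Real.rpow_natCast 2 ⌈4 * l' + 4⌉₊]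
      calc (n / ε) ^ 4 * 16 = (2 : ℝ) ^ (4 * l' + 4) := by
            rw [Real.rpow_add (by norm_num), mul_comm 4 l', Real.rpow_mul (by norm_num), hl',
              Real.rpow_logb (by norm_num) (by norm_num) hnε0]
            norm_num
        _ ≤ _ := Real.rpow_le_rpow_of_exponent_le (by norm_num) (Nat.le_ceil _)
    have h6 : (q : ℝ) ^ 2 ≤ (n / ε) ^ 4 := by
      calc (q : ℝ) ^ 2 ≤ ((n / ε) ^ 2) ^ 2 := by gcongr
        _ = _ := by ring
    linarith
end
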